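/- arXiv:2408.07950 — 4 statements merged into one kernel-verified Lean document; each statement's English description precedes it below -/
import Mathlib

section
/- Let γ₁, γ₂ be simple paths with ranges Γ₁, Γ₂ such that the symmetric difference Γ₁ Δ Γ₂ is contained in a compact set. Let A₁ be a connected component of ℝ² ∖ Γ₁. Then there exists a unique connected component A₂ of ℝ² ∖ Γ₂ such that A₁ Δ A₂ is bounded. -/
noncomputable section

/-- The lattice ℤ². -/
abbrev Z2 := ℤ × ℤ
/-- The plane ℝ². -/
abbrev R2 := ℝ × ℝ

/-- The ℓ¹ distance on the plane. -/
def d1 (x y : R2) : ℝ := |x.1 - y.1| + |x.2 - y.2|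

/-- The ℓ¹ distance from a point to a set. -/
def d1S (x : R2) (S : Set R2) : ℝ := sInf (d1 x '' S)

/-- The logarithmic distance on the plane: d_l(x,y) = ln(1 + d₁(x,y)). -/
def dl (x y : R2) : ℝ := Real.log (1 + d1 x y)

/-- The logarithmic distance from a point to a set. -/
def dlS (x : R2) (S : Set R2) : ℝ := Real.log (1 + d1S x S)

/-- The Euclidean norm on the plane. -/
def eunorm (x : R2) : ℝ := Real.sqrt (x.1 ^ 2 + x.2 ^ 2)

/-- The Euclidean distance on the plane. -/
def eudist (x y : R2) : ℝ := eunorm (x - y)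

/-- The embedding of ℤ² into ℝ². -/
def emb (x : Z2) : R2 := ((x.1 : ℝ), (x.2 : ℝ))

/-- Ψ_{U,V}(x) = 1 + d₁(x,∂U) + d₁(x,∂V). -/
def Psi (U V : Set R2) (x : R2) : ℝ := 1 + d1S x (frontier U) + d1S x (frontier V)

/-- U and V are transverse: for some c ∈ (0,1), Ψ_{U,V}(x) ≥ |x|ᶜ whenever |x| ≥ 1/c. -/
def Transverse (U V : Set R2) : Prop :=
  ∃ c : ℝ, 0 < c ∧ c < 1 ∧ ∀ x : R2, 1 / c ≤ eunorm x → eunorm x ^ c ≤ Psi U V x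

/-- The operator norm of an m×m complex matrix. -/
def matNorm {m : ℕ} (M : Matrix (Fin m) (Fin m) ℂ) : ℝ :=
  ‖Matrix.toEuclideanCLM (𝕜 := ℂ) M‖

/-- The real-valued indicator function of a subset of the plane. -/
def indR (W : Set R2) (z : R2) : ℝ := Set.indicator W (fun _ => (1:ℝ)) z

/-- A simple path: continuous, injective, proper, smooth outside a closed discrete set,
with unit left and right derivatives everywhere. -/
structure IsSimplePath (γ : ℝ → R2) : Prop where
  continuous : Continuous γ
  injective : Function.Injective γ
  proper : ∀ K : Set R2, IsCompact K → IsCompact (γ ⁻¹' K)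
  smooth : ∃ S : Set ℝ, IsClosed S ∧ DiscreteTopology ↥S ∧ ContDiffOn ℝ (⊤ : ℕ∞) γ Sᶜ
  deriv_right : ∀ t : ℝ, ∃ v : R2, HasDerivWithinAt γ v (Set.Ici t) t ∧ eunorm v = 1
  deriv_left : ∀ t : ℝ, ∃ v : R2, HasDerivWithinAt γ v (Set.Iic t) t ∧ eunorm v = 1

/-- A simple loop: periodic, injective over a period, smooth outside a closed discrete set,
with unit left and right derivatives everywhere. -/
structure IsSimpleLoop (γ : ℝ → R2) : Prop where
  continuous : Continuous γ
  periodic : ∃ T : ℝ, 0 < T ∧ Function.Periodic γ T ∧ Set.InjOn γ (Set.Ico 0 T)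
  smooth : ∃ S : Set ℝ, IsClosed S ∧ DiscreteTopology ↥S ∧ ContDiffOn ℝ (⊤ : ℕ∞) γ Sᶜ
  deriv_right : ∀ t : ℝ, ∃ v : R2, HasDerivWithinAt γ v (Set.Ici t) t ∧ eunorm v = 1
  deriv_left : ∀ t : ℝ, ∃ v : R2, HasDerivWithinAt γ v (Set.Iic t) t ∧ eunorm v = 1

/-- A simple set: open, connected, boundary the range of a simple path or loop. -/
def IsSimpleSet (A : Set R2) : Prop :=
  IsOpen A ∧ IsConnected A ∧
    ∃ γ : ℝ → R2, (IsSimplePath γ ∨ IsSimpleLoop γ) ∧ frontier A = Set.range γ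

/-- The set of connected components of a subset of the plane. -/
def components (S : Set R2) : Set (Set R2) :=
  {C | ∃ x ∈ S, C = connectedComponentIn S x}

/-- A good set: open, int(A^c) has boundary ∂A, the connected components of ∂A are
well-separated ranges of simple paths or loops, and ∂A avoids ℤ². -/
def IsGoodSet (A : Set R2) : Prop :=
  IsOpen A ∧
  frontier (interior Aᶜ) = frontier A ∧
  (∀ Γ ∈ components (frontier A),
    ∃ γ : ℝ → R2, (IsSimplePath γ ∨ IsSimpleLoop γ) ∧ Γ = Set.range γ) ∧
  (∃ ρ : ℝ, 0 < ρ ∧ ∀ Γ ∈ components (frontier A), ∀ Γ' ∈ components (frontier A),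
    Γ ≠ Γ' → ∀ x ∈ Γ, ∀ y ∈ Γ', ρ ≤ eudist x y) ∧
  (∀ x : Z2, emb x ∉ frontier A)

/-- The open Euclidean disk. -/
def eball (z : R2) (r : ℝ) : Set R2 := {x | eudist x z < r}

/-- The closed curve obtained by following γ from γ(a) to γ(b) and then the circular
arc of the circle centered at z of radius r from angle β to angle α. -/
def ellCurve (γ : ℝ → R2) (a b : ℝ) (z : R2) (r α β : ℝ) : ℝ → R2 := fun t =>
  if t ≤ 0 then γ (b * (1 + t) - a * t)
  else (z.1 + r * Real.cos ((1 - t) * β + t * α), z.2 + r * Real.sin ((1 - t) * β + t * α))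

/-- L is the left of γ in the disk of center z and radius r: the disk is simply split
by γ, and L is the bounded connected component of the complement of the closed curve ℓ. -/
def LeftInDisk (γ : ℝ → R2) (z : R2) (r : ℝ) (L : Set R2) : Prop :=
  ∃ a b α β : ℝ, a < b ∧
    γ ⁻¹' (eball z r) = Set.Ioo a b ∧
    (∃ C₁ C₂ : Set R2, C₁ ≠ C₂ ∧
      components (eball z r \ γ '' Set.Ioo a b) = {C₁, C₂}) ∧
    β < α ∧ α < β + 2 * Real.pi ∧
    γ a = (z.1 + r * Real.cos α, z.2 + r * Real.sin α) ∧
    γ b = (z.1 + r * Real.cos β, z.2 + r * Real.sin β) ∧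
    L ∈ components ((ellCurve γ a b z r α β '' Set.Icc (-1) 1)ᶜ) ∧
    Bornology.IsBounded L

/-- U lies to the left of γ: for some disk centered on the range of γ and simply split
by γ, U contains the left of γ in that disk. -/
def LiesLeftOf (U : Set R2) (γ : ℝ → R2) : Prop :=
  ∃ z ∈ Set.range γ, ∃ r : ℝ, 0 < r ∧ ∃ L : Set R2, LeftInDisk γ z r L ∧ L ⊆ U

/-- χ is the intersection number of the pair (U,V), U a simple set: 0 if ∂U is bounded;
otherwise χ₊ − χ₋ where χ_± are the limits at ±∞ of 1_V ∘ γ for a simple path γ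
parametrizing ∂U with U on its left. -/
def HasIntersectionNumber (U V : Set R2) (χ : ℤ) : Prop :=
  (Bornology.IsBounded (frontier U) ∧ χ = 0) ∨
  ((¬ Bornology.IsBounded (frontier U)) ∧
    ∃ γ : ℝ → R2, IsSimplePath γ ∧ Set.range γ = frontier U ∧ LiesLeftOf U γ ∧
      ∃ cp cm : ℝ,
        Filter.Tendsto (fun t => indR V (γ t)) Filter.atTop (nhds cp) ∧
        Filter.Tendsto (fun t => indR V (γ t)) Filter.atBot (nhds cm) ∧
        (χ : ℝ) = cp - cm)

section CspHelpers
open Filter Topology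

theorem csp_glue {s t : Set ℂ} {f g : ℂ → ℂ} (hs : IsClosed s) (ht : IsClosed t)
    (hf : ContinuousOn f s) (hg : ContinuousOn g t) (h : ∀ z ∈ s, z ∈ t → f z = g z) :
    ∃ k : ℂ → ℂ, ContinuousOn k (s ∪ t) ∧ (∀ z ∈ s, k z = f z) ∧ (∀ z ∈ t, k z = g z) := by
  classical
  have h1 : ∀ z ∈ s, s.piecewise f g z = f z := fun z hz => by simp [Set.piecewise, hz]
  have h2 : ∀ z ∈ t, s.piecewise f g z = g z := fun z hz => by
    by_cases hzs : z ∈ s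
    · simp [Set.piecewise, hzs, h z hzs hz]
    · simp [Set.piecewise, hzs]
  exact ⟨s.piecewise f g, (hf.congr h1).union_of_isClosed (hg.congr h2) hs ht, h1, h2⟩

theorem csp_const {X : Type*} [TopologicalSpace X] {S : Set X} (hS : IsPreconnected S) {f : X → ℂ}
    (hf : ContinuousOn f S) (h : ∀ x ∈ S, Complex.exp (f x) = 1) :
    ∀ x ∈ S, ∀ y ∈ S, f x = f y := by
  have hc : (Set.range fun n : ℤ => (n : ℂ) * (2 * Real.pi * Complex.I)).Countable :=
    Set.countable_range _
  intro x hx y hy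
  refine hc.isTotallyDisconnected (f '' S) ?_ (hS.image f hf) ⟨x, hx, rfl⟩ ⟨y, hy, rfl⟩
  rintro _ ⟨z, hz, rfl⟩
  obtain ⟨n, hn⟩ := Complex.exp_eq_one_iff.1 (h z hz)
  exact ⟨n, hn.symm⟩

theorem csp_tietze {s : Set ℂ} (hs : IsClosed s) {f : ℂ → ℂ} (hf : ContinuousOn f s) :
    ∃ g : ℂ → ℂ, Continuous g ∧ ∀ z ∈ s, g z = f z := by
  obtain ⟨g, hg⟩ := ContinuousMap.exists_restrict_eq hs
    (⟨fun z : s => f z, continuousOn_iff_continuous_domRestrict.1 hf⟩ : C(s, ℂ))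
  exact ⟨g, g.continuous, fun z hz => congrArg (fun k : C(s, ℂ) => k ⟨z, hz⟩) hg⟩

theorem csp_lift {X : Type*} [TopologicalSpace X] [SimplyConnectedSpace X]
    [LocallyPathConnectedSpace X] {g : X → ℂ} (hg : Continuous g) (h0 : ∀ x, g x ≠ 0) :
    ∃ f : X → ℂ, Continuous f ∧ ∀ x, Complex.exp (f x) = g x := by
  obtain ⟨x₀⟩ : Nonempty X := inferInstance
  obtain ⟨F, ⟨-, hF⟩, -⟩ := Complex.isCoveringMapOn_exp.existsUnique_continuousMap_lifts
    (⟨g, hg⟩ : C(X, ℂ)) (a₀ := x₀) (e₀ := Complex.log (g x₀)) (Complex.exp_log (h0 x₀))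
    (fun x => by simpa using h0 x)
  exact ⟨F, F.continuous, fun x => congrFun hF x⟩

/-- no nonvanishing continuous function on the plane is asymptotic to the identity. -/
theorem csp_no {v : ℂ → ℂ} (hv : Continuous v) (h0 : ∀ z, v z ≠ 0)
    (hlim : Tendsto (fun z => v z / z) (cocompact ℂ) (𝓝 1)) : False := by
  obtain ⟨w, hw, hwv⟩ := csp_lift hv h0
  have h1 : ∀ᶠ z in cocompact ℂ, v z / z ∈ Complex.slitPlane :=
    hlim.eventually (Complex.isOpen_slitPlane.mem_nhds Complex.one_mem_slitPlane)
  obtain ⟨R, hR⟩ : ∃ R : ℝ, ∀ z : ℂ, R < ‖z‖ → v z / z ∈ Complex.slitPlane := by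
    rw [← Metric.cobounded_eq_cocompact, ← comap_norm_atTop] at h1
    obtain ⟨s, hs, hsub⟩ := Filter.mem_comap.1 h1
    obtain ⟨R, hR⟩ := mem_atTop_sets.1 hs
    exact ⟨R, fun z hz => hsub (hR _ hz.le)⟩
  set ρ : ℝ := |R| + 1
  have hρ : 0 < ρ := by positivity
  have hρC : (ρ : ℂ) ≠ 0 := by exact_mod_cast hρ.ne'
  let c : ℝ → ℂ := fun θ => ρ * Complex.exp (θ * Complex.I)
  have hc : Continuous c := by fun_prop
  have hcn : ∀ θ, ‖c θ‖ = ρ := fun θ => by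
    simp [c, Complex.norm_exp_ofReal_mul_I, abs_of_pos hρ]
  have hc0 : ∀ θ, c θ ≠ 0 := fun θ h => by
    have := hcn θ; rw [h, norm_zero] at this; exact hρ.ne this
  have hsl : ∀ θ, v (c θ) / c θ ∈ Complex.slitPlane := fun θ => hR _ (by
    rw [hcn]; have := le_abs_self R; simp only [ρ]; linarith)
  let f : ℝ → ℂ := fun θ => w (c θ) - Complex.log ρ - θ * Complex.I - Complex.log (v (c θ) / c θ)
  have hf : Continuous f := by
    have h3 : Continuous fun θ => Complex.log (v (c θ) / c θ) :=
      ((hv.comp hc).div hc hc0).clog hsl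
    have h4 : Continuous fun θ => w (c θ) := hw.comp hc
    fun_prop
  have hf1 : ∀ θ ∈ (Set.univ : Set ℝ), Complex.exp (f θ) = 1 := fun θ _ => by
    have h5 : v (c θ) / c θ ≠ 0 := div_ne_zero (h0 _) (hc0 _)
    simp only [f, Complex.exp_sub, hwv, Complex.exp_log hρC, Complex.exp_log h5]
    have h6 := h0 (c θ)
    have h7 := Complex.exp_ne_zero (θ * Complex.I)
    have h8 : c θ = ρ * Complex.exp (θ * Complex.I) := rfl
    generalize v (c θ) = u at h6 ⊢
    rw [h8]
    field_simp
  have := csp_const isPreconnected_univ hf.continuousOn hf1 0 trivial (2 * Real.pi) trivial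
  have hcc : c (2 * Real.pi) = c 0 := by simp [c]
  simp only [f, hcc] at this
  push_cast at this
  exact Complex.two_pi_I_ne_zero (by linear_combination this)

def CspQ (Γ : Set ℂ) (a b : ℂ) : Prop :=
  ∃ L : ℂ → ℂ, Continuous L ∧ Tendsto L (cocompact ℂ) (𝓝 0) ∧
    ∀ z ∈ Γ, Complex.exp (L z) * (z - b) = z - a

theorem CspQ.symm {Γ : Set ℂ} {a b : ℂ} (h : CspQ Γ a b) : CspQ Γ b a := by
  obtain ⟨L, h1, h2, h3⟩ := h
  refine ⟨fun z => -L z, h1.neg, by simpa using h2.neg, fun z hz => ?_⟩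
  rw [← h3 z hz, ← mul_assoc, ← Complex.exp_add]; simp

theorem CspQ.trans {Γ : Set ℂ} {a b c : ℂ} (h : CspQ Γ a b) (h' : CspQ Γ b c) : CspQ Γ a c := by
  obtain ⟨L, h1, h2, h3⟩ := h
  obtain ⟨L', h1', h2', h3'⟩ := h'
  refine ⟨fun z => L z + L' z, h1.add h1', by simpa using h2.add h2', fun z hz => ?_⟩
  rw [← h3 z hz, ← h3' z hz, Complex.exp_add, mul_assoc]

theorem csp_local {Γ : Set ℂ} {a b : ℂ} {r : ℝ} (hr : 0 < r)
    (hΓ : ∀ z ∈ Γ, r ≤ ‖z - a‖) (hb : ‖a - b‖ < r) : CspQ Γ b a := by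
  let φ : ℂ → ℂ := fun z => (starRingEnd ℂ) (z - a) / ((max (‖z - a‖ ^ 2) (r ^ 2) : ℝ) : ℂ)
  have hm : ∀ z, 0 < max (‖z - a‖ ^ 2) (r ^ 2) := fun z => lt_max_of_lt_right (by positivity)
  have hφ : Continuous φ := by
    refine Continuous.div (by fun_prop) (by fun_prop) fun z => ?_
    exact_mod_cast (hm z).ne'
  have hn : ∀ z, ‖φ z‖ = ‖z - a‖ / max (‖z - a‖ ^ 2) (r ^ 2) := fun z => by
    simp only [φ]
    rw [norm_div, Complex.norm_real, Real.norm_of_nonneg (hm z).le, RCLike.norm_conj]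
  have hφr : ∀ z, ‖φ z‖ ≤ 1 / r := fun z => by
    rw [hn, div_le_div_iff₀ (hm z) hr, one_mul]
    rcases le_total r ‖z - a‖ with h | h
    · exact le_max_of_le_left (by nlinarith)
    · exact le_max_of_le_right (by nlinarith)
  have hφ2 : ∀ z, ‖φ z‖ ≤ ‖z - a‖⁻¹ := fun z => by
    rw [hn]
    rcases eq_or_lt_of_le (norm_nonneg (z - a)) with h | h
    · simp [← h]
    · rw [div_le_iff₀ (hm z), inv_mul_eq_div, le_div_iff₀ h]
      exact le_max_of_le_left (by nlinarith)
  have hφ0 : Tendsto φ (cocompact ℂ) (𝓝 0) := by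
    refine squeeze_zero_norm hφ2 (tendsto_inv_atTop_zero.comp ?_)
    exact (tendsto_norm_cocompact_atTop (E := ℂ)).comp
      (Homeomorph.subRight a).isClosedEmbedding.tendsto_cocompact
  have hlt : ∀ z, ‖(a - b) * φ z‖ < 1 := fun z => by
    rw [norm_mul]
    calc ‖a - b‖ * ‖φ z‖ ≤ ‖a - b‖ * (1 / r) := by gcongr; exact hφr z
      _ < 1 := by rw [mul_one_div, div_lt_one hr]; exact hb
  have hsl : ∀ z, 1 + (a - b) * φ z ∈ Complex.slitPlane := fun z =>
    Complex.mem_slitPlane_of_norm_lt_one (hlt z)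
  have hcont : Continuous fun z => 1 + (a - b) * φ z := by fun_prop
  refine ⟨fun z => Complex.log (1 + (a - b) * φ z), hcont.clog hsl, ?_, fun z hz => ?_⟩
  · have : Tendsto (fun z => 1 + (a - b) * φ z) (cocompact ℂ) (𝓝 1) := by
      simpa using (hφ0.const_mul (a - b)).const_add 1
    simpa using this.clog Complex.one_mem_slitPlane
  · rw [Complex.exp_log (Complex.slitPlane_ne_zero (hsl z))]
    have h1 := hΓ z hz
    have h2 : z - a ≠ 0 := fun h => by rw [h, norm_zero] at h1; linarith
    have h3 : φ z * (z - a) = 1 := by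
      have h4 : max (‖z - a‖ ^ 2) (r ^ 2) = ‖z - a‖ ^ 2 := max_eq_left (by gcongr)
      simp only [φ, h4]
      rw [div_mul_eq_mul_div, mul_comm, Complex.mul_conj, Complex.normSq_eq_norm_sq, div_self]
      exact_mod_cast (pow_pos (hr.trans_le h1) 2).ne'
    linear_combination (a - b) * h3

theorem csp_F1 {Γ : Set ℂ} (hΓ : IsClosed Γ) {a b : ℂ} (hb : b ∈ connectedComponentIn Γᶜ a)
    (ha : a ∈ Γᶜ) : CspQ Γ a b := by
  refine isPreconnected_connectedComponentIn.induction₂ (CspQ Γ) ?_ ?_ ?_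
    (mem_connectedComponentIn ha) hb
  · intro x hx
    have hx' : x ∈ Γᶜ := connectedComponentIn_subset _ _ hx
    obtain ⟨r, hr, hball⟩ := Metric.isOpen_iff.1 hΓ.isOpen_compl x hx'
    filter_upwards [nhdsWithin_le_nhds (Metric.ball_mem_nhds x hr)] with y hy
    refine (csp_local (a := x) (b := y) hr (fun z hz => ?_) ?_).symm
    · by_contra hlt
      exact hball (by simpa [dist_eq_norm] using hlt) hz
    · rw [Metric.mem_ball, dist_comm, dist_eq_norm] at hy; exact hy
  · intro x y z _ _ _ h h'; exact h.trans h'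
  · intro x y _ _ h; exact h.symm

theorem csp_closure {Γ : Set ℂ} (hΓ : IsClosed Γ) (b : ℂ) :
    closure (connectedComponentIn Γᶜ b) ⊆ connectedComponentIn Γᶜ b ∪ Γ := by
  intro x hx
  by_cases h : x ∈ Γ
  · exact Or.inr h
  left
  have ho : IsOpen (connectedComponentIn Γᶜ x) := hΓ.isOpen_compl.connectedComponentIn
  obtain ⟨y, hy1, hy2⟩ := mem_closure_iff.1 hx _ ho (mem_connectedComponentIn h)
  rw [connectedComponentIn_eq hy2, ← connectedComponentIn_eq hy1]
  exact mem_connectedComponentIn h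

theorem csp_tendsto_ratio (a : ℂ) : Tendsto (fun z : ℂ => (z - a) / z) (cocompact ℂ) (𝓝 1) := by
  have h : Tendsto (fun z : ℂ => 1 - a * z⁻¹) (cocompact ℂ) (𝓝 1) := by
    rw [← Metric.cobounded_eq_cocompact]
    simpa using ((tendsto_inv₀_cobounded (α := ℂ)).const_mul a).const_sub 1
  refine h.congr' ?_
  filter_upwards [(isCompact_singleton (x := (0 : ℂ))).compl_mem_cocompact] with z hz
  have : z ≠ 0 := hz
  field_simp

theorem csp_F2 {Γ : Set ℂ} (hΓ : IsClosed Γ) {a b : ℂ} (ha : a ∈ Γᶜ) (hb : b ∈ Γᶜ)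
    (h : CspQ Γ a b) : b ∈ connectedComponentIn Γᶜ a := by
  by_contra hab
  obtain ⟨L, hL, hL0, hLz⟩ := h
  set B := connectedComponentIn Γᶜ a with hB
  have hBo : IsOpen B := hΓ.isOpen_compl.connectedComponentIn
  have haB : a ∈ B := mem_connectedComponentIn ha
  have hcl := csp_closure hΓ a
  -- glue exp (L z) times z minus b on B with z minus a off B
  have hbcl : b ∉ closure B := fun h => (hcl h).elim hab hb
  obtain ⟨v, hv, hv1, hv2⟩ := csp_glue (s := closure B) (t := Bᶜ)
    (f := fun z => Complex.exp (L z) * (z - b)) (g := fun z => z - a)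
    isClosed_closure hBo.isClosed_compl (by fun_prop) (by fun_prop) (fun z hz hz' =>
      hLz z ((hcl hz).resolve_left hz'))
  have hun : closure B ∪ Bᶜ = Set.univ := by
    rw [Set.eq_univ_iff_forall]; intro z
    by_cases hz : z ∈ B
    · exact Or.inl (subset_closure hz)
    · exact Or.inr hz
  rw [hun, ← continuousOn_univ.symm.eq] at hv
  refine csp_no hv (fun z hz => ?_) ?_
  · by_cases hzB : z ∈ B
    · rw [hv1 z (subset_closure hzB)] at hz
      have : z - b = 0 := (mul_eq_zero.1 hz).resolve_left (Complex.exp_ne_zero _)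
      exact hab (sub_eq_zero.1 this ▸ hzB)
    · rw [hv2 z hzB] at hz
      exact hzB (sub_eq_zero.1 hz ▸ haB)
  · have t1 : Tendsto (fun z => Complex.exp (L z) * ((z - b) / z)) (cocompact ℂ) (𝓝 1) := by
      have := (Complex.continuous_exp.tendsto 0).comp hL0
      simpa using this.mul (csp_tendsto_ratio b)
    have t2 := csp_tendsto_ratio a
    rw [tendsto_def] at *
    intro s hs
    filter_upwards [t1 s hs, t2 s hs] with z h1 h2
    by_cases hzB : z ∈ B
    · simpa [hv1 z (subset_closure hzB), mul_div_assoc] using h1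
    · simpa [hv2 z hzB] using h2

theorem csp_unbounded {δ : ℝ → ℂ} (hδ : IsClosedEmbedding δ) {a : ℂ} (ha : a ∈ (Set.range δ)ᶜ) :
    ¬ Bornology.IsBounded (connectedComponentIn (Set.range δ)ᶜ a) := by
  intro hbd
  have hΓ := hδ.isClosed_range
  set B := connectedComponentIn (Set.range δ)ᶜ a with hB
  have hBo : IsOpen B := hΓ.isOpen_compl.connectedComponentIn
  have haB : a ∈ B := mem_connectedComponentIn ha
  have hcl := csp_closure hΓ a
  have hδc := hδ.continuous
  obtain ⟨l, hl, hle⟩ := csp_lift (g := fun t => δ t - a) (by fun_prop)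
    (fun t h => ha ⟨t, sub_eq_zero.1 h⟩)
  obtain ⟨L, hL⟩ := ContinuousMap.exists_extension' hδ (⟨l, hl⟩ : C(ℝ, ℂ))
  have hLc := L.continuous
  obtain ⟨v, hv, hv1, hv2⟩ := csp_glue (s := closure B) (t := Bᶜ)
    (f := fun z => Complex.exp (L z)) (g := fun z => z - a)
    isClosed_closure hBo.isClosed_compl (by fun_prop) (by fun_prop) (fun z hz hz' => by
      obtain ⟨t, rfl⟩ := (hcl hz).resolve_left hz'
      have : L (δ t) = l t := congrFun hL t
      simp [this, hle])
  have hun : closure B ∪ Bᶜ = Set.univ := by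
    rw [Set.eq_univ_iff_forall]; intro z
    by_cases hz : z ∈ B
    · exact Or.inl (subset_closure hz)
    · exact Or.inr hz
  rw [hun, ← continuousOn_univ.symm.eq] at hv
  refine csp_no hv (fun z hz => ?_) ?_
  · by_cases hzB : z ∈ B
    · rw [hv1 z (subset_closure hzB)] at hz
      exact Complex.exp_ne_zero _ hz
    · rw [hv2 z hzB] at hz
      exact hzB (sub_eq_zero.1 hz ▸ haB)
  · refine (csp_tendsto_ratio a).congr' ?_
    filter_upwards [hbd.isCompact_closure.compl_mem_cocompact] with z hz
    rw [hv2 z (fun h => hz (subset_closure h))]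

/-- transfer of the logarithm criterion from one closed set to another one. -/
theorem csp_transfer {Γ₁ Γ₂ M K : Set ℂ} (hΓ₁ : IsClosed Γ₁) (hΓ₂ : IsClosed Γ₂)
    (hM : IsCompact M) (hMc : IsPreconnected M) (hM1 : M ⊆ Γ₁) (hMne : M.Nonempty) 
    (hK : IsCompact K)
    (hKM : Γ₁ ∩ K ⊆ M) (hd : Γ₂ \ Γ₁ ⊆ K) :
    ∃ R : ℝ, ∀ a b : ℂ, R < ‖a‖ → R < ‖b‖ → CspQ Γ₁ a b → CspQ Γ₂ a b := by
  obtain ⟨R, hR⟩ := (hM.union hK).isBounded.exists_norm_le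
  refine ⟨max R 0, fun a b ha hb => ?_⟩
  rintro ⟨L, hL, hL0, hLz⟩
  have hz1 : ∀ c : ℂ, max R 0 < ‖c‖ → c ≠ 0 := fun c hc h => by
    rw [h, norm_zero] at hc; exact absurd hc (not_lt.2 (le_max_right _ _))
  have ha0 := hz1 a ha
  have hb0 := hz1 b hb
  have hsl : ∀ c : ℂ, max R 0 < ‖c‖ → ∀ z ∈ M ∪ K, 1 + -(z / c) ∈ Complex.slitPlane := by
    intro c hc z hz
    apply Complex.mem_slitPlane_of_norm_lt_one
    have hc' : 0 < ‖c‖ := (le_max_right R 0).trans_lt hc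
    rw [norm_neg, norm_div, div_lt_one hc']
    exact (hR z hz).trans_lt ((le_max_left R 0).trans_lt hc)
  let E₀ : ℂ → ℂ := fun z => Complex.log (1 + -(z / a)) - Complex.log (1 + -(z / b)) +
    Complex.log (a / b) - L z
  have hE₀ : ContinuousOn E₀ (M ∪ K) := by
    have h1 : ∀ c : ℂ, max R 0 < ‖c‖ →
        ContinuousOn (fun z => Complex.log (1 + -(z / c))) (M ∪ K) := fun c hc =>
      ContinuousOn.clog (by fun_prop) (hsl c hc)
    exact (((h1 a ha).sub (h1 b hb)).add continuousOn_const).sub hL.continuousOn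
  have hexp : ∀ z ∈ M ∪ K, Complex.exp (E₀ z) * (Complex.exp (L z) * (z - b)) = z - a := by
    intro z hz
    have e1 := Complex.slitPlane_ne_zero (hsl a ha z hz)
    have e2 := Complex.slitPlane_ne_zero (hsl b hb z hz)
    have hzb : z - b ≠ 0 := fun h => e2 (by rw [sub_eq_zero.1 h, div_self hb0]; ring)
    simp only [E₀, Complex.exp_sub, Complex.exp_add, Complex.exp_log e1, Complex.exp_log e2,
      Complex.exp_log (div_ne_zero ha0 hb0)]
    have e3 : (1 + -(z / b)) = -(z - b) / b := by field_simp; ring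
    have e4 : (1 + -(z / a)) = -(z - a) / a := by field_simp; ring
    have := Complex.exp_ne_zero (L z)
    rw [e3, e4]
    field_simp
  have hzbM : ∀ z ∈ M, z - b ≠ 0 ∧ z - a ≠ 0 := by
    intro z hz
    have e1 := Complex.slitPlane_ne_zero (hsl a ha z (Or.inl hz))
    have e2 := Complex.slitPlane_ne_zero (hsl b hb z (Or.inl hz))
    exact ⟨fun h => e2 (by rw [sub_eq_zero.1 h, div_self hb0]; ring),
      fun h => e1 (by rw [sub_eq_zero.1 h, div_self ha0]; ring)⟩
  have hone : ∀ z ∈ M, Complex.exp (E₀ z) = 1 := by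
    intro z hz
    have h1 := hexp z (Or.inl hz)
    rw [hLz z (hM1 hz)] at h1
    exact mul_right_cancel₀ (hzbM z hz).2 (h1.trans (one_mul _).symm)
  obtain ⟨m, hm⟩ := hMne
  have hconst := csp_const hMc (hE₀.mono Set.subset_union_left) hone
  obtain ⟨D, hD, hD1, hD2⟩ := csp_glue (s := Γ₂ ∩ (M ∪ K)) (t := Γ₁)
    (f := fun z => E₀ z - E₀ m) (g := fun _ => 0)
    (hΓ₂.inter (hM.union hK).isClosed) hΓ₁
    ((hE₀.mono Set.inter_subset_right).sub continuousOn_const) continuousOn_const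
    (fun z hz hz1 => by
      have : z ∈ M := hz.2.elim id fun h => hKM ⟨hz1, h⟩
      simp [hconst z this m hm])
  obtain ⟨D', hD', hDD⟩ := csp_tietze ((hΓ₂.inter (hM.union hK).isClosed).union hΓ₁) hD
  obtain ⟨χ, hχ1, -, hχc, -⟩ := exists_continuous_one_zero_of_isCompact (hM.union hK)
    isClosed_empty (Set.disjoint_empty _)
  have hχ := χ.continuous
  refine ⟨fun z => L z + χ z * D' z, by fun_prop, ?_, fun z hz => ?_⟩
  · refine hL0.congr' ?_
    filter_upwards [hχc.isCompact.compl_mem_cocompact] with z hz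
    simp [image_eq_zero_of_notMem_tsupport hz]
  · by_cases hzK : z ∈ M ∪ K
    · have h1 : D' z = E₀ z - E₀ m := (hDD z (Or.inl ⟨hz, hzK⟩)).trans (hD1 z ⟨hz, hzK⟩)
      have h2 : χ z = 1 := hχ1 hzK
      have h3 := hexp z hzK
      simp only [h1, h2, Complex.exp_add, Complex.exp_sub, hone m hm, Complex.ofReal_one, one_mul,
        div_one]
      rw [← h3]; ring
    · have hz1 : z ∈ Γ₁ := by
        by_contra h; exact hzK (Or.inr (hd ⟨hz, h⟩))
      have h1 : D' z = 0 := (hDD z (Or.inr hz1)).trans (hD2 z hz1)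
      simp only [h1, mul_zero, add_zero]
      exact hLz z hz1

theorem csp_transfer_path {δ : ℝ → ℂ} (hδ : IsClosedEmbedding δ) {Γ₂ K : Set ℂ}
    (hΓ₂ : IsClosed Γ₂) (hK : IsCompact K) (hd : Γ₂ \ Set.range δ ⊆ K) :
    ∃ R : ℝ, ∀ a b : ℂ, R < ‖a‖ → R < ‖b‖ → CspQ (Set.range δ) a b → CspQ Γ₂ a b := by
  obtain ⟨n, hn⟩ := (hδ.isCompact_preimage hK).isBounded.exists_norm_le
  refine csp_transfer (M := δ '' Set.Icc (-|n|) |n|) hδ.isClosed_range hΓ₂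
    (isCompact_Icc.image hδ.continuous)
    (isPreconnected_Icc.image _ hδ.continuous.continuousOn) (Set.image_subset_range _ _)
    ((Set.nonempty_Icc.2 (by linarith [abs_nonneg n])).image _) hK ?_ hd
  rintro _ ⟨⟨t, rfl⟩, ht⟩
  have := (hn t ht).trans (le_abs_self n)
  exact ⟨t, abs_le.1 this, rfl⟩

theorem csp_main {δ₁ δ₂ : ℝ → ℂ} (h₁ : IsClosedEmbedding δ₁) (h₂ : IsClosedEmbedding δ₂)
    {K : Set ℂ} (hK : IsCompact K) (hd : symmDiff (Set.range δ₁) (Set.range δ₂) ⊆ K)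
    {a₀ : ℂ} (ha₀ : a₀ ∈ (Set.range δ₁)ᶜ) :
    ∃ a ∈ (Set.range δ₂)ᶜ, Bornology.IsBounded
      (symmDiff (connectedComponentIn (Set.range δ₁)ᶜ a₀)
        (connectedComponentIn (Set.range δ₂)ᶜ a)) := by
  have c1 := h₁.isClosed_range
  have c2 := h₂.isClosed_range
  obtain ⟨R1, hR1⟩ := csp_transfer_path h₁ c2 hK (fun z hz => hd (Or.inr hz))
  obtain ⟨R2, hR2⟩ := csp_transfer_path h₂ c1 hK (fun z hz => hd (Or.inl hz))
  obtain ⟨R3, hR3⟩ := hK.isBounded.exists_norm_le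
  set R := max R1 (max R2 R3)
  have hmax : ∀ z : ℂ, R < ‖z‖ → R1 < ‖z‖ ∧ R2 < ‖z‖ ∧ z ∉ K := fun z hz => by
    simp only [R, max_lt_iff] at hz
    exact ⟨hz.1, hz.2.1, fun h => absurd (hR3 z h) (not_le.2 hz.2.2)⟩
  have hiff : ∀ z, R < ‖z‖ → (z ∈ Set.range δ₁ ↔ z ∈ Set.range δ₂) := fun z hz => by
    have := (hmax z hz).2.2
    constructor
    · intro h; by_contra h'; exact this (hd (Or.inl ⟨h, h'⟩))
    · intro h; by_contra h'; exact this (hd (Or.inr ⟨h, h'⟩))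
  obtain ⟨a, haA, haR⟩ : ∃ a ∈ connectedComponentIn (Set.range δ₁)ᶜ a₀, R < ‖a‖ := by
    by_contra! hcon
    exact csp_unbounded h₁ ha₀ (isBounded_iff_forall_norm_le.2 ⟨R, hcon⟩)
  have ha1 : a ∈ (Set.range δ₁)ᶜ := connectedComponentIn_subset _ _ haA
  have ha2 : a ∈ (Set.range δ₂)ᶜ := fun h => ha1 ((hiff a haR).2 h)
  refine ⟨a, ha2, isBounded_iff_forall_norm_le.2 ⟨R, fun z hz => ?_⟩⟩
  rw [connectedComponentIn_eq haA] at hz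
  by_contra! hzR
  obtain ⟨m1, m2, m3⟩ := hmax z hzR
  obtain ⟨n1, n2, n3⟩ := hmax a haR
  rcases hz with ⟨hz, hz'⟩ | ⟨hz, hz'⟩
  · have hz1 : z ∈ (Set.range δ₁)ᶜ := connectedComponentIn_subset _ _ hz
    exact hz' (csp_F2 c2 ha2 (fun h => hz1 ((hiff z hzR).2 h)) (hR1 a z n1 m1 (csp_F1 c1 hz ha1)))
  · have hz1 : z ∈ (Set.range δ₂)ᶜ := connectedComponentIn_subset _ _ hz
    exact hz' (csp_F2 c1 ha1 (fun h => hz1 ((hiff z hzR).1 h)) (hR2 a z n2 m2 (csp_F1 c2 hz ha2)))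

end CspHelpers

/-- Proposition 5.2: if two simple paths have ranges differing in a
compact set, each connected component of the complement of the first range is boundedly
equivalent to a unique connected component of the complement of the second. -/
theorem component_stability_under_compact_perturbation
    (γ₁ γ₂ : ℝ → R2) (h₁ : IsSimplePath γ₁) (h₂ : IsSimplePath γ₂)
    (K : Set R2) (hK : IsCompact K)
    (hΔ : symmDiff (Set.range γ₁) (Set.range γ₂) ⊆ K)
    (A₁ : Set R2) (hA₁ : A₁ ∈ components (Set.range γ₁)ᶜ) :
    ∃! A₂ : Set R2, A₂ ∈ components (Set.range γ₂)ᶜ ∧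
      Bornology.IsBounded (symmDiff A₁ A₂) := by
  let e : R2 ≃ₜ ℂ := Complex.equivRealProdCLM.symm.toHomeomorph
  have hemb : ∀ γ : ℝ → R2, IsSimplePath γ → Topology.IsClosedEmbedding (e ∘ γ) := by
    intro γ h
    have hp : IsProperMap γ := isProperMap_iff_isCompact_preimage.2
      ⟨h.continuous, fun K hK => h.proper K hK⟩
    exact e.isClosedEmbedding.comp
      (Topology.IsClosedEmbedding.of_continuous_injective_isClosedMap h.continuous h.injective hp.isClosedMap)
  have hrange : ∀ γ : ℝ → R2, Set.range (e ∘ γ) = e '' Set.range γ := fun γ => Set.range_comp _ _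
  have hcomp : ∀ (γ : ℝ → R2) (x : R2), x ∈ (Set.range γ)ᶜ →
      e '' connectedComponentIn (Set.range γ)ᶜ x =
        connectedComponentIn (Set.range (e ∘ γ))ᶜ (e x) := by
    intro γ x hx
    rw [e.image_connectedComponentIn hx, Set.image_compl_eq e.bijective, hrange]
  have hmem : ∀ (γ : ℝ → R2) (x : R2), x ∈ (Set.range γ)ᶜ → e x ∈ (Set.range (e ∘ γ))ᶜ := by
    rintro γ x hx ⟨t, ht⟩
    exact hx ⟨t, e.injective ht⟩
  have hbdd : ∀ S : Set R2, Bornology.IsBounded (e '' S) ↔ Bornology.IsBounded S := by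
    intro S
    constructor
    · intro h
      have h2 := (h.isCompact_closure.image e.symm.continuous).isBounded
      refine h2.subset ?_
      intro x hx
      exact ⟨e x, subset_closure ⟨x, hx, rfl⟩, e.symm_apply_apply x⟩
    · intro h
      exact (h.isCompact_closure.image e.continuous).isBounded.subset
        (Set.image_mono subset_closure)
  obtain ⟨x, hx, rfl⟩ := hA₁
  obtain ⟨a, ha, hb⟩ := csp_main (hemb γ₁ h₁) (hemb γ₂ h₂) (hK.image e.continuous)
    (by rw [hrange, hrange, ← Set.image_symmDiff e.injective]; exact Set.image_mono hΔ)
    (hmem γ₁ x hx)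
  obtain ⟨y, rfl⟩ := e.surjective a
  have hy : y ∈ (Set.range γ₂)ᶜ := by
    rintro ⟨t, rfl⟩
    exact ha ⟨t, rfl⟩
  rw [← hcomp _ _ hx, ← hcomp _ _ hy, ← Set.image_symmDiff e.injective, hbdd] at hb
  refine ⟨_, ⟨⟨y, hy, rfl⟩, hb⟩, ?_⟩
  rintro _ ⟨⟨y', hy', rfl⟩, hb'⟩
  by_contra hne
  have hunb := csp_unbounded (hemb γ₂ h₂) (hmem γ₂ y hy)
  rw [← hcomp _ _ hy, hbdd] at hunb
  refine hunb ((hb.union hb').subset fun z hz => ?_)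
  have hz' : z ∉ connectedComponentIn (Set.range γ₂)ᶜ y' := fun h =>
    hne ((connectedComponentIn_eq h).trans (connectedComponentIn_eq hz).symm)
  by_cases hzA : z ∈ connectedComponentIn (Set.range γ₁)ᶜ x
  · exact Or.inr (Or.inl ⟨hzA, hz'⟩)
  · exact Or.inl (Or.inr ⟨hz, hzA⟩)

end
end

section
/- Let γ : ℝ → ℝ² be a continuous, injective and proper map (preimages of compact sets are compact), with range Γ. Then ℝ² ∖ Γ has exactly two connected components; moreover, every connected component A of ℝ² ∖ Γ satisfies: (i) A is unbounded; (ii) the boundary of A equals Γ; (iii) for every compact set K ⊆ ℝ² there exists an open set Ω ⊆ ℝ² ∖ K such that ℝ² ∖ Ω is compact and A ∩ Ω is connected. -/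
noncomputable section

namespace JL

open Set Filter Topology

lemma log_lift {A : Type*} [TopologicalSpace A] [SimplyConnectedSpace A]
    [LocallyPathConnectedSpace A] (f : A → ℂ) (hf : Continuous f) (h0 : ∀ x, f x ≠ 0) :
    ∃ F : A → ℂ, Continuous F ∧ ∀ x, Complex.exp (F x) = f x := by
  obtain ⟨x₀⟩ : Nonempty A := inferInstance
  obtain ⟨F, ⟨-, hF⟩, -⟩ := Complex.isCoveringMapOn_exp.existsUnique_continuousMap_lifts
    ⟨f, hf⟩ (a₀ := x₀) (Complex.exp_log (h0 x₀)) (fun x ↦ h0 x)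
  exact ⟨F, F.continuous, fun x ↦ congrFun hF x⟩

lemma const_of_exp {X : Type*} [TopologicalSpace X] {S : Set X} (hS : IsPreconnected S)
    {u : X → ℂ} (hu : ContinuousOn u S) {c : ℂ} (hc : ∀ x ∈ S, Complex.exp (u x) = c)
    {x y : X} (hx : x ∈ S) (hy : y ∈ S) : u x = u y := by
  have : PreconnectedSpace S := Subtype.preconnectedSpace hS
  have h := Complex.isCoveringMap_exp.const_of_comp (A := S) (g := S.domRestrict u)
    hu.domRestrict (fun a b ↦ Subtype.ext ((hc a a.2).trans (hc b b.2).symm))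
  exact h ⟨x, hx⟩ ⟨y, hy⟩

lemma const_int {X : Type*} [TopologicalSpace X] {S : Set X} (hS : IsPreconnected S)
    {u v : X → ℂ} (hu : ContinuousOn u S) (hv : ContinuousOn v S)
    (hc : ∀ x ∈ S, Complex.exp (u x) = Complex.exp (v x)) :
    ∃ n : ℤ, ∀ x ∈ S, u x = v x + n * (2 * Real.pi * Complex.I) := by
  rcases S.eq_empty_or_nonempty with rfl | ⟨x₀, hx₀⟩
  · exact ⟨0, by simp⟩
  obtain ⟨n, hn⟩ := Complex.exp_eq_exp_iff_exists_int.1 (hc x₀ hx₀)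
  refine ⟨n, fun x hx ↦ ?_⟩
  have := const_of_exp hS (hu.sub hv) (c := 1)
    (fun x hx ↦ by
      rw [Pi.sub_apply, Complex.exp_sub, hc x hx, div_self (Complex.exp_ne_zero _)]) hx hx₀
  simp only [Pi.sub_apply] at this
  linear_combination this + hn

lemma circle_lemma {p c : ℂ} {R : ℝ} (hR : 0 < R) {k : ℤ} {H : ℂ → ℂ}
    (hH : ContinuousOn H (Metric.sphere p R))
    (he : ∀ z ∈ Metric.sphere p R, Complex.exp (H z) = c * (z - p) ^ k) : k = 0 := by
  have hm : ∀ θ : ℝ, p + R * Complex.exp (θ * Complex.I) ∈ Metric.sphere p R := by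
    intro θ
    simp [Complex.norm_exp_ofReal_mul_I, abs_of_pos hR]
  have hcont : Continuous fun θ : ℝ ↦ H (p + R * Complex.exp (θ * Complex.I)) :=
    hH.comp_continuous (by fun_prop) hm
  have h := const_of_exp (S := (univ : Set ℝ)) isPreconnected_univ
    (u := fun θ : ℝ ↦ H (p + R * Complex.exp (θ * Complex.I)) - k * (θ * Complex.I))
    (c := c * R ^ k)
    (hcont.sub (by fun_prop)).continuousOn (fun θ _ ↦ by
      rw [Complex.exp_sub, he _ (hm θ), Complex.exp_int_mul, add_sub_cancel_left, mul_zpow,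
        mul_div_assoc, mul_div_assoc, div_self (zpow_ne_zero _ (Complex.exp_ne_zero _)), mul_one])
    (mem_univ 0) (mem_univ (2 * Real.pi))
  simp [Complex.exp_two_pi_mul_I] at h
  have h2 : (k : ℂ) * (2 * Real.pi * Complex.I) = 0 := by linear_combination h
  simpa [Complex.I_ne_zero, Real.pi_ne_zero] using h2

lemma tietze {X : Set ℂ} (hX : IsClosed X) {g : ℂ → ℂ} (hg : ContinuousOn g X) :
    ∃ G : ℂ → ℂ, Continuous G ∧ ∀ z ∈ X, G z = g z := by
  obtain ⟨G, hG⟩ := ContinuousMap.exists_restrict_eq hX ⟨X.domRestrict g, hg.domRestrict⟩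
  exact ⟨G, G.continuous, fun z hz ↦ DFunLike.congr_fun hG ⟨z, hz⟩⟩

lemma e2 {U X : Set ℂ} {p : ℂ} (hU : IsOpen U) (hb : Bornology.IsBounded U) (hp : p ∈ U)
    (hX : IsClosed X) (hUX : frontier U ⊆ X) {g h : ℂ → ℂ} {a : ℤ} (hg : ContinuousOn g X)
    (hh : ContinuousOn h (closure U)) (hh0 : ∀ z ∈ closure U, h z ≠ 0)
    (he : ∀ z ∈ frontier U, Complex.exp (g z) = (z - p) ^ a * h z) : a = 0 := by
  classical
  obtain ⟨G, hGc, hG⟩ := tietze hX hg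
  let F : ℂ → ℂ := fun z ↦ if z ∈ U then Complex.exp (G z) / h z else (z - p) ^ a
  have hne : ∀ z, z ∉ U → z - p ≠ 0 := by
    intro z hz h0
    exact hz (by rwa [sub_eq_zero.1 h0])
  have hFc : Continuous F := by
    apply continuous_if
    · intro z hz
      have hz' : z ∈ frontier U := hz
      rw [hG z (hUX hz'), he z hz', mul_div_cancel_right₀ _ (hh0 z (frontier_subset_closure hz'))]
    · exact (hGc.cexp.continuousOn).div hh hh0
    · have : closure {z | z ∉ U} = Uᶜ := hU.isClosed_compl.closure_eq
      rw [this]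
      exact ContinuousOn.zpow₀ (by fun_prop) a (fun z hz ↦ Or.inl (hne z hz))
  have hF0 : ∀ z, F z ≠ 0 := by
    intro z
    by_cases hz : z ∈ U
    · simp only [F, hz, if_true]
      exact div_ne_zero (Complex.exp_ne_zero _) (hh0 z (subset_closure hz))
    · simp only [F, hz, if_false]
      exact zpow_ne_zero _ (hne z hz)
  obtain ⟨H, hHc, hH⟩ := log_lift F hFc hF0
  obtain ⟨R, hR0, hR⟩ := hb.subset_ball_lt 0 p
  refine circle_lemma (c := 1) hR0 (hHc.continuousOn (s := Metric.sphere p R)) (fun z hz ↦ ?_)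
  have hz : z ∉ U := fun h ↦ by
    have h1 := hR h
    rw [Metric.mem_sphere] at hz
    rw [Metric.mem_ball] at h1
    linarith
  rw [hH z, one_mul]
  simp [F, hz]

lemma closed_glue {A B : Set ℂ} (hA : IsClosed A) (hB : IsClosed B) {f g : ℂ → ℂ}
    (hf : ContinuousOn f A) (hg : ContinuousOn g B) (hfg : ∀ z ∈ A, z ∈ B → f z = g z) :
    ∃ h : ℂ → ℂ, ContinuousOn h (A ∪ B) ∧ (∀ z ∈ A, h z = f z) ∧ ∀ z ∈ B, h z = g z := by
  classical
  let h : ℂ → ℂ := fun z ↦ if z ∈ A then f z else g z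
  have h1 : ∀ z ∈ A, h z = f z := fun z hz ↦ by simp [h, hz]
  have h2 : ∀ z ∈ B, h z = g z := fun z hz ↦ by
    by_cases hz' : z ∈ A
    · rw [h1 z hz', hfg z hz' hz]
    · simp [h, hz']
  exact ⟨h, (hf.congr h1).union_of_isClosed (hg.congr h2) hA hB, h1, h2⟩

lemma e2inf {U X : Set ℂ} {p : ℂ} (hU : IsOpen U) (hp : p ∈ U)
    (hX : IsClosed X) (hUX : frontier U ⊆ X) {f h G l : ℂ → ℂ} {a : ℤ} {R : ℝ}
    (hG : ContinuousOn G X) (hGe : ∀ z ∈ X, Complex.exp (G z) = f z)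
    (hl : ContinuousOn l {z | R ≤ ‖z‖}) (hle : ∀ z, R ≤ ‖z‖ → Complex.exp (l z) = f z)
    (hag : ∀ z ∈ X, R ≤ ‖z‖ → G z = l z)
    (hh : ContinuousOn h (closure U)) (hh0 : ∀ z ∈ closure U, h z ≠ 0)
    (hf : ∀ z ∈ closure U, z ≠ p → f z = (z - p) ^ a * h z) : a = 0 := by
  set R' := max R (‖p‖ + 1)
  have hR : R ≤ R' := le_max_left _ _
  have hpR : ‖p‖ < R' := lt_of_lt_of_le (by linarith) (le_max_right R (‖p‖ + 1))
  have hcl : IsClosed {z : ℂ | R' ≤ ‖z‖} := isClosed_le continuous_const continuous_norm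
  obtain ⟨g, hg, hg1, hg2⟩ := closed_glue hX hcl hG
    (hl.mono (fun z hz ↦ hR.trans hz)) (fun z hz hz' ↦ hag z hz (hR.trans hz'))
  have hcU : closure (U ∩ Metric.ball 0 R') ⊆ closure U := closure_mono inter_subset_left
  have ho : IsOpen (U ∩ Metric.ball 0 R') := hU.inter Metric.isOpen_ball
  have hpm : p ∈ U ∩ Metric.ball 0 R' := ⟨hp, by simpa using hpR⟩
  have hfr : frontier (U ∩ Metric.ball 0 R') ⊆ X ∪ {z | R' ≤ ‖z‖} := by
    intro z hz
    rw [ho.frontier_eq] at hz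
    by_cases hzU : z ∈ U
    · right
      have : z ∉ Metric.ball (0 : ℂ) R' := fun h ↦ hz.2 ⟨hzU, h⟩
      simpa using this
    · left
      exact hUX (by rw [hU.frontier_eq]; exact ⟨hcU hz.1, hzU⟩)
  refine e2 ho (Metric.isBounded_ball.subset inter_subset_right) hpm (hX.union hcl) hfr hg
    (hh.mono hcU) (fun z hz ↦ hh0 z (hcU hz)) (fun z hz ↦ ?_)
  have hzp : z ≠ p := by
    rintro rfl
    rw [ho.frontier_eq] at hz
    exact hz.2 hpm
  rw [← hf z (hcU (frontier_subset_closure hz)) hzp]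
  rcases hfr hz with h | h
  · rw [hg1 z h, hGe z h]
  · rw [hg2 z h, hle z (hR.trans h)]

lemma slit_far {p q : ℂ} {z : ℂ} (hz : ‖q‖ + ‖q - p‖ + 1 ≤ ‖z‖) :
    (z - p) / (z - q) ∈ Complex.slitPlane := by
  have h1 : ‖q - p‖ < ‖z - q‖ := by
    have := norm_sub_norm_le z q
    linarith
  have h2 : 0 < ‖z - q‖ := (norm_nonneg _).trans_lt h1
  have h3 : z - q ≠ 0 := norm_pos_iff.1 h2
  have h4 : (z - p) / (z - q) = 1 + (q - p) / (z - q) := by field_simp; ring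
  rw [h4]
  apply Complex.mem_slitPlane_of_norm_lt_one
  rw [norm_div, div_lt_one h2]
  exact h1

lemma e1 {L Ω : Set ℂ} (hL : IsClosed L) (hΩ : IsPreconnected Ω) (hd : ∀ z ∈ Ω, z ∉ L)
    {p q : ℂ} (hp : p ∈ Ω) (hq : q ∈ Ω) :
    ∃ g : ℂ → ℂ, ContinuousOn g L ∧ ∀ z ∈ L, Complex.exp (g z) = (z - p) / (z - q) := by
  have hne : ∀ x ∈ Ω, ∀ z ∈ L, z - x ≠ 0 := fun x hx z hz h ↦ hd x hx (by rwa [← sub_eq_zero.1 h])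
  refine hΩ.induction₂ (fun p q ↦ ∃ g : ℂ → ℂ, ContinuousOn g L ∧
    ∀ z ∈ L, Complex.exp (g z) = (z - p) / (z - q)) ?_ ?_ ?_ hp hq
  · intro x hx
    obtain ⟨ε, hε, hεL⟩ := Metric.isOpen_iff.1 hL.isOpen_compl x (hd x hx)
    rw [eventually_nhdsWithin_iff]
    filter_upwards [Metric.ball_mem_nhds x (half_pos hε)] with y hy hyΩ
    have hsl : ∀ z ∈ L, (z - x) / (z - y) ∈ Complex.slitPlane := by
      intro z hz
      have h3 := hne y hyΩ z hz
      have h4 : (z - x) / (z - y) = 1 + (y - x) / (z - y) := by field_simp; ring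
      rw [h4]
      apply Complex.mem_slitPlane_of_norm_lt_one
      rw [norm_div, div_lt_one (norm_pos_iff.2 h3)]
      have h5 : ε ≤ ‖z - x‖ := by
        by_contra! h
        exact hεL (show z ∈ Metric.ball x ε by rwa [mem_ball_iff_norm]) hz
      rw [mem_ball_iff_norm] at hy
      have h6 : ‖z - x‖ ≤ ‖z - y‖ + ‖y - x‖ := by
        simpa using norm_add_le (z - y) (y - x)
      linarith
    refine ⟨fun z ↦ Complex.log ((z - x) / (z - y)), ?_, fun z hz ↦ ?_⟩
    · apply ContinuousOn.clog _ hsl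
      exact ContinuousOn.div (by fun_prop) (by fun_prop) (hne y hyΩ)
    · exact Complex.exp_log (Complex.slitPlane_ne_zero (hsl z hz))
  · rintro x y z hx hy hz ⟨g, hg, hge⟩ ⟨k, hk, hke⟩
    refine ⟨g + k, hg.add hk, fun w hw ↦ ?_⟩
    rw [Pi.add_apply, Complex.exp_add, hge w hw, hke w hw]
    have := hne y hy w hw
    have := hne z hz w hw
    field_simp
  · rintro x y hx hy ⟨g, hg, hge⟩
    refine ⟨-g, hg.neg, fun w hw ↦ ?_⟩
    rw [Pi.neg_apply, Complex.exp_neg, hge w hw, inv_div]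


/-- A proper line in the complex plane. -/
structure PL (γ : ℝ → ℂ) : Prop where
  c : Continuous γ
  i : Function.Injective γ
  p : ∀ K : Set ℂ, IsCompact K → IsCompact (γ ⁻¹' K)

lemma PL.emb {γ : ℝ → ℂ} (h : PL γ) : IsClosedEmbedding γ := by
  refine .of_continuous_injective_isClosedMap h.c h.i ?_
  exact (isProperMap_iff_isCompact_preimage.2 ⟨h.c, fun K hK ↦ h.p K hK⟩).isClosedMap

lemma PL.closed {γ : ℝ → ℂ} (h : PL γ) : IsClosed (range γ) := h.emb.isClosed_range

lemma PL.inv {γ : ℝ → ℂ} (h : PL γ) : ∃ τ : ℂ → ℝ, Continuous τ ∧ ∀ t, τ (γ t) = t := by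
  obtain ⟨g, hg⟩ := ContinuousMap.exists_extension' h.emb (ContinuousMap.id ℝ)
  exact ⟨g, g.continuous, fun t ↦ congrFun hg t⟩

lemma PL.far {γ : ℝ → ℂ} (h : PL γ) (R : ℝ) : ∃ T : ℝ, 0 < T ∧ ∀ t, ‖γ t‖ ≤ R → |t| < T := by
  obtain ⟨T, hT, hb⟩ := (h.p _ (isCompact_closedBall (0 : ℂ) R)).isBounded.subset_ball_lt 0 0
  refine ⟨T, hT, fun t ht ↦ ?_⟩
  have := hb (show t ∈ γ ⁻¹' Metric.closedBall 0 R by simpa using ht)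
  simpa using this

lemma PL.ends {γ : ℝ → ℂ} (h : PL γ) (R : ℝ) : ∃ T R0 : ℝ, 0 < T ∧ R ≤ R0 ∧
    (∀ t, T ≤ |t| → R ≤ ‖γ t‖) ∧ ∀ t, R0 ≤ ‖γ t‖ → T ≤ |t| := by
  obtain ⟨T, hT, h1⟩ := h.far R
  obtain ⟨C, hC⟩ := (isCompact_Icc (a := -T) (b := T)).exists_bound_of_continuousOn
    h.c.continuousOn
  refine ⟨T, max R (C + 1), hT, le_max_left _ _, fun t ht ↦ ?_, fun t ht ↦ ?_⟩
  · by_contra! h2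
    exact absurd (h1 t h2.le) (not_lt.2 ht)
  · by_contra! h2
    have := hC t (abs_le.1 h2.le)
    have := (le_max_right R (C + 1)).trans ht
    linarith

lemma PL.tail {γ : ℝ → ℂ} (h : PL γ) {K : ℝ → ℂ} {f l : ℂ → ℂ} {R T : ℝ} (hK : Continuous K)
    (hKe : ∀ t, Complex.exp (K t) = f (γ t)) (hl : ContinuousOn l {z | R ≤ ‖z‖})
    (hle : ∀ z, R ≤ ‖z‖ → Complex.exp (l z) = f z) (hT : ∀ t, T ≤ |t| → R ≤ ‖γ t‖) :
    ∃ n m : ℤ, (∀ t, T ≤ t → K t = l (γ t) + n * (2 * Real.pi * Complex.I)) ∧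
      ∀ t, t ≤ -T → K t = l (γ t) + m * (2 * Real.pi * Complex.I) := by
  have h1 : ∀ t ∈ Ici T, R ≤ ‖γ t‖ := fun t ht ↦ hT t (le_trans ht (le_abs_self t))
  have h2 : ∀ t ∈ Iic (-T), R ≤ ‖γ t‖ := fun t ht ↦
    hT t (le_trans (by have : t ≤ -T := ht; linarith) (neg_le_abs t))
  obtain ⟨n, hn⟩ := const_int (isPreconnected_Ici (a := T)) hK.continuousOn
    (hl.comp h.c.continuousOn h1) (fun t ht ↦ by
      rw [hKe, Function.comp_apply, hle _ (h1 t ht)])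
  obtain ⟨m, hm⟩ := const_int (isPreconnected_Iic (a := -T)) hK.continuousOn
    (hl.comp h.c.continuousOn h2) (fun t ht ↦ by
      rw [hKe, Function.comp_apply, hle _ (h2 t ht)])
  exact ⟨n, m, hn, hm⟩

/-- principal logarithm of `(z-p)/(z-q)` near infinity -/
noncomputable def ell (p q z : ℂ) : ℂ := Complex.log ((z - p) / (z - q))

lemma ell_cont {p q : ℂ} {R : ℝ} (hR : ‖q‖ + ‖q - p‖ + 1 ≤ R) :
    ContinuousOn (ell p q) {z | R ≤ ‖z‖} := by
  unfold ell
  apply ContinuousOn.clog _ (fun z hz ↦ slit_far (hR.trans hz))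
  refine ContinuousOn.div (by fun_prop) (by fun_prop) (fun z hz h0 ↦ ?_)
  have := Complex.slitPlane_ne_zero (slit_far (hR.trans hz))
  simp [h0] at this

lemma ell_exp {p q : ℂ} {R : ℝ} (hR : ‖q‖ + ‖q - p‖ + 1 ≤ R) (z : ℂ) (hz : R ≤ ‖z‖) :
    Complex.exp (ell p q z) = (z - p) / (z - q) :=
  Complex.exp_log (Complex.slitPlane_ne_zero (slit_far (hR.trans hz)))

lemma PL.lift {γ : ℝ → ℂ} (h : PL γ) {p q : ℂ} (hp : p ∉ range γ) (hq : q ∉ range γ) :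
    ∃ K : ℝ → ℂ, Continuous K ∧ ∀ t, Complex.exp (K t) = (γ t - p) / (γ t - q) := by
  have h1 : ∀ t, γ t - p ≠ 0 := fun t h0 ↦ hp ⟨t, sub_eq_zero.1 h0⟩
  have h2 : ∀ t, γ t - q ≠ 0 := fun t h0 ↦ hq ⟨t, sub_eq_zero.1 h0⟩
  have := h.c
  exact log_lift _ (Continuous.div (by fun_prop) (by fun_prop) h2)
    (fun t ↦ div_ne_zero (h1 t) (h2 t))

lemma comp_frontier {F : Set ℂ} (hF : IsOpen F) (x : ℂ) :
    frontier (connectedComponentIn F x) ⊆ Fᶜ := by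
  intro z hz hzF
  have ho := hF.connectedComponentIn (x := x)
  rw [ho.frontier_eq] at hz
  obtain ⟨w, hw1, hw2⟩ := mem_closure_iff.1 hz.1 _ (hF.connectedComponentIn (x := z))
    (mem_connectedComponentIn hzF)
  apply hz.2
  rw [connectedComponentIn_eq hw2, ← connectedComponentIn_eq hw1]
  exact mem_connectedComponentIn hzF

lemma comp_closure {F : Set ℂ} (hF : IsOpen F) (x z : ℂ)
    (hz : z ∈ closure (connectedComponentIn F x)) (hzF : z ∈ F) :
    z ∈ connectedComponentIn F x := by
  by_contra h
  refine comp_frontier hF x ?_ hzF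
  rw [hF.connectedComponentIn.frontier_eq]
  exact ⟨hz, h⟩

/-- no bounded component -/
lemma PL.unbdd {γ : ℝ → ℂ} (h : PL γ) {p : ℂ} (hp : p ∉ range γ) :
    ¬ Bornology.IsBounded (connectedComponentIn (range γ)ᶜ p) := by
  intro hb
  obtain ⟨τ, hτ, hτγ⟩ := h.inv
  have hc := h.c
  obtain ⟨K, hK, hKe⟩ := log_lift (fun t ↦ γ t - p) (by fun_prop)
    (fun t h0 ↦ hp ⟨t, sub_eq_zero.1 h0⟩)
  have hsub : frontier (connectedComponentIn (range γ)ᶜ p) ⊆ range γ := by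
    simpa using comp_frontier h.closed.isOpen_compl p
  have := e2 (a := 1) (h := fun _ ↦ 1) (g := fun z ↦ K (τ z)) h.closed.isOpen_compl.connectedComponentIn hb
    (mem_connectedComponentIn hp) h.closed hsub
    (by fun_prop) (by fun_prop) (by simp) (by
      intro z hz
      obtain ⟨t, rfl⟩ := hsub hz
      simp [hτγ, hKe])
  exact one_ne_zero this

lemma PL.frontier_eq {γ : ℝ → ℂ} (h : PL γ) {p q : ℂ} (hp : p ∉ range γ) (hq : q ∉ range γ)
    (hpq : q ∉ connectedComponentIn (range γ)ᶜ p) :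
    frontier (connectedComponentIn (range γ)ᶜ p) = range γ := by
  have hsub : frontier (connectedComponentIn (range γ)ᶜ p) ⊆ range γ := by
    simpa using comp_frontier h.closed.isOpen_compl p
  refine hsub.antisymm ?_
  rintro _ ⟨t₀, rfl⟩
  by_contra ht
  obtain ⟨τ, hτ, hτγ⟩ := h.inv
  obtain ⟨K, hK, hKe⟩ := h.lift hp hq
  set X := frontier (connectedComponentIn (range γ)ᶜ p)
  have hX : IsClosed X := isClosed_frontier
  obtain ⟨T, R, hT0, hR, hT, hRT⟩ := h.ends (‖q‖ + ‖q - p‖ + 1)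
  obtain ⟨n, m, hn, hm⟩ := h.tail (f := fun z ↦ (z - p) / (z - q)) hK hKe
    (ell_cont le_rfl) (ell_exp le_rfl) hT
  obtain ⟨C, hC⟩ := (isCompact_Icc (a := -|t₀|) (b := |t₀|)).exists_bound_of_continuousOn
    h.c.continuousOn
  obtain ⟨G, hG, hG1, hG2⟩ := closed_glue
    (hX.inter (isClosed_le continuous_const hτ : IsClosed {z | t₀ ≤ τ z}))
    (hX.inter (isClosed_le hτ continuous_const : IsClosed {z | τ z ≤ t₀}))
    (f := fun z ↦ K (τ z) - n * (2 * Real.pi * Complex.I))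
    (g := fun z ↦ K (τ z) - m * (2 * Real.pi * Complex.I))
    (by fun_prop) (by fun_prop) (by
      rintro z ⟨hz, hz1⟩ ⟨-, hz2⟩
      obtain ⟨t, rfl⟩ := hsub hz
      have : t = t₀ := by
        have h1 : t₀ ≤ τ (γ t) := hz1
        have h2 : τ (γ t) ≤ t₀ := hz2
        rw [hτγ] at h1 h2
        exact le_antisymm h2 h1
      exact absurd (this ▸ hz) ht)
  have hG' : ContinuousOn G X := hG.mono (fun z hz ↦ by
    rcases le_total t₀ (τ z) with h | h
    · exact Or.inl ⟨hz, h⟩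
    · exact Or.inr ⟨hz, h⟩)
  have hqc : ∀ z ∈ closure (connectedComponentIn (range γ)ᶜ p), z - q ≠ 0 := by
    intro z hz h0
    rw [sub_eq_zero] at h0
    subst h0
    exact hpq (comp_closure h.closed.isOpen_compl p _ hz hq)
  set R' := max R (C + 1)
  have hRR : R ≤ R' := le_max_left _ _
  have := e2inf (U := connectedComponentIn (range γ)ᶜ p) (p := p) (X := X)
    (f := fun z ↦ (z - p) / (z - q)) (h := fun z ↦ (z - q)⁻¹) (G := G) (l := ell p q) (a := 1)
    (R := R')
    h.closed.isOpen_compl.connectedComponentIn (mem_connectedComponentIn hp) hX subset_rfl hG'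
    (by
      intro z hz
      obtain ⟨t, rfl⟩ := hsub hz
      rcases le_total t₀ (τ (γ t)) with h' | h'
      · rw [hG1 _ ⟨hz, h'⟩, Complex.exp_sub, Complex.exp_int_mul, Complex.exp_two_pi_mul_I]
        simp [hτγ, hKe]
      · rw [hG2 _ ⟨hz, h'⟩, Complex.exp_sub, Complex.exp_int_mul, Complex.exp_two_pi_mul_I]
        simp [hτγ, hKe])
    (ell_cont (hR.trans hRR)) (ell_exp (hR.trans hRR))
    (by
      intro z hz hzR
      obtain ⟨t, rfl⟩ := hsub hz
      have h1 : T ≤ |t| := hRT t (hRR.trans hzR)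
      have h2 : |t₀| < |t| := by
        by_contra! h2
        have := hC t (abs_le.1 h2)
        have := (le_max_right R (C + 1)).trans hzR
        linarith
      rcases le_total 0 t with h3 | h3
      · rw [abs_of_nonneg h3] at h1 h2
        have h4 : t₀ ≤ τ (γ t) := by rw [hτγ]; exact (le_abs_self _).trans h2.le
        rw [hG1 _ ⟨hz, h4⟩, hτγ, hn t h1]
        ring
      · rw [abs_of_nonpos h3] at h1 h2
        have h4 : τ (γ t) ≤ t₀ := by rw [hτγ]; linarith [neg_abs_le t₀]
        rw [hG2 _ ⟨hz, h4⟩, hτγ, hm t (by linarith)]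
        ring)
    (ContinuousOn.inv₀ (by fun_prop) hqc) (fun z hz ↦ inv_ne_zero (hqc z hz))
    (fun z hz _ ↦ by rw [zpow_one, div_eq_mul_inv])
  exact one_ne_zero this

/-- logarithm of `(z-p)/(z-q)` on `L ∪ Γ` -/
lemma PL.logLG {γ : ℝ → ℂ} (h : PL γ) {L Ω : Set ℂ} (hL : IsClosed L)
    (hpre : IsPreconnected (γ ⁻¹' L)) (hΩ : IsPreconnected Ω) (hd : ∀ z ∈ Ω, z ∉ L)
    {p q : ℂ} (hp : p ∈ Ω) (hq : q ∈ Ω) (hp' : p ∉ range γ) (hq' : q ∉ range γ) :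
    ∃ G : ℂ → ℂ, ContinuousOn G (L ∪ range γ) ∧
      ∀ z ∈ L ∪ range γ, Complex.exp (G z) = (z - p) / (z - q) := by
  obtain ⟨τ, hτ, hτγ⟩ := h.inv
  obtain ⟨g, hg, hge⟩ := e1 hL hΩ hd hp hq
  obtain ⟨K, hK, hKe⟩ := h.lift hp' hq'
  obtain ⟨n, hn⟩ := const_int hpre (u := fun t ↦ g (γ t)) (v := K)
    (hg.comp h.c.continuousOn (fun t ht ↦ ht)) hK.continuousOn
    (fun t ht ↦ by rw [hge _ ht, hKe])
  obtain ⟨G, hG, hG1, hG2⟩ := closed_glue hL h.closed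
    (g := fun z ↦ K (τ z) + n * (2 * Real.pi * Complex.I)) hg (by fun_prop) (by
      rintro _ hz ⟨t, rfl⟩
      rw [hτγ]
      exact hn t hz)
  refine ⟨G, hG, ?_⟩
  rintro z (hz | ⟨t, rfl⟩)
  · rw [hG1 z hz, hge z hz]
  · rw [hG2 _ ⟨t, rfl⟩, Complex.exp_add, Complex.exp_int_mul, Complex.exp_two_pi_mul_I]
    simp [hτγ, hKe]

lemma PL.three {γ : ℝ → ℂ} (h : PL γ) {L Ω : Set ℂ} (hL : IsCompact L)
    (hpre : IsPreconnected (γ ⁻¹' L)) (hΩ : IsPreconnected Ω) (hd : ∀ z ∈ Ω, z ∉ L)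
    {p q r : ℂ} (hp : p ∈ Ω) (hq : q ∈ Ω) (hr : r ∈ Ω)
    (hp' : p ∉ range γ) (hq' : q ∉ range γ) (hr' : r ∉ range γ)
    (hqp : p ∉ connectedComponentIn (L ∪ range γ)ᶜ q)
    (hrp : p ∉ connectedComponentIn (L ∪ range γ)ᶜ r)
    (hqr : r ∉ connectedComponentIn (L ∪ range γ)ᶜ q) : False := by
  set X := L ∪ range γ with hXdef
  have hX : IsClosed X := hL.isClosed.union h.closed
  have hXo := hX.isOpen_compl
  have hpX : p ∈ Xᶜ := fun h ↦ h.elim (hd p hp) hp'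
  have hqX : q ∈ Xᶜ := fun h ↦ h.elim (hd q hq) hq'
  have hrX : r ∈ Xᶜ := fun h ↦ h.elim (hd r hr) hr'
  have hrq : q ∉ connectedComponentIn Xᶜ r := fun h1 ↦
    hqr (by rw [← connectedComponentIn_eq h1]; exact mem_connectedComponentIn hrX)
  obtain ⟨G1, hG1, hG1e⟩ := h.logLG hL.isClosed hpre hΩ hd hp hq hp' hq'
  obtain ⟨G2, hG2, hG2e⟩ := h.logLG hL.isClosed hpre hΩ hd hp hr hp' hr'
  set R₁ := max (‖q‖ + ‖q - p‖ + 1) (‖r‖ + ‖r - p‖ + 1)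
  have hR1 : ‖q‖ + ‖q - p‖ + 1 ≤ R₁ := le_max_left _ _
  have hR2 : ‖r‖ + ‖r - p‖ + 1 ≤ R₁ := le_max_right _ _
  obtain ⟨T, R₂, hT0, hR12, hT, hRT⟩ := h.ends R₁
  obtain ⟨n₁, m₁, hn₁, hm₁⟩ := h.tail (K := fun t ↦ G1 (γ t)) (f := fun z ↦ (z - p) / (z - q))
    (hG1.comp_continuous h.c (fun t ↦ Or.inr ⟨t, rfl⟩)) (fun t ↦ hG1e _ (Or.inr ⟨t, rfl⟩))
    (ell_cont hR1) (ell_exp hR1) hT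
  obtain ⟨n₂, m₂, hn₂, hm₂⟩ := h.tail (K := fun t ↦ G2 (γ t)) (f := fun z ↦ (z - p) / (z - r))
    (hG2.comp_continuous h.c (fun t ↦ Or.inr ⟨t, rfl⟩)) (fun t ↦ hG2e _ (Or.inr ⟨t, rfl⟩))
    (ell_cont hR2) (ell_exp hR2) hT
  obtain ⟨C, hC⟩ := hL.isBounded.exists_norm_le
  set R := max R₂ (C + 1)
  have hRR : R₂ ≤ R := le_max_left _ _
  obtain ⟨b, c, hbc, hsum⟩ : ∃ b c : ℤ, (b ≠ 0 ∨ c ≠ 0) ∧ b * n₁ + c * n₂ = b * m₁ + c * m₂ := by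
    by_cases h0 : n₁ - m₁ = 0
    · exact ⟨1, 0, by simp, by linarith⟩
    · exact ⟨n₂ - m₂, -(n₁ - m₁), Or.inr (neg_ne_zero.2 h0), by ring⟩
  have hsum' : (b * n₁ + c * n₂ : ℂ) = b * m₁ + c * m₂ := by exact_mod_cast hsum
  let f : ℂ → ℂ := fun z ↦ ((z - p) / (z - q)) ^ b * ((z - p) / (z - r)) ^ c
  let G : ℂ → ℂ := fun z ↦ b * G1 z + c * G2 z - (b * n₁ + c * n₂ : ℤ) * (2 * Real.pi * Complex.I)
  let l : ℂ → ℂ := fun z ↦ b * ell p q z + c * ell p r z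
  have hGc : ContinuousOn G X := by fun_prop
  have hGe : ∀ z ∈ X, Complex.exp (G z) = f z := by
    intro z hz
    simp only [G, f]
    rw [Complex.exp_sub, Complex.exp_int_mul _ (b * n₁ + c * n₂), Complex.exp_two_pi_mul_I,
      one_zpow, div_one, Complex.exp_add, Complex.exp_int_mul, Complex.exp_int_mul, hG1e z hz,
      hG2e z hz]
  have hlc : ContinuousOn l {z | R ≤ ‖z‖} := by
    have h1 := ell_cont (hR1.trans (hR12.trans hRR))
    have h2 := ell_cont (hR2.trans (hR12.trans hRR))
    fun_prop
  have hle : ∀ z, R ≤ ‖z‖ → Complex.exp (l z) = f z := by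
    intro z hz
    simp only [l, f]
    rw [Complex.exp_add, Complex.exp_int_mul, Complex.exp_int_mul,
      ell_exp (hR1.trans (hR12.trans hRR)) z hz, ell_exp (hR2.trans (hR12.trans hRR)) z hz]
  have hag : ∀ z ∈ X, R ≤ ‖z‖ → G z = l z := by
    rintro z (hz | ⟨t, rfl⟩) hzR
    · have := hC z hz
      have := (le_max_right R₂ (C + 1)).trans hzR
      linarith
    · have h1 := hRT t (hRR.trans hzR)
      simp only [G, l]
      push_cast
      rcases le_total 0 t with h3 | h3
      · rw [abs_of_nonneg h3] at h1
        rw [hn₁ t h1, hn₂ t h1]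
        ring
      · rw [abs_of_nonpos h3] at h1
        rw [hm₁ t (by linarith), hm₂ t (by linarith), hsum']
        ring
  have hcl : ∀ x ∈ Xᶜ, ∀ y, x ∉ connectedComponentIn Xᶜ y →
      ∀ z ∈ closure (connectedComponentIn Xᶜ y), z - x ≠ 0 := by
    intro x hx y hxy z hz h0
    rw [sub_eq_zero] at h0
    subst h0
    exact hxy (comp_closure hXo _ _ hz hx)
  have hfr : ∀ y, frontier (connectedComponentIn Xᶜ y) ⊆ X := fun y ↦ by
    simpa using comp_frontier hXo y
  have hb : -b = 0 := by
    have e1 := hcl p hpX q hqp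
    have e2 := hcl r hrX q hqr
    refine e2inf (U := connectedComponentIn Xᶜ q) (h := fun z ↦ (z - p) ^ b * ((z - p) / (z - r)) ^ c)
      hXo.connectedComponentIn (mem_connectedComponentIn hqX)
      hX (hfr q) hGc hGe hlc hle hag ?_ ?_ ?_
    · refine ContinuousOn.mul (ContinuousOn.zpow₀ (by fun_prop) _ fun z hz ↦ Or.inl (e1 z hz))
        (ContinuousOn.zpow₀ (ContinuousOn.div (by fun_prop) (by fun_prop) e2) _
          fun z hz ↦ Or.inl (div_ne_zero (e1 z hz) (e2 z hz)))
    · exact fun z hz ↦ mul_ne_zero (zpow_ne_zero _ (e1 z hz))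
        (zpow_ne_zero _ (div_ne_zero (e1 z hz) (e2 z hz)))
    · intro z hz hzq
      simp only [f]
      rw [div_zpow, zpow_neg]
      ring
  have hc : -c = 0 := by
    have e1 := hcl p hpX r hrp
    have e2 := hcl q hqX r hrq
    refine e2inf (U := connectedComponentIn Xᶜ r) (h := fun z ↦ (z - p) ^ c * ((z - p) / (z - q)) ^ b)
      hXo.connectedComponentIn (mem_connectedComponentIn hrX)
      hX (hfr r) hGc hGe hlc hle hag ?_ ?_ ?_
    · refine ContinuousOn.mul (ContinuousOn.zpow₀ (by fun_prop) _ fun z hz ↦ Or.inl (e1 z hz))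
        (ContinuousOn.zpow₀ (ContinuousOn.div (by fun_prop) (by fun_prop) e2) _
          fun z hz ↦ Or.inl (div_ne_zero (e1 z hz) (e2 z hz)))
    · exact fun z hz ↦ mul_ne_zero (zpow_ne_zero _ (e1 z hz))
        (zpow_ne_zero _ (div_ne_zero (e1 z hz) (e2 z hz)))
    · intro z hz hzq
      simp only [f]
      rw [div_zpow (z - p) (z - r) c, zpow_neg]
      ring
  omega

lemma PL.raylog {γ : ℝ → ℂ} (h : PL γ) {z₀ : ℂ} (hz₀ : z₀ ∉ range γ) :
    ∃ g : ℂ → ℂ, ContinuousOn g (γ '' Ici 0)ᶜ ∧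
      ∀ z ∈ (γ '' Ici 0)ᶜ, Complex.exp (g z) = (z - γ 0) / (z₀ - γ 0) := by
  classical
  have hne : ∀ t, z₀ - γ t ≠ 0 := fun t h0 ↦ hz₀ ⟨t, (sub_eq_zero.1 h0).symm⟩
  let u : unitInterval → ℂ := fun s ↦ if (s : ℝ) = 0 then 0 else (z₀ - γ ((1 - s) / s))⁻¹
  have hu0 : ∀ s : unitInterval, (s : ℝ) = 0 → u s = 0 := fun s hs ↦ if_pos hs
  have hu1 : ∀ s : unitInterval, (s : ℝ) ≠ 0 → u s = (z₀ - γ ((1 - s) / s))⁻¹ :=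
    fun s hs ↦ if_neg hs
  have hu : Continuous u := by
    rw [continuous_iff_continuousAt]
    intro s
    by_cases hs : (s : ℝ) = 0
    · have hs' : u s = 0 := hu0 s hs
      rw [ContinuousAt, hs', Metric.tendsto_nhds]
      intro ε hε
      obtain ⟨T, hT, hTf⟩ := h.far (‖z₀‖ + ε⁻¹ + 1)
      have hlt : ∀ᶠ x : unitInterval in 𝓝 s, (x : ℝ) < (T + 1)⁻¹ :=
        continuous_subtype_val.continuousAt.eventually_lt continuousAt_const
          (by rw [hs]; positivity)
      filter_upwards [hlt] with x hx
      by_cases hx0 : (x : ℝ) = 0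
      · rw [hu0 x hx0, dist_self]
        exact hε
      · have hxp : 0 < (x : ℝ) := lt_of_le_of_ne x.2.1 (Ne.symm hx0)
        have h1 : T ≤ (1 - x) / (x : ℝ) := by
          rw [le_div_iff₀ hxp]
          rw [lt_inv_comm₀ hxp (by positivity)] at hx
          have := mul_inv_cancel₀ hx0
          nlinarith
        have h2 : ‖z₀‖ + ε⁻¹ + 1 < ‖γ ((1 - x) / x)‖ := by
          by_contra! h3
          exact absurd (hTf _ h3) (not_lt.2 (h1.trans (le_abs_self _)))
        have h3 : ε⁻¹ < ‖z₀ - γ ((1 - x) / x)‖ := by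
          have := norm_sub_norm_le (γ ((1 - x) / x)) z₀
          rw [norm_sub_rev] at this
          linarith
        simp only [u, hx0, if_false, dist_zero_right, norm_inv]
        exact inv_lt_of_inv_lt₀ hε h3
    · have hev : ∀ᶠ x : unitInterval in 𝓝 s, (z₀ - γ ((1 - x) / x))⁻¹ = u x := by
        filter_upwards [continuous_subtype_val.continuousAt.eventually_ne hs] with x hx
        simp only [u]
        rw [if_neg hx]
      refine ContinuousAt.congr ?_ hev
      refine ContinuousAt.inv₀ ?_ (hne _)
      refine continuousAt_const.sub (h.c.continuousAt.comp ?_)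
      exact ContinuousAt.div (by fun_prop) (by fun_prop) hs
  let U := (γ '' Ici 0)ᶜ
  have hH0 : ∀ x : unitInterval × U, 1 + ((x.2 : ℂ) - z₀) * u x.1 ≠ 0 := by
    rintro ⟨s, z, hz⟩
    by_cases hs : (s : ℝ) = 0
    · simp [hu0 s hs]
    · simp only [u, hs, if_false]
      intro h0
      have h1 := hne ((1 - s) / s)
      field_simp at h0
      apply hz
      refine ⟨(1 - s) / s, div_nonneg (by linarith [s.2.2]) s.2.1, ?_⟩
      linear_combination -h0
  let H : C(unitInterval × U, {z : ℂ // z ≠ 0}) :=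
    ⟨fun x ↦ ⟨1 + ((x.2 : ℂ) - z₀) * u x.1, hH0 x⟩, by
      apply Continuous.subtype_mk
      fun_prop⟩
  have hH : ∀ a : U, H (0, a) = (⟨_, (ContinuousMap.const U (0 : ℂ) a).exp_ne_zero⟩ : {z : ℂ // z ≠ 0}) := by
    intro a
    apply Subtype.ext
    simp [H, u]
  let W := Complex.isCoveringMap_exp.liftHomotopy H (ContinuousMap.const U 0) hH
  have hW := Complex.isCoveringMap_exp.liftHomotopy_lifts H (ContinuousMap.const U 0) hH
  refine ⟨fun z ↦ if hz : z ∈ U then W (1, ⟨z, hz⟩) else 0, ?_, fun z hz ↦ ?_⟩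
  · rw [continuousOn_iff_continuous_domRestrict]
    have : Continuous fun x : U ↦ W (1, x) := by fun_prop
    convert this using 1
    ext x
    have hx : (x : ℂ) ∈ U := x.2
    simp [Set.domRestrict, hx]
  · have hz' : z ∈ U := hz
    have h1 := congrArg Subtype.val (congrFun hW (1, ⟨z, hz'⟩))
    have h2 := hne 0
    have h3 : Complex.exp (W (1, ⟨z, hz'⟩)) = 1 + (z - z₀) * u 1 := h1
    simp only [hz', dif_pos, h3]
    have hu_one : u 1 = (z₀ - γ 0)⁻¹ := by
      rw [hu1 1 (by simp)]
      simp
    rw [hu_one]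
    field_simp
    ring

lemma PL.neg {γ : ℝ → ℂ} (h : PL γ) : PL (fun t ↦ γ (-t)) where
  c := h.c.comp continuous_neg
  i := h.i.comp neg_injective
  p := fun K hK ↦ by
    have := (h.p K hK).image continuous_neg
    convert this using 1
    ext t
    simp

lemma PL.nonempty {γ : ℝ → ℂ} (h : PL γ) : (range γ)ᶜ.Nonempty := by
  by_contra! hne
  rw [compl_empty_iff] at hne
  obtain ⟨τ, hτ, hτγ⟩ := h.inv
  have hc : IsPreconnected ({γ 0}ᶜ : Set ℂ) :=
    (isConnected_compl_singleton_of_one_lt_rank (by simp) _).isPreconnected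
  have h1 : (-1 : ℝ) ∈ τ '' {γ 0}ᶜ := ⟨γ (-1), fun h' ↦ by simpa using h.i h', hτγ _⟩
  have h2 : (1 : ℝ) ∈ τ '' {γ 0}ᶜ := ⟨γ 1, fun h' ↦ by simpa using h.i h', hτγ _⟩
  obtain ⟨z, hz, hz0⟩ := (hc.image τ hτ.continuousOn).ordConnected.out h1 h2
    (show (0 : ℝ) ∈ Icc (-1) 1 by simp)
  obtain ⟨t, rfl⟩ : z ∈ range γ := hne ▸ mem_univ z
  rw [hτγ] at hz0
  subst hz0
  exact hz rfl

lemma PL.sep {γ : ℝ → ℂ} (h : PL γ) : ¬ IsPreconnected (range γ)ᶜ := by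
  classical
  intro hpc
  obtain ⟨z₀, hz₀⟩ := h.nonempty
  obtain ⟨g, hg, hge⟩ := h.raylog hz₀
  obtain ⟨k, hk, hke⟩ := h.neg.raylog (z₀ := z₀) (by
    rintro ⟨t, rfl⟩
    exact hz₀ ⟨-t, rfl⟩)
  have hset : (fun t ↦ γ (-t)) '' Ici 0 = γ '' Iic 0 := by
    ext z
    constructor
    · rintro ⟨t, ht, rfl⟩
      exact ⟨-t, by simpa using ht, rfl⟩
    · rintro ⟨t, ht, rfl⟩
      exact ⟨-t, by simpa using ht, by simp⟩
  simp only [hset, neg_zero] at hk hke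
  have hcl1 : IsClosed (γ '' Ici 0) := h.emb.isClosedMap _ isClosed_Ici
  have hcl2 : IsClosed (γ '' Iic 0) := h.emb.isClosedMap _ isClosed_Iic
  have hs1 : (range γ)ᶜ ⊆ (γ '' Ici 0)ᶜ := compl_subset_compl.2 (image_subset_range _ _)
  have hs2 : (range γ)ᶜ ⊆ (γ '' Iic 0)ᶜ := compl_subset_compl.2 (image_subset_range _ _)
  obtain ⟨n, hn⟩ := const_int hpc (hg.mono hs1) (hk.mono hs2)
    (fun z hz ↦ by rw [hge z (hs1 hz), hke z (hs2 hz)])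
  let k' : ℂ → ℂ := fun z ↦ k z + n * (2 * Real.pi * Complex.I)
  have hk' : ContinuousOn k' (γ '' Iic 0)ᶜ := by fun_prop
  have hk'e : ∀ z ∈ (γ '' Iic 0)ᶜ, Complex.exp (k' z) = (z - γ 0) / (z₀ - γ 0) := by
    intro z hz
    simp only [k']
    rw [Complex.exp_add, Complex.exp_int_mul, Complex.exp_two_pi_mul_I, hke z hz]
    simp
  have hor : ∀ z, z ≠ γ 0 → z ∈ (γ '' Ici 0)ᶜ ∨ z ∈ (γ '' Iic 0)ᶜ := by
    intro z hz
    by_contra! hcon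
    obtain ⟨h1, h2⟩ := hcon
    simp only [mem_compl_iff, not_not] at h1 h2
    obtain ⟨s, hs, rfl⟩ := h1
    obtain ⟨t, ht, hst⟩ := h2
    have := h.i hst
    subst this
    exact hz (congrArg γ (le_antisymm ht hs))
  have hag : ∀ z ∈ (γ '' Ici 0)ᶜ, z ∈ (γ '' Iic 0)ᶜ → g z = k' z := by
    intro z h1 h2
    apply hn
    rintro ⟨t, rfl⟩
    rcases le_total 0 t with h3 | h3
    · exact h1 ⟨t, h3, rfl⟩
    · exact h2 ⟨t, h3, rfl⟩
  let H : ℂ → ℂ := fun z ↦ if z ∈ (γ '' Ici 0)ᶜ then g z else k' z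
  have hH1 : ∀ z ∈ (γ '' Ici 0)ᶜ, H z = g z := fun z hz ↦ if_pos hz
  have hH2 : ∀ z ∈ (γ '' Iic 0)ᶜ, H z = k' z := fun z hz ↦ by
    by_cases hz' : z ∈ (γ '' Ici 0)ᶜ
    · rw [hH1 z hz', hag z hz' hz]
    · exact if_neg hz'
  have hz₀' : z₀ - γ 0 ≠ 0 := fun h0 ↦ hz₀ ⟨0, (sub_eq_zero.1 h0).symm⟩
  have := circle_lemma (p := γ 0) (R := 1) one_pos (k := 1) (c := (z₀ - γ 0)⁻¹) (H := H)
    (by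
      intro z hz
      have hzne : z ≠ γ 0 := by
        rintro rfl
        simp at hz
      apply ContinuousAt.continuousWithinAt
      rcases hor z hzne with h1 | h1
      · exact ((hg.congr hH1).continuousAt (hcl1.isOpen_compl.mem_nhds h1))
      · exact ((hk'.congr hH2).continuousAt (hcl2.isOpen_compl.mem_nhds h1)))
    (by
      intro z hz
      have hzne : z ≠ γ 0 := by
        rintro rfl
        simp at hz
      rcases hor z hzne with h1 | h1
      · rw [hH1 z h1, hge z h1]; field_simp
      · rw [hH2 z h1, hk'e z h1]; field_simp)
  exact one_ne_zero this

lemma exterior {R : ℝ} (_hR : 0 ≤ R) : IsPreconnected {z : ℂ | R < ‖z‖} := by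
  have h1 : IsPreconnected ((fun x : ℝ × ℝ ↦ (x.1 : ℂ) * Complex.exp (x.2 * Complex.I)) ''
      (Ioi R ×ˢ univ)) :=
    (isPreconnected_Ioi.prod isPreconnected_univ).image _ (by fun_prop)
  convert h1 using 1
  ext z
  constructor
  · intro hz
    exact ⟨(‖z‖, Complex.arg z), ⟨hz, mem_univ _⟩, Complex.norm_mul_exp_arg_mul_I z⟩
  · rintro ⟨⟨r, θ⟩, ⟨hr, -⟩, rfl⟩
    have hr' : R < r := hr
    simp only [mem_ofPred_eq, norm_mul, Complex.norm_exp_ofReal_mul_I, mul_one,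
      Complex.norm_real, Real.norm_eq_abs]
    exact hr'.trans_le (le_abs_self _)

/-- The set of connected components of a subset of the complex plane. -/
def comps (S : Set ℂ) : Set (Set ℂ) := {C | ∃ x ∈ S, C = connectedComponentIn S x}

theorem main {γ : ℝ → ℂ} (h : PL γ) :
    (∃ C₁ C₂ : Set ℂ, C₁ ≠ C₂ ∧ comps (range γ)ᶜ = {C₁, C₂}) ∧
    ∀ A ∈ comps (range γ)ᶜ, (¬ Bornology.IsBounded A) ∧ frontier A = range γ ∧
      (∀ K : Set ℂ, IsCompact K → ∃ Ω : Set ℂ, IsOpen Ω ∧ Ω ⊆ Kᶜ ∧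
        IsCompact Ωᶜ ∧ IsConnected (A ∩ Ω)) := by
  have hex : ∃ p q : ℂ, p ∉ range γ ∧ q ∉ range γ ∧ q ∉ connectedComponentIn (range γ)ᶜ p := by
    by_contra! hcon
    apply h.sep
    refine isPreconnected_of_forall_pair (fun x hx y hy ↦ ?_)
    exact ⟨_, connectedComponentIn_subset _ x, mem_connectedComponentIn hx, hcon x y hx hy,
      isPreconnected_connectedComponentIn⟩
  obtain ⟨p, q, hp, hq, hpq⟩ := hex
  have hqp : p ∉ connectedComponentIn (range γ)ᶜ q := fun h1 ↦
    hpq (by rw [← connectedComponentIn_eq h1]; exact mem_connectedComponentIn hq)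
  have htwo : ∀ r, r ∉ range γ → r ∈ connectedComponentIn (range γ)ᶜ p ∨
      r ∈ connectedComponentIn (range γ)ᶜ q := by
    intro r hr
    by_contra! hcon
    have hL : ({γ 0} ∪ range γ) = range γ := by
      apply union_eq_right.2
      simp
    refine h.three (L := {γ 0}) (Ω := {γ 0}ᶜ) (p := r) (q := p) (r := q) isCompact_singleton ?_
      (isConnected_compl_singleton_of_one_lt_rank (by simp) _).isPreconnected
      (fun z hz ↦ hz) ?_ ?_ ?_ hr hp hq (by rw [hL]; exact hcon.1) (by rw [hL]; exact hcon.2)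
      (by rw [hL]; exact hpq)
    · have : γ ⁻¹' {γ 0} = {0} := by
        ext t
        simp [h.i.eq_iff]
      rw [this]
      exact isPreconnected_singleton
    · rintro rfl
      exact hr ⟨0, rfl⟩
    · rintro rfl
      exact hp ⟨0, rfl⟩
    · rintro rfl
      exact hq ⟨0, rfl⟩
  refine ⟨⟨connectedComponentIn (range γ)ᶜ p, connectedComponentIn (range γ)ᶜ q, ?_, ?_⟩, ?_⟩
  · intro heq
    exact hpq (heq ▸ mem_connectedComponentIn hq)
  · ext C
    constructor
    · rintro ⟨x, hx, rfl⟩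
      rcases htwo x hx with h1 | h1
      · exact Or.inl (connectedComponentIn_eq h1).symm
      · exact Or.inr (connectedComponentIn_eq h1).symm
    · rintro (rfl | rfl)
      · exact ⟨p, hp, rfl⟩
      · exact ⟨q, hq, rfl⟩
  rintro _ ⟨x, hx, rfl⟩
  obtain ⟨y, hy, hxy⟩ : ∃ y, y ∉ range γ ∧ y ∉ connectedComponentIn (range γ)ᶜ x := by
    by_cases h1 : p ∈ connectedComponentIn (range γ)ᶜ x
    · exact ⟨q, hq, by rwa [connectedComponentIn_eq h1]⟩
    · exact ⟨p, hp, h1⟩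
  refine ⟨h.unbdd hx, h.frontier_eq hx hy hxy, fun K hK ↦ ?_⟩
  obtain ⟨C, hC⟩ := hK.isBounded.exists_norm_le
  set R := max C 0
  obtain ⟨T, hT0, hT⟩ := h.far R
  set L := Metric.closedBall (0 : ℂ) R ∪ γ '' Icc (-T) T with hLdef
  have hL : IsCompact L := (isCompact_closedBall _ _).union (isCompact_Icc.image h.c)
  have hKL : K ⊆ L := fun z hz ↦ Or.inl (by simpa [R] using Or.inl (hC z hz))
  have hpreL : γ ⁻¹' L = Icc (-T) T := by
    ext t
    constructor
    · rintro (h1 | ⟨s, hs, hst⟩)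
      · exact abs_le.1 (hT t (by simpa using h1)).le
      · rwa [← h.i hst]
    · intro ht
      exact Or.inr ⟨t, ht, rfl⟩
  obtain ⟨M, hM0, hM⟩ := hL.isBounded.subset_closedBall_lt 0 (0 : ℂ)
  have hext : {z : ℂ | M < ‖z‖} ⊆ Lᶜ := by
    intro z hz hzL
    have h1 := hM hzL
    have h2 : M < ‖z‖ := hz
    rw [mem_closedBall_zero_iff] at h1
    linarith
  set w : ℂ := ((M + 1 : ℝ) : ℂ)
  have hw : w ∈ {z : ℂ | M < ‖z‖} := by
    have h1 : (0 : ℝ) ≤ M + 1 := by linarith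
    show M < ‖((M + 1 : ℝ) : ℂ)‖
    rw [Complex.norm_real, Real.norm_eq_abs, abs_of_nonneg h1]
    linarith
  set Ω := connectedComponentIn Lᶜ w
  have hΩext : {z : ℂ | M < ‖z‖} ⊆ Ω :=
    (exterior hM0.le).subset_connectedComponentIn hw hext
  have hΩo : IsOpen Ω := hL.isClosed.isOpen_compl.connectedComponentIn
  have hΩL : Ω ⊆ Lᶜ := connectedComponentIn_subset _ _
  have hΩc : Ωᶜ ⊆ Metric.closedBall 0 M := by
    intro z hz
    by_contra h1
    exact hz (hΩext (by simpa using h1))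
  have hmeet : ∀ v, v ∉ range γ → (connectedComponentIn (range γ)ᶜ v ∩ Ω).Nonempty := by
    intro v hv
    by_contra! h1
    refine h.unbdd hv (Metric.isBounded_closedBall.subset (Subset.trans ?_ hΩc))
    intro z hz hzΩ
    have : z ∈ connectedComponentIn (range γ)ᶜ v ∩ Ω := ⟨hz, hzΩ⟩
    rw [h1] at this
    exact this
  refine ⟨Ω, hΩo, fun z hz hzK ↦ hΩL hz (hKL hzK),
    (isCompact_closedBall (0 : ℂ) M).of_isClosed_subset hΩo.isClosed_compl hΩc, hmeet x hx, ?_⟩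
  refine isPreconnected_of_forall_pair ?_
  rintro a ⟨haA, haΩ⟩ b ⟨hbA, hbΩ⟩
  obtain ⟨r, hrB, hrΩ⟩ := hmeet y hy
  have haΓ : a ∉ range γ := connectedComponentIn_subset _ _ haA
  have hbΓ : b ∉ range γ := connectedComponentIn_subset _ _ hbA
  have hrΓ : r ∉ range γ := connectedComponentIn_subset _ _ hrB
  have hrA : r ∉ connectedComponentIn (range γ)ᶜ x := by
    intro h1
    apply hxy
    rw [connectedComponentIn_eq h1, ← connectedComponentIn_eq hrB]
    exact mem_connectedComponentIn hy
  have hsub : (L ∪ range γ)ᶜ ⊆ (range γ)ᶜ := compl_subset_compl.2 subset_union_right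
  have hsubL : (L ∪ range γ)ᶜ ⊆ Lᶜ := compl_subset_compl.2 subset_union_left
  have key : b ∈ connectedComponentIn (L ∪ range γ)ᶜ a := by
    by_contra hba
    have hF : ∀ v ∈ Ω, v ∉ range γ → v ∈ (L ∪ range γ)ᶜ := fun v h1 h2 h3 ↦
      h3.elim (hΩL h1) h2
    refine h.three (p := r) (q := a) (r := b) hL (hpreL ▸ isPreconnected_Icc)
      isPreconnected_connectedComponentIn (fun z hz ↦ hΩL hz) hrΩ haΩ hbΩ hrΓ haΓ hbΓ ?_ ?_ hba
    · intro h1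
      apply hrA
      rw [connectedComponentIn_eq haA]
      exact connectedComponentIn_mono a hsub h1
    · intro h1
      apply hrA
      rw [connectedComponentIn_eq hbA]
      exact connectedComponentIn_mono b hsub h1
  have haF : a ∈ (L ∪ range γ)ᶜ := fun h3 ↦ h3.elim (hΩL haΩ) haΓ
  refine ⟨connectedComponentIn (L ∪ range γ)ᶜ a, fun z hz ↦ ⟨?_, ?_⟩,
    mem_connectedComponentIn haF, key, isPreconnected_connectedComponentIn⟩
  · rw [connectedComponentIn_eq haA]
    exact connectedComponentIn_mono a hsub hz
  · show z ∈ connectedComponentIn Lᶜ w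
    rw [connectedComponentIn_eq haΩ]
    exact connectedComponentIn_mono a hsubL hz


end JL

/-- Lemma B.1: the complement of the range of a continuous injective
proper map ℝ → ℝ² has exactly two connected components; each is unbounded, has the
range as boundary, and admits connected "neighborhoods of infinity". -/
theorem jordan_for_proper_lines
    (γ : ℝ → R2) (hcont : Continuous γ) (hinj : Function.Injective γ)
    (hproper : ∀ K : Set R2, IsCompact K → IsCompact (γ ⁻¹' K)) :
    (∃ C₁ C₂ : Set R2, C₁ ≠ C₂ ∧ components (Set.range γ)ᶜ = {C₁, C₂}) ∧
    ∀ A ∈ components (Set.range γ)ᶜ,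
      (¬ Bornology.IsBounded A) ∧
      frontier A = Set.range γ ∧
      (∀ K : Set R2, IsCompact K → ∃ Ω : Set R2, IsOpen Ω ∧ Ω ⊆ Kᶜ ∧
        IsCompact Ωᶜ ∧ IsConnected (A ∩ Ω)) := by
  let e : ℂ ≃ₜ ℝ × ℝ := Complex.equivRealProdCLM.toHomeomorph
  have hP : JL.PL (e.symm ∘ γ) :=
    { c := e.symm.continuous.comp hcont
      i := e.symm.injective.comp hinj
      p := fun K hK ↦ by
        have h1 := hproper (e.symm ⁻¹' K) (e.symm.isCompact_preimage.2 hK)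
        exact h1 }
  have hr : e '' (Set.range (e.symm ∘ γ)) = Set.range γ := by
    rw [← Set.range_comp]
    congr 1
  have hrc : e '' (Set.range (e.symm ∘ γ))ᶜ = (Set.range γ)ᶜ := by
    rw [e.image_compl, hr]
  have hcomp : components (Set.range γ)ᶜ =
      (fun A ↦ e '' A) '' JL.comps (Set.range (e.symm ∘ γ))ᶜ := by
    ext C
    constructor
    · rintro ⟨x, hx, rfl⟩
      rw [← hrc] at hx ⊢
      obtain ⟨y, hy, rfl⟩ := hx
      exact ⟨_, ⟨y, hy, rfl⟩, e.image_connectedComponentIn hy⟩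
    · rintro ⟨_, ⟨y, hy, rfl⟩, rfl⟩
      refine ⟨e y, hrc ▸ Set.mem_image_of_mem e hy, ?_⟩
      simp only
      rw [e.image_connectedComponentIn hy, hrc]
  obtain ⟨⟨C₁, C₂, hne, hC⟩, hA⟩ := JL.main hP
  refine ⟨⟨e '' C₁, e '' C₂, fun h ↦ hne (e.injective.image_injective h), ?_⟩, ?_⟩
  · rw [hcomp, hC, Set.image_pair]
  · rw [hcomp]
    rintro _ ⟨A, hAm, rfl⟩
    obtain ⟨hb, hf, hK⟩ := hA A hAm
    refine ⟨fun hbd ↦ hb ?_, ?_, fun K hKc ↦ ?_⟩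
    · have h1 : IsCompact (e ⁻¹' closure (e '' A)) :=
        e.isCompact_preimage.2 hbd.isCompact_closure
      exact h1.isBounded.subset fun x hx ↦ subset_closure (Set.mem_image_of_mem e hx)
    · simp only
      rw [← e.image_frontier, hf, hr]
    · obtain ⟨Ω, hΩo, hΩK, hΩc, hΩA⟩ := hK (e ⁻¹' K) (e.isCompact_preimage.2 hKc)
      refine ⟨e '' Ω, e.isOpenMap _ hΩo, ?_, ?_, ?_⟩
      · rintro _ ⟨x, hx, rfl⟩
        exact hΩK hx
      · rw [← e.image_compl]
        exact hΩc.image e.continuous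
      · simp only
        rw [← Set.image_inter e.injective]
        exact hΩA.image e e.continuous.continuousOn

end
end

section
/- Let A ⊆ ℝ² be a good set. Then: (i) for every connected component B of A, the boundary ∂B is a union of connected components of ∂A; (ii) every connected component of ∂A is contained in ∂B for exactly one connected component B of A (in particular, the boundaries of distinct connected components of A are disjoint); (iii) every connected component of A is itself a good set. -/
noncomputable section

open Set Filter Topology in
/-- A continuous nonvanishing function on a nice space has a continuous logarithm. -/
theorem gsc_exists_log {X : Type*} [TopologicalSpace X] [SimplyConnectedSpace X]
    [LocallyPathConnectedSpace X] (g : X → ℂ) (hg : Continuous g) (h0 : ∀ x, g x ≠ 0)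
    (x₀ : X) (e₀ : ℂ) (he : Complex.exp e₀ = g x₀) :
    ∃ F : X → ℂ, Continuous F ∧ F x₀ = e₀ ∧ ∀ x, Complex.exp (F x) = g x := by
  obtain ⟨F, ⟨h1, h2⟩, -⟩ := Complex.isCoveringMapOn_exp.existsUnique_continuousMap_lifts
    (A := X) ⟨g, hg⟩ (a₀ := x₀) (e₀ := e₀) he (by simpa using h0)
  exact ⟨F, F.continuous, h1, fun x => congrFun h2 x⟩

/-- The identification of the plane with the complex numbers. -/
def gscPhi (x : ℝ × ℝ) : ℂ := ⟨x.1, x.2⟩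

theorem gscPhi_continuous : Continuous gscPhi := Complex.equivRealProdCLM.symm.continuous

theorem gscPhi_inj {x y : ℝ × ℝ} : gscPhi x = gscPhi y ↔ x = y := by
  simp [gscPhi, Complex.ext_iff, Prod.ext_iff]

open Set Filter Topology in
/-- No nonvanishing continuous function on the plane agrees with `z - a` at infinity. -/
theorem gsc_no_ext (h : ℝ × ℝ → ℂ) (hc : Continuous h) (h0 : ∀ x, h x ≠ 0) (a : ℝ × ℝ) (R : ℝ)
    (hR : 0 < R) (hh : ∀ x, R ≤ ‖gscPhi x - gscPhi a‖ → h x = gscPhi x - gscPhi a) : False := by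
  obtain ⟨H, Hc, -, He⟩ := gsc_exists_log h hc h0 a (Complex.log (h a)) (Complex.exp_log (h0 a))
  let c : ℝ → ℝ × ℝ := fun θ => (a.1 + R * Real.cos θ, a.2 + R * Real.sin θ)
  have hcc : Continuous c := by fun_prop
  have hcv : ∀ θ : ℝ, gscPhi (c θ) - gscPhi a = R * Complex.exp (θ * Complex.I) := by
    intro θ
    rw [Complex.exp_mul_I]
    apply Complex.ext <;> simp [gscPhi, c, Complex.cos_ofReal_re, Complex.sin_ofReal_re,
      Complex.cos_ofReal_im, Complex.sin_ofReal_im]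
  have hn : ∀ θ : ℝ, ‖gscPhi (c θ) - gscPhi a‖ = R := by
    intro θ
    rw [hcv, norm_mul, Complex.norm_exp_ofReal_mul_I]
    simp [abs_of_pos hR]
  have hE : ∀ θ : ℝ, Complex.exp (H (c θ) - θ * Complex.I) = R := by
    intro θ
    rw [Complex.exp_sub, He, hh _ (hn θ).ge, hcv]
    field_simp
  let G : ℝ → ℂ := fun θ => H (c θ) - θ * Complex.I
  have hGc : Continuous G := by fun_prop
  have hRC : (R : ℂ) ≠ 0 := by exact_mod_cast hR.ne'
  obtain ⟨F, -, hF⟩ := (Complex.isCoveringMapOn_exp.existsUnique_continuousMap_lifts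
    (A := ℝ) ⟨fun _ => (R : ℂ), continuous_const⟩ (a₀ := (0 : ℝ)) (e₀ := G 0)
    (hE 0) (by simpa using hRC))
  have e1 := hF ⟨G, hGc⟩ ⟨rfl, by ext θ; exact hE θ⟩
  have e2 := hF ⟨fun _ => G 0, continuous_const⟩ ⟨rfl, by ext θ; exact hE 0⟩
  have e3 : G (2 * Real.pi) = G 0 := by
    have := e1.trans e2.symm
    exact congrArg (fun f : C(ℝ, ℂ) => f (2 * Real.pi)) this
  have hc2 : c (2 * Real.pi) = c 0 := by simp [c]
  simp only [G, hc2] at e3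
  have := Real.pi_ne_zero
  simp at e3

open Set Filter Topology in
/-- A planar version of Janiszewski's theorem for an arc meeting a closed set in an endpoint. -/
theorem gsc_sep (σ : ℝ → ℝ × ℝ) (hσ : Continuous σ) (s t : ℝ) (hst : s ≤ t)
    (hinj : InjOn σ (Icc s t)) (Y : Set (ℝ × ℝ)) (hY : IsClosed Y)
    (hXY : ∀ u ∈ Icc s t, σ u ∈ Y → u = s) (a b : ℝ × ℝ)
    (hab : ∀ x ∈ segment ℝ a b, x ∉ Y) (haX : a ∉ σ '' Icc s t) (hbX : b ∉ σ '' Icc s t)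
    (O : Set (ℝ × ℝ)) (hOb : Bornology.IsBounded O)
    (hOf : frontier O ⊆ σ '' Icc s t ∪ Y) (haO : a ∈ O) (hbO : b ∉ closure O) : False := by
  classical
  set X := σ '' Icc s t with hX
  have hXcomp : IsCompact X := isCompact_Icc.image hσ
  have haY : a ∉ Y := hab a (left_mem_segment ℝ a b)
  have hbY : b ∉ Y := hab b (right_mem_segment ℝ a b)
  let g : ℝ × ℝ → ℂ := fun x => (gscPhi x - gscPhi a) / (gscPhi x - gscPhi b)
  have hφ := gscPhi_continuous
  have hsub : ∀ x y, x ≠ y → gscPhi x - gscPhi y ≠ 0 := fun x y h =>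
    sub_ne_zero.2 (fun h' => h (gscPhi_inj.1 h'))
  have hg0 : ∀ x, x ≠ a → x ≠ b → g x ≠ 0 := fun x h1 h2 => div_ne_zero (hsub _ _ h1) (hsub _ _ h2)
  have hgc : ContinuousOn g {b}ᶜ := by
    apply ContinuousOn.div (by fun_prop) (by fun_prop)
    intro x hx
    exact hsub _ _ hx
  -- logarithm along the arc
  let cl : ℝ → ℝ := fun u => max s (min u t)
  have hclm : ∀ u, cl u ∈ Icc s t := fun u => ⟨le_max_left _ _, max_le hst (min_le_right _ _)⟩
  have hclc : Continuous cl := by fun_prop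
  have hXa : ∀ u ∈ Icc s t, σ u ≠ a := fun u hu h => haX ⟨u, hu, h⟩
  have hXb : ∀ u ∈ Icc s t, σ u ≠ b := fun u hu h => hbX ⟨u, hu, h⟩
  have hsm : s ∈ Icc s t := ⟨le_rfl, hst⟩
  obtain ⟨F, Fc, Fs, Fe⟩ := gsc_exists_log (fun u => g (σ (cl u)))
    (hgc.comp_continuous (hσ.comp hclc) (fun u => hXb _ (hclm u)))
    (fun u => hg0 _ (hXa _ (hclm u)) (hXb _ (hclm u))) s (Complex.log (g (σ s)))
    (by
      have : cl s = s := by simp [cl, hst]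
      rw [this, Complex.exp_log (hg0 _ (hXa _ hsm) (hXb _ hsm))])
  have hemb : IsClosedEmbedding (fun u : Icc s t => σ u) :=
    Continuous.isClosedEmbedding (by fun_prop)
      (fun u v h => Subtype.ext (hinj u.2 v.2 h))
  obtain ⟨LX, hLX⟩ := ContinuousMap.exists_extension' (Y := ℂ) hemb
    ⟨fun u : Icc s t => F u, by fun_prop⟩
  have hLX' : ∀ u ∈ Icc s t, LX (σ u) = F u := fun u hu => congrFun hLX ⟨u, hu⟩
  -- logarithm on Y
  have hslit : ∀ x ∈ Y, g x ∈ Complex.slitPlane := by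
    intro x hx
    by_contra hns
    have hxb : x ≠ b := fun h => hbY (h ▸ hx)
    have hxa : x ≠ a := fun h => haY (h ▸ hx)
    rw [Complex.mem_slitPlane_iff, not_or, not_lt, not_not] at hns
    obtain ⟨h1, h2⟩ := hns
    set k := -(g x).re with hk
    have hk0 : 0 ≤ k := by linarith
    have hgx : g x = -(k : ℂ) := by
      apply Complex.ext <;> simp [hk, h2]
    have h3 : gscPhi x - gscPhi a = -(k : ℂ) * (gscPhi x - gscPhi b) := by
      rw [← hgx]; exact (div_mul_cancel₀ _ (hsub _ _ hxb)).symm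
    apply hab x _ hx
    have hk1 : (1 + k) ≠ 0 := by linarith
    refine ⟨1 / (1 + k), k / (1 + k), by positivity, by positivity, by field_simp, ?_⟩
    have hre := congrArg Complex.re h3
    have him := congrArg Complex.im h3
    simp [gscPhi] at hre him
    apply Prod.ext
    · simp; field_simp; linarith
    · simp; field_simp; linarith
  let L : ℝ × ℝ → ℂ := fun x => if x ∈ Y then Complex.log (g x) else LX x
  have hLY : ContinuousOn L Y := by
    have h1 : ContinuousOn (fun x => Complex.log (g x)) Y :=
      (hgc.mono (fun x hx h => hbY (h ▸ hx))).clog hslit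
    exact h1.congr (fun x hx => by simp [L, hx])
  have hLXX : EqOn L LX X := by
    rintro x ⟨u, hu, rfl⟩
    by_cases hy : σ u ∈ Y
    · have := hXY u hu hy
      subst this
      simp [L, hy, hLX' _ hu, Fs]
    · simp [L, hy]
  have hLc : ContinuousOn L (X ∪ Y) :=
    ContinuousOn.union_of_isClosed (LX.continuous.continuousOn.congr hLXX) hLY hXcomp.isClosed hY
  have hLe : ∀ x ∈ X ∪ Y, Complex.exp (L x) = g x := by
    rintro x (hx | hx)
    · rw [hLXX hx]
      obtain ⟨u, hu, rfl⟩ := hx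
      rw [hLX' u hu, Fe]
      have : cl u = u := by simp [cl, hu.1, hu.2]
      rw [this]
    · simp only [L, hx, if_true]
      exact Complex.exp_log (Complex.slitPlane_ne_zero (hslit x hx))
  obtain ⟨M, hM⟩ := ContinuousMap.exists_restrict_eq (Y := ℂ) (hXcomp.isClosed.union hY)
    ⟨(X ∪ Y).domRestrict L, continuousOn_iff_continuous_domRestrict.mp hLc⟩
  have hM' : ∀ x ∈ X ∪ Y, M x = L x := fun x hx =>
    congrArg (fun f : C(↥(X ∪ Y), ℂ) => f ⟨x, hx⟩) hM
  let h : ℝ × ℝ → ℂ := fun x => if x ∈ O then Complex.exp (M x) * (gscPhi x - gscPhi b)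
    else gscPhi x - gscPhi a
  have hfr : ∀ x ∈ frontier O, Complex.exp (M x) * (gscPhi x - gscPhi b) = gscPhi x - gscPhi a := by
    intro x hx
    have hxm := hOf hx
    have hxb : x ≠ b := fun h => hbO (h ▸ frontier_subset_closure hx)
    rw [hM' x hxm, hLe x hxm]
    exact div_mul_cancel₀ _ (hsub _ _ hxb)
  have hhc : Continuous h := by
    refine Continuous.if (p := fun x => x ∈ O) hfr ?_ ?_
    · have := M.continuous
      fun_prop
    · fun_prop
  have hh0 : ∀ x, h x ≠ 0 := by
    intro x
    by_cases hx : x ∈ O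
    · simp only [h, hx, if_true]
      exact mul_ne_zero (Complex.exp_ne_zero _) (hsub _ _ (fun h => hbO (h ▸ subset_closure hx)))
    · simp only [h, hx, if_false]
      exact hsub _ _ (fun h => hx (h ▸ haO))
  have hbd : IsCompact (closure O) := hOb.isCompact_closure
  obtain ⟨C, hC⟩ := (hbd.image (f := fun x => ‖gscPhi x - gscPhi a‖) (by fun_prop)).bddAbove
  refine gsc_no_ext h hhc hh0 a (max C 0 + 1) (by positivity) ?_
  intro x hx
  have : x ∉ O := by
    intro hxO
    have := hC ⟨x, subset_closure hxO, rfl⟩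
    have h2 := le_max_left C 0
    simp only at this
    linarith
  simp [h, this]

theorem gsc_icc_ico {a b c d : ℝ} (h1 : c ≤ a) (h2 : b < d) : Set.Icc a b ⊆ Set.Ico c d :=
  fun _ hx => ⟨h1.trans hx.1, hx.2.trans_lt h2⟩

open Set Filter Topology in
/-- A continuous curve which is locally injective and locally equal to a short arc. -/
def GscLoc (γ : ℝ → ℝ × ℝ) : Prop :=
  Continuous γ ∧ ∀ t₀, (∃ ε > 0, InjOn γ (Icc (t₀ - ε) (t₀ + ε))) ∧
    ∀ ε > 0, ∃ M ∈ 𝓝 (γ t₀), ∀ u, γ u ∈ M → ∃ v ∈ Ioo (t₀ - ε) (t₀ + ε), γ v = γ u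

open Set Filter Topology in
theorem gscLoc_neg {γ : ℝ → ℝ × ℝ} (h : GscLoc γ) : GscLoc (fun t => γ (-t)) := by
  obtain ⟨hc, h⟩ := h
  refine ⟨by fun_prop, fun t₀ => ⟨?_, ?_⟩⟩
  · obtain ⟨ε, h0, hi⟩ := (h (-t₀)).1
    refine ⟨ε, h0, fun x hx y hy hxy => ?_⟩
    have := hi ⟨by linarith [hx.2], by linarith [hx.1]⟩ ⟨by linarith [hy.2], by linarith [hy.1]⟩ hxy
    linarith
  · intro ε h0
    obtain ⟨M, hM, h1⟩ := (h (-t₀)).2 ε h0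
    refine ⟨M, hM, fun u hu => ?_⟩
    obtain ⟨v, hv, hvu⟩ := h1 (-u) hu
    exact ⟨-v, ⟨by linarith [hv.2], by linarith [hv.1]⟩, by simpa using hvu⟩

open Set Filter Topology in
theorem gsc_right (γ : ℝ → ℝ × ℝ) (hγ : GscLoc γ) (B E : Set (ℝ × ℝ))
    (hE : IsOpen E) (hBE : Disjoint B E) (hγB : ∀ t, γ t ∉ B) (hγE : ∀ t, γ t ∉ E) (t₀ : ℝ)
    (hp : γ t₀ ∈ frontier B) (hpE : γ t₀ ∈ closure E) (N : Set (ℝ × ℝ)) (hN : N ∈ 𝓝 (γ t₀))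
    (hNB : ∀ x ∈ frontier B, x ∈ N → x ∈ range γ) :
    ∃ η > 0, ∀ t ∈ Ioo t₀ (t₀ + η), γ t ∈ frontier B := by
  obtain ⟨hc, hloc⟩ := hγ
  obtain ⟨⟨ε, hε, hinj⟩, hM⟩ := hloc t₀
  obtain ⟨M, hM, hMγ⟩ := hM ε hε
  obtain ⟨r, hr, hrMN⟩ := Metric.mem_nhds_iff.1 (inter_mem hM hN)
  obtain ⟨r', hr', hrr⟩ : ∃ r', 0 < r' ∧ r' < r := ⟨r / 2, by linarith, by linarith⟩
  have hcb : Metric.closedBall (γ t₀) r' ⊆ M ∩ N := (Metric.closedBall_subset_ball hrr).trans hrMN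
  obtain ⟨η₀, hη₀, hball⟩ := Metric.mem_nhds_iff.1
    (hc.continuousAt.preimage_mem_nhds (Metric.ball_mem_nhds (γ t₀) hr'))
  obtain ⟨η, hη, hηε, hηη⟩ : ∃ η, 0 < η ∧ η < ε ∧ η < η₀ :=
    ⟨min ε η₀ / 2, by positivity, by linarith [min_le_left ε η₀, lt_min hε hη₀],
      by linarith [min_le_right ε η₀, lt_min hε hη₀]⟩
  refine ⟨η, hη, fun t₁ ht₁ => ?_⟩
  by_contra hnot
  have hopen : {t | γ t ∉ frontier B} ∈ 𝓝 t₁ :=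
    (isClosed_frontier.isOpen_compl.preimage hc).mem_nhds hnot
  obtain ⟨δ, hδ, hδs⟩ := Metric.mem_nhds_iff.1 (inter_mem hopen (Iio_mem_nhds (ht₁.2)))
  obtain ⟨t₂, h12, h2δ⟩ : ∃ t₂, t₁ < t₂ ∧ t₂ < t₁ + δ := ⟨t₁ + δ / 2, by linarith, by linarith⟩
  have hgap : ∀ t ∈ Icc t₁ t₂, γ t ∉ frontier B ∧ t < t₀ + η := by
    intro t ht
    have : t ∈ Metric.ball t₁ δ := by
      rw [Metric.mem_ball, Real.dist_eq, abs_lt]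
      exact ⟨by linarith [ht.1], by linarith [ht.2]⟩
    exact hδs this
  have ht2 : t₂ < t₀ + η := (hgap t₂ ⟨h12.le, le_rfl⟩).2
  obtain ⟨ht₁a, ht₁b⟩ := ht₁
  set s := t₀ - η with hs
  let Y : Set (ℝ × ℝ) := (Metric.ball (γ t₀) r')ᶜ ∪ γ '' (Icc (t₀ - ε) s ∪ Icc t₂ (t₀ + ε))
  have hYc : IsClosed Y := Metric.isOpen_ball.isClosed_compl.union
    ((isCompact_Icc.union isCompact_Icc).image hc).isClosed
  have hin : ∀ u ∈ Icc s t₁, γ u ∈ Metric.ball (γ t₀) r' := by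
    intro u hu
    apply hball
    rw [Metric.mem_ball, Real.dist_eq, abs_lt]
    exact ⟨by linarith [hu.1], by linarith [hu.2]⟩
  have hXY : ∀ u ∈ Icc s t₁, γ u ∈ Y → u = s := by
    rintro u hu (h | ⟨v, hv, hvu⟩)
    · exact absurd (hin u hu) h
    · have hu' : u ∈ Icc (t₀ - ε) (t₀ + ε) := ⟨by linarith [hu.1], by linarith [hu.2]⟩
      rcases hv with hv | hv
      · have := hinj ⟨hv.1, by linarith [hv.2]⟩ hu' hvu
        subst this
        exact le_antisymm hv.2 hu.1
      · have := hinj ⟨by linarith [hv.1], hv.2⟩ hu' hvu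
        subst this
        linarith [hv.1, hu.2]
  have hpY : γ t₀ ∉ Y := by
    intro h
    have := hXY t₀ ⟨by linarith, by linarith⟩ h
    linarith
  obtain ⟨d, hd, hdY⟩ := Metric.mem_nhds_iff.1 (hYc.isOpen_compl.mem_nhds hpY)
  obtain ⟨a, haV, haB⟩ := mem_closure_iff_nhds.1 (frontier_subset_closure hp) _
    (Metric.ball_mem_nhds _ hd)
  obtain ⟨b, hbV, hbE⟩ := mem_closure_iff_nhds.1 hpE _ (Metric.ball_mem_nhds _ hd)
  refine gsc_sep γ hc s t₁ (by linarith) (hinj.mono ?_) Y hYc hXY a b ?_ ?_ ?_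
    (B ∩ Metric.ball (γ t₀) r')
    (Metric.isBounded_ball.subset inter_subset_right) ?_ ⟨haB, ?_⟩ ?_
  · exact Icc_subset_Icc (by linarith) (by linarith)
  · intro x hx
    exact hdY ((convex_ball (γ t₀) d).segment_subset haV hbV hx)
  · rintro ⟨u, -, rfl⟩
    exact hγB u haB
  · rintro ⟨u, -, rfl⟩
    exact hγE u hbE
  · intro x hx
    by_cases hxb : x ∈ Metric.ball (γ t₀) r'
    swap
    · exact Or.inr (Or.inl hxb)
    have hxB : x ∈ frontier B := by
      rcases frontier_inter_subset _ _ hx with h | h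
      · exact h.1
      · rw [Metric.isOpen_ball.frontier_eq] at h
        exact absurd hxb h.2.2
    have hxMN := hcb (Metric.ball_subset_closedBall hxb)
    obtain ⟨u, rfl⟩ := hNB x hxB hxMN.2
    obtain ⟨v, hv, hvu⟩ := hMγ u hxMN.1
    rw [← hvu] at hxB ⊢
    rcases le_or_gt v s with h | h
    · exact Or.inr (Or.inr ⟨v, Or.inl ⟨hv.1.le, h⟩, rfl⟩)
    rcases le_or_gt v t₁ with h' | h'
    · exact Or.inl ⟨v, ⟨h.le, h'⟩, rfl⟩
    rcases le_or_gt t₂ v with h'' | h''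
    · exact Or.inr (Or.inr ⟨v, Or.inr ⟨h'', hv.2.le⟩, rfl⟩)
    · exact absurd hxB (hgap v ⟨h'.le, h''.le⟩).1
  · by_contra h
    exact hdY haV (Or.inl h)
  · intro h
    exact (hBE.closure_left hE).le_bot ⟨closure_mono inter_subset_left h, hbE⟩

open Set Filter Topology in
/-- The boundary of `B` contains the whole curve as soon as it meets it. -/
theorem gsc_range (γ : ℝ → ℝ × ℝ) (hγ : GscLoc γ) (B E : Set (ℝ × ℝ))
    (hE : IsOpen E) (hBE : Disjoint B E) (hγB : ∀ t, γ t ∉ B) (hγE : ∀ t, γ t ∉ E)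
    (hpE : ∀ t, γ t ∈ closure E)
    (hN : ∀ t, ∃ N ∈ 𝓝 (γ t), ∀ x ∈ frontier B, x ∈ N → x ∈ range γ) (t₀ : ℝ)
    (hp : γ t₀ ∈ frontier B) : range γ ⊆ frontier B := by
  have hcl : IsClopen {t | γ t ∈ frontier B} := by
    refine ⟨isClosed_frontier.preimage hγ.1, isOpen_iff_mem_nhds.2 fun t ht => ?_⟩
    obtain ⟨N, hN1, hN2⟩ := hN t
    obtain ⟨η, hη, h1⟩ := gsc_right γ hγ B E hE hBE hγB hγE t ht (hpE t) N hN1 hN2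
    obtain ⟨η', hη', h2⟩ := gsc_right (fun t => γ (-t)) (gscLoc_neg hγ) B E hE hBE
      (fun t => hγB _) (fun t => hγE _) (-t) (by simpa using ht) (by simpa using hpE t) N
      (by simpa using hN1) (fun x hx hx' => by
        obtain ⟨u, hu⟩ := hN2 x hx hx'
        exact ⟨-u, by simpa using hu⟩)
    refine mem_of_superset (Ioo_mem_nhds (a := t - η') (b := t + η) (by linarith) (by linarith)) ?_
    intro u hu
    rcases lt_trichotomy u t with h | h | h
    · have := h2 (-u) ⟨by linarith, by linarith [hu.1]⟩
      simpa using this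
    · rw [h]; exact ht
    · exact h1 u ⟨h, hu.2⟩
  have huniv := hcl.eq_univ ⟨t₀, hp⟩
  rintro _ ⟨t, rfl⟩
  have : t ∈ {t | γ t ∈ frontier B} := by rw [huniv]; trivial
  exact this

open Set Filter Topology in
theorem gscLoc_path (γ : ℝ → ℝ × ℝ) (hc : Continuous γ) (hi : Function.Injective γ)
    (hp : ∀ K : Set (ℝ × ℝ), IsCompact K → IsCompact (γ ⁻¹' K)) : GscLoc γ := by
  refine ⟨hc, fun t₀ => ⟨⟨1, one_pos, hi.injOn⟩, fun ε hε => ?_⟩⟩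
  have hpm : IsProperMap γ := isProperMap_iff_isCompact_preimage.2 ⟨hc, fun K hK => hp K hK⟩
  refine ⟨(γ '' (Ioo (t₀ - ε) (t₀ + ε))ᶜ)ᶜ,
    (hpm.isClosedMap _ isOpen_Ioo.isClosed_compl).isOpen_compl.mem_nhds ?_, ?_⟩
  · rintro ⟨u, hu, h⟩
    rw [hi h] at hu
    exact hu ⟨by linarith, by linarith⟩
  · intro u hu
    refine ⟨u, ?_, rfl⟩
    by_contra h
    exact hu ⟨u, h, rfl⟩

open Set Filter Topology in
theorem gscLoc_loop (γ : ℝ → ℝ × ℝ) (hc : Continuous γ) (T : ℝ) (hT : 0 < T)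
    (hp : Function.Periodic γ T) (hi : InjOn γ (Ico 0 T)) : GscLoc γ := by
  have hinj : ∀ a, InjOn γ (Ico a (a + T)) := by
    intro a x hx y hy hxy
    have hx' := sub_toIcoDiv_zsmul_mem_Ico hT 0 x
    have hy' := sub_toIcoDiv_zsmul_mem_Ico hT 0 y
    rw [zero_add] at hx' hy'
    have := hi hx' hy' (by rw [hp.sub_zsmul_eq, hp.sub_zsmul_eq, hxy])
    simp only [zsmul_eq_mul] at this
    set m := toIcoDiv hT 0 x
    set n := toIcoDiv hT 0 y
    have h1 : x - y = ((m - n : ℤ) : ℝ) * T := by push_cast; linarith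
    have h2 : |x - y| < T := by
      rw [abs_lt]; exact ⟨by linarith [hx.1, hy.2], by linarith [hx.2, hy.1]⟩
    rw [h1, abs_mul, abs_of_pos hT] at h2
    have h3 : |((m - n : ℤ) : ℝ)| < 1 := by
      by_contra h
      push Not at h
      nlinarith
    have h4 : (m - n : ℤ) = 0 := by
      rw [← Int.abs_lt_one_iff]
      exact_mod_cast h3
    rw [h4] at h1
    simp at h1
    linarith
  refine ⟨hc, fun t₀ => ⟨⟨T / 4, by positivity, (hinj (t₀ - T / 2)).mono
    (gsc_icc_ico (by linarith) (by linarith))⟩, fun ε hε => ?_⟩⟩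
  set a := t₀ - T / 2 with ha
  have hK : IsCompact (Icc a (a + T) \ Ioo (t₀ - ε) (t₀ + ε)) := isCompact_Icc.diff isOpen_Ioo
  refine ⟨(γ '' (Icc a (a + T) \ Ioo (t₀ - ε) (t₀ + ε)))ᶜ,
    (hK.image hc).isClosed.isOpen_compl.mem_nhds ?_, ?_⟩
  · rintro ⟨u, ⟨hu, hu'⟩, h⟩
    have ht : t₀ ∈ Ico a (a + T) := ⟨by linarith, by linarith⟩
    rcases hu.2.lt_or_eq with h1 | h1
    · have := hinj a ⟨hu.1, h1⟩ ht h
      rw [this] at hu'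
      exact hu' ⟨by linarith, by linarith⟩
    · rw [h1, hp a] at h
      have := hinj a ⟨le_rfl, by linarith⟩ ht h
      linarith
  · intro u hu
    obtain ⟨v, hv, hvu⟩ := hp.exists_mem_Ico hT u a
    refine ⟨v, ?_, hvu.symm⟩
    by_contra h
    exact hu ⟨v, ⟨⟨hv.1, hv.2.le⟩, h⟩, hvu.symm⟩

open Set Filter Topology in
/-- Near a smooth point, the complement of the curve is covered by two connected sets. -/
theorem gsc_smooth (γ : ℝ → ℝ × ℝ) (hγ : GscLoc γ) (t₀ : ℝ) (v : ℝ × ℝ)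
    (hd : HasStrictDerivAt γ v t₀) (hv : v ≠ 0) (W : Set (ℝ × ℝ)) (hW : W ∈ 𝓝 (γ t₀)) :
    ∃ N ∈ 𝓝 (γ t₀), N ⊆ W ∧ ∃ C₁ C₂, IsPreconnected C₁ ∧ IsPreconnected C₂ ∧
      N \ range γ = C₁ ∪ C₂ := by
  let n : ℝ × ℝ := (-v.2, v.1)
  let F : ℝ × ℝ → ℝ × ℝ := fun q => γ q.1 + q.2 • n
  have hFc : Continuous F := by have := hγ.1; fun_prop
  let F' : ℝ × ℝ →L[ℝ] ℝ × ℝ := (ContinuousLinearMap.fst ℝ ℝ ℝ).smulRight v +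
    (ContinuousLinearMap.snd ℝ ℝ ℝ).smulRight n
  have hF0 : F (t₀, 0) = γ t₀ := by simp [F]
  have hstrict : HasStrictFDerivAt F F' (t₀, 0) := by
    have h1 : HasStrictFDerivAt (fun q : ℝ × ℝ => γ q.1)
        ((ContinuousLinearMap.fst ℝ ℝ ℝ).smulRight v) (t₀, 0) := by
      have := (hd.hasStrictFDerivAt).comp (t₀, (0 : ℝ)) (f := Prod.fst)
        (hasStrictFDerivAt_fst (𝕜 := ℝ) (E := ℝ) (F := ℝ))
      refine this.congr_fderiv ?_
      ext <;> simp
    have h2 : HasStrictFDerivAt (fun q : ℝ × ℝ => q.2 • n)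
        ((ContinuousLinearMap.snd ℝ ℝ ℝ).smulRight n) (t₀, 0) :=
      ((ContinuousLinearMap.snd ℝ ℝ ℝ).smulRight n).hasStrictFDerivAt
    exact h1.add h2
  have hpos : 0 < v.1 ^ 2 + v.2 ^ 2 := by
    by_contra h
    apply hv
    have h1 : v.1 = 0 := by nlinarith [sq_nonneg v.1, sq_nonneg v.2]
    have h2 : v.2 = 0 := by nlinarith [sq_nonneg v.1, sq_nonneg v.2]
    exact Prod.ext h1 h2
  have hinj : Function.Injective (F' : ℝ × ℝ →ₗ[ℝ] ℝ × ℝ) := by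
    rw [← LinearMap.ker_eq_bot, LinearMap.ker_eq_bot']
    rintro ⟨x, y⟩ h
    have h1 := congrArg Prod.fst h
    have h2 := congrArg Prod.snd h
    simp [F', n] at h1 h2
    have hx : x * (v.1 ^ 2 + v.2 ^ 2) = 0 := by linear_combination v.1 * h1 + v.2 * h2
    have hy : y * (v.1 ^ 2 + v.2 ^ 2) = 0 := by linear_combination v.1 * h2 - v.2 * h1
    have hx' := (mul_eq_zero.1 hx).resolve_right hpos.ne'
    have hy' := (mul_eq_zero.1 hy).resolve_right hpos.ne'
    simp [hx', hy']
  let e : (ℝ × ℝ) ≃L[ℝ] ℝ × ℝ :=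
    (LinearEquiv.ofInjectiveEndo (F' : ℝ × ℝ →ₗ[ℝ] ℝ × ℝ) hinj).toContinuousLinearEquiv
  have he : (e : ℝ × ℝ →L[ℝ] ℝ × ℝ) = F' := by
    ext <;> simp [e]
  have hse : HasStrictFDerivAt F (e : ℝ × ℝ →L[ℝ] ℝ × ℝ) (t₀, 0) := he ▸ hstrict
  have hmap := hse.map_nhds_eq_of_equiv
  let P := hse.toOpenPartialHomeomorph F
  have hPinj : InjOn F P.source := by
    have := P.injOn
    exact this
  have hPs : P.source ∈ 𝓝 (t₀, (0 : ℝ)) := P.open_source.mem_nhds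
    (hse.mem_toOpenPartialHomeomorph_source)
  obtain ⟨δ₀, hδ₀, hδP⟩ := Metric.mem_nhds_iff.1 hPs
  obtain ⟨M, hM, hMγ⟩ := (hγ.2 t₀).2 δ₀ hδ₀
  have hpre : F ⁻¹' (M ∩ W) ∈ 𝓝 (t₀, (0 : ℝ)) :=
    hFc.continuousAt.preimage_mem_nhds (by rw [hF0]; exact inter_mem hM hW)
  obtain ⟨δ, hδ, hδs⟩ := Metric.mem_nhds_iff.1 (inter_mem hpre hPs)
  set Q := Metric.ball (t₀, (0 : ℝ)) δ with hQ
  have hQc : Convex ℝ Q := convex_ball _ _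
  refine ⟨F '' Q, ?_, ?_, F '' (Q ∩ {q | 0 < q.2}), F '' (Q ∩ {q | q.2 < 0}), ?_, ?_, ?_⟩
  · rw [← hF0, ← hmap]
    exact image_mem_map (Metric.ball_mem_nhds _ hδ)
  · rintro _ ⟨q, hq, rfl⟩
    exact (hδs hq).1.2
  · refine IsPreconnected.image ?_ _ hFc.continuousOn
    exact (hQc.inter (convex_halfSpace_gt (ContinuousLinearMap.snd ℝ ℝ ℝ).isLinear 0)).isPreconnected
  · refine IsPreconnected.image ?_ _ hFc.continuousOn
    exact (hQc.inter (convex_halfSpace_lt (ContinuousLinearMap.snd ℝ ℝ ℝ).isLinear 0)).isPreconnected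
  · have key : ∀ q ∈ Q, F q ∈ range γ ↔ q.2 = 0 := by
      intro q hq
      constructor
      · rintro ⟨u, hu⟩
        obtain ⟨w, hw, hwu⟩ := hMγ u (by rw [hu]; exact (hδs hq).1.1)
        have h1 : F (w, 0) = F q := by
          rw [← hu, ← hwu]; simp [F]
        have h2 : (w, (0 : ℝ)) ∈ P.source := by
          apply hδP
          rw [Metric.mem_ball, Prod.dist_eq, dist_self]
          refine max_lt ?_ hδ₀
          rw [Real.dist_eq, abs_lt]
          exact ⟨by linarith [hw.1], by linarith [hw.2]⟩
        have := hPinj h2 (hδs hq).2 h1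
        rw [← this]
      · intro h
        exact ⟨q.1, by simp [F, h]⟩
    ext x
    constructor
    · rintro ⟨⟨q, hq, rfl⟩, hx⟩
      rw [key q hq] at hx
      rcases lt_or_gt_of_ne hx with h | h
      · exact Or.inr ⟨q, ⟨hq, h⟩, rfl⟩
      · exact Or.inl ⟨q, ⟨hq, h⟩, rfl⟩
    · rintro (⟨q, ⟨hq, h⟩, rfl⟩ | ⟨q, ⟨hq, h⟩, rfl⟩)
      · exact ⟨⟨q, hq, rfl⟩, fun hx => (ne_of_gt h) ((key q hq).1 hx)⟩
      · exact ⟨⟨q, hq, rfl⟩, fun hx => (ne_of_lt h) ((key q hq).1 hx)⟩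

open Set Filter Topology in
theorem gsc_smooth_point (γ : ℝ → R2)
    (smooth : ∃ S : Set ℝ, IsClosed S ∧ DiscreteTopology ↥S ∧ ContDiffOn ℝ (⊤ : ℕ∞) γ Sᶜ)
    (deriv_right : ∀ t : ℝ, ∃ v : R2, HasDerivWithinAt γ v (Set.Ici t) t ∧ eunorm v = 1) :
    ∃ t v, HasStrictDerivAt γ v t ∧ v ≠ 0 := by
  obtain ⟨S, hS, hd, hc⟩ := smooth
  have hne : ∃ t, t ∉ S := by
    by_contra h
    push Not at h
    have hu : S = univ := eq_univ_of_forall h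
    subst hu
    have : DiscreteTopology ℝ := (Homeomorph.Set.univ ℝ).symm.isEmbedding.discreteTopology
    have h1 : IsOpen ({0} : Set ℝ) := isOpen_discrete _
    exact not_isOpen_singleton (0 : ℝ) h1
  obtain ⟨t, ht⟩ := hne
  have h1 : ContDiffAt ℝ (⊤ : ℕ∞) γ t := hc.contDiffAt (hS.isOpen_compl.mem_nhds ht)
  have h2 : HasStrictDerivAt γ (deriv γ t) t := h1.hasStrictDerivAt (by simp)
  obtain ⟨v, hv, hv1⟩ := deriv_right t
  have h3 : deriv γ t = v :=
    (uniqueDiffWithinAt_Ici t).eq_deriv _ h2.hasDerivAt.hasDerivWithinAt hv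
  refine ⟨t, v, h3 ▸ h2, ?_⟩
  rintro rfl
  simp [eunorm] at hv1

open Set Filter Topology in
theorem gsc_curve (γ : ℝ → R2) (h : IsSimplePath γ ∨ IsSimpleLoop γ) :
    GscLoc γ ∧ ∃ t v, HasStrictDerivAt γ v t ∧ v ≠ 0 := by
  rcases h with h | h
  · exact ⟨gscLoc_path γ h.continuous h.injective h.proper, gsc_smooth_point γ h.smooth h.deriv_right⟩
  · obtain ⟨T, hT, hp, hi⟩ := h.periodic
    exact ⟨gscLoc_loop γ h.continuous T hT hp hi, gsc_smooth_point γ h.smooth h.deriv_right⟩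

theorem gsc_comp_subset {S C : Set R2} (hC : C ∈ components S) : C ⊆ S := by
  obtain ⟨x, -, rfl⟩ := hC
  exact connectedComponentIn_subset S x

theorem gsc_comp_eq {S C : Set R2} (hC : C ∈ components S) {y : R2} (hy : y ∈ C) :
    C = connectedComponentIn S y := by
  obtain ⟨x, -, rfl⟩ := hC
  exact connectedComponentIn_eq hy

theorem gsc_comp_open {A B : Set R2} (hA : IsOpen A) (hB : B ∈ components A) : IsOpen B := by
  obtain ⟨x, -, rfl⟩ := hB
  exact hA.connectedComponentIn

theorem gsc_comp_frontier {A B : Set R2} (hA : IsOpen A) (hB : B ∈ components A) :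
    frontier B ⊆ frontier A := by
  intro p hp
  have hBo := gsc_comp_open hA hB
  rw [hBo.frontier_eq] at hp
  rw [hA.frontier_eq]
  refine ⟨closure_mono (gsc_comp_subset hB) hp.1, fun hpA => hp.2 ?_⟩
  obtain ⟨y, hy, hyB⟩ := mem_closure_iff_nhds.1 hp.1 _
    (hA.connectedComponentIn.mem_nhds (mem_connectedComponentIn hpA))
  rw [gsc_comp_eq hB hyB, ← connectedComponentIn_eq hy]
  exact mem_connectedComponentIn hpA

open Set Filter Topology in
theorem gsc_isolated {A : Set R2} (hA : IsGoodSet A) {Γ : Set R2}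
    (hΓ : Γ ∈ components (frontier A)) {x : R2} (hx : x ∈ Γ) :
    ∃ N ∈ 𝓝 x, ∀ y ∈ frontier A, y ∈ N → y ∈ Γ := by
  obtain ⟨-, -, -, ⟨ρ, hρ, hsep⟩, -⟩ := hA
  have hcont : Continuous (fun y => eudist x y) := by
    unfold eudist eunorm
    fun_prop
  have h0 : eudist x x < ρ := by simpa [eudist, eunorm] using hρ
  refine ⟨{y | eudist x y < ρ}, (isOpen_lt hcont continuous_const).mem_nhds h0, fun y hy hyN => ?_⟩
  have hyN' : eudist x y < ρ := hyN
  by_contra hne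
  have h1 : connectedComponentIn (frontier A) y ∈ components (frontier A) := ⟨y, hy, rfl⟩
  have hym := mem_connectedComponentIn hy
  have := hsep Γ hΓ _ h1 (fun h => hne (h ▸ hym)) x hx y hym
  linarith

open Set Filter Topology in
theorem gsc_curve_subset {A : Set R2} (hA : IsGoodSet A) {B Γ : Set R2} (hB : B ∈ components A)
    (hΓ : Γ ∈ components (frontier A)) {x : R2} (hx : x ∈ Γ) (hxB : x ∈ frontier B) :
    Γ ⊆ frontier B := by
  have hA' := hA
  obtain ⟨hAo, hfr, hcomp, -, -⟩ := hA'
  obtain ⟨γ, hγ, rfl⟩ := hcomp Γ hΓ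
  obtain ⟨t₀, rfl⟩ := hx
  have hfA : ∀ t, γ t ∈ frontier A := fun t => gsc_comp_subset hΓ ⟨t, rfl⟩
  refine gsc_range γ (gsc_curve γ hγ).1 B (interior Aᶜ) isOpen_interior ?_ ?_ ?_ ?_ ?_ t₀ hxB
  · rw [Set.disjoint_left]
    intro y hy hy'
    exact interior_subset hy' (gsc_comp_subset hB hy)
  · intro t ht
    have := hfA t
    rw [hAo.frontier_eq] at this
    exact this.2 (gsc_comp_subset hB ht)
  · intro t ht
    have := hfA t
    rw [← hfr, isOpen_interior.frontier_eq] at this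
    exact this.2 ht
  · intro t
    have := hfA t
    rw [← hfr] at this
    exact frontier_subset_closure this
  · intro t
    obtain ⟨N, hN, h⟩ := gsc_isolated hA hΓ ⟨t, rfl⟩
    exact ⟨N, hN, fun x hx hxN => h x (gsc_comp_frontier hAo hB hx) hxN⟩

open Set Filter Topology in
/-- Near some point of each boundary curve, `A` coincides with a connected set. -/
theorem gsc_local {A : Set R2} (hA : IsGoodSet A) {Γ : Set R2}
    (hΓ : Γ ∈ components (frontier A)) :
    ∃ p ∈ Γ, ∃ N ∈ 𝓝 p, IsPreconnected (A ∩ N) := by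
  have hA' := hA
  obtain ⟨hAo, hfr, hcomp, -, -⟩ := hA'
  obtain ⟨γ, hγ, rfl⟩ := hcomp Γ hΓ
  obtain ⟨hloc, t, v, hd, hv⟩ := gsc_curve γ hγ
  have hpA : γ t ∈ frontier A := gsc_comp_subset hΓ ⟨t, rfl⟩
  obtain ⟨W, hW, hWA⟩ := gsc_isolated hA hΓ ⟨t, rfl⟩
  obtain ⟨N, hN, hNW, C₁, C₂, hC₁, hC₂, hNC⟩ := gsc_smooth γ hloc t v hd hv W hW
  refine ⟨γ t, ⟨t, rfl⟩, N, hN, ?_⟩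
  have hgf : ∀ s, γ s ∈ frontier A := fun s => gsc_comp_subset hΓ ⟨s, rfl⟩
  have hAE : ∀ y ∈ A, y ∉ interior Aᶜ := fun y hy h => interior_subset h hy
  have hAf : ∀ y ∈ A, y ∉ range γ := by
    rintro y hy ⟨s, rfl⟩
    have := hgf s
    rw [hAo.frontier_eq] at this
    exact this.2 hy
  have hEf : ∀ y ∈ interior Aᶜ, y ∉ range γ := by
    rintro y hy ⟨s, rfl⟩
    have := hgf s
    rw [← hfr, isOpen_interior.frontier_eq] at this
    exact this.2 hy
  have hcov : ∀ y ∈ N \ range γ, y ∈ A ∪ interior Aᶜ := by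
    intro y hy
    by_contra h
    rw [mem_union, not_or] at h
    apply hy.2
    apply hWA y _ (hNW hy.1)
    rw [hAo.frontier_eq]
    refine ⟨?_, h.1⟩
    have := h.2
    rw [interior_compl] at this
    simpa using this
  have hdich : ∀ C, IsPreconnected C → C ⊆ N \ range γ → C ⊆ A ∨ C ⊆ interior Aᶜ := by
    intro C hC hCN
    apply hC.subset_or_subset hAo isOpen_interior
    · rw [Set.disjoint_left]; exact hAE
    · exact fun y hy => hcov y (hCN hy)
  obtain ⟨b, hbN, hbE⟩ := mem_closure_iff_nhds.1
    (frontier_subset_closure (show γ t ∈ frontier (interior Aᶜ) by rw [hfr]; exact hpA)) N hN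
  have hb : b ∈ C₁ ∪ C₂ := hNC ▸ ⟨hbN, hEf b hbE⟩
  have hs1 : C₁ ⊆ N \ range γ := hNC ▸ subset_union_left
  have hs2 : C₂ ⊆ N \ range γ := hNC ▸ subset_union_right
  have hAN : A ∩ N = A ∩ (C₁ ∪ C₂) := by
    rw [← hNC]
    ext y
    constructor
    · exact fun h => ⟨h.1, h.2, hAf y h.1⟩
    · exact fun h => ⟨h.1, h.2.1⟩
  have fin : ∀ C D, IsPreconnected C → IsPreconnected D → C ⊆ N \ range γ → D ⊆ N \ range γ →
      b ∈ C → IsPreconnected (A ∩ (C ∪ D)) := by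
    intro C D hC hD hCN hDN hbC
    have hCE : C ⊆ interior Aᶜ := (hdich C hC hCN).resolve_left (fun h => hAE b (h hbC) hbE)
    have e1 : A ∩ (C ∪ D) = A ∩ D := by
      ext y
      constructor
      · rintro ⟨h1, h2 | h2⟩
        · exact absurd (hCE h2) (hAE y h1)
        · exact ⟨h1, h2⟩
      · exact fun h => ⟨h.1, Or.inr h.2⟩
    rw [e1]
    rcases hdich D hD hDN with h | h
    · rwa [inter_eq_self_of_subset_right h]
    · have : A ∩ D = ∅ := by
        ext y
        simp only [mem_inter_iff, mem_empty_iff_false, iff_false, not_and]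
        exact fun h1 h2 => hAE y h1 (h h2)
      rw [this]
      exact isPreconnected_empty
  rw [hAN]
  rcases hb with hb | hb
  · exact fin C₁ C₂ hC₁ hC₂ hs1 hs2 hb
  · rw [union_comm]
    exact fin C₂ C₁ hC₂ hC₁ hs2 hs1 hb

/-- The components of the boundary of a component of a good set are components of the boundary
of the set. -/
theorem gsc_comp_of_frontier {A : Set R2} (hA : IsGoodSet A) {B Γ : Set R2}
    (hB : B ∈ components A) (hΓ : Γ ∈ components (frontier B)) : Γ ∈ components (frontier A) := by
  obtain ⟨x, hx, rfl⟩ := hΓ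
  have hsub := gsc_comp_frontier hA.1 hB
  refine ⟨x, hsub hx, ?_⟩
  apply Set.Subset.antisymm (connectedComponentIn_mono x hsub)
  exact isPreconnected_connectedComponentIn.subset_connectedComponentIn
    (mem_connectedComponentIn (hsub hx))
    (gsc_curve_subset hA hB ⟨x, hsub hx, rfl⟩ (mem_connectedComponentIn (hsub hx)) hx)

/-- Lemma 7.6: the boundary of each connected component of a good
set is a union of connected components of the boundary; each component of the boundary
belongs to exactly one of them; connected components of good sets are good. -/
theorem good_set_components
    (A : Set R2) (hA : IsGoodSet A) :
    (∀ B ∈ components A, ∃ 𝒦 ⊆ components (frontier A), frontier B = ⋃₀ 𝒦) ∧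
    (∀ Γ ∈ components (frontier A),
      ∃! B : Set R2, B ∈ components A ∧ Γ ⊆ frontier B) ∧
    (∀ B ∈ components A, IsGoodSet B) := by
  have hAo := hA.1
  refine ⟨?_, ?_, ?_⟩
  · intro B hB
    refine ⟨{Γ | Γ ∈ components (frontier A) ∧ Γ ⊆ frontier B}, fun Γ h => h.1, ?_⟩
    apply Set.Subset.antisymm
    · intro x hx
      have hxA := gsc_comp_frontier hAo hB hx
      have hm := mem_connectedComponentIn hxA
      exact ⟨connectedComponentIn (frontier A) x,
        ⟨⟨x, hxA, rfl⟩, gsc_curve_subset hA hB ⟨x, hxA, rfl⟩ hm hx⟩, hm⟩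
    · rintro x ⟨Γ, hΓ, hx⟩
      exact hΓ.2 hx
  · intro Γ hΓ
    obtain ⟨p, hp, N, hN, hconn⟩ := gsc_local hA hΓ
    have hpA : p ∈ frontier A := gsc_comp_subset hΓ hp
    have hmeet : ∀ M ∈ nhds p, (M ∩ A).Nonempty :=
      fun M hM => mem_closure_iff_nhds.1 (frontier_subset_closure hpA) M hM
    obtain ⟨a, haN, haA⟩ := hmeet N hN
    have hANB : A ∩ N ⊆ connectedComponentIn A a :=
      hconn.subset_connectedComponentIn ⟨haA, haN⟩ Set.inter_subset_left
    have hBc : connectedComponentIn A a ∈ components A := ⟨a, haA, rfl⟩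
    refine ⟨connectedComponentIn A a, ⟨hBc, ?_⟩, ?_⟩
    · refine gsc_curve_subset hA hBc hΓ hp ?_
      rw [(gsc_comp_open hAo hBc).frontier_eq]
      rw [hAo.frontier_eq] at hpA
      refine ⟨mem_closure_iff_nhds.2 fun M hM => ?_, fun h => hpA.2 (gsc_comp_subset hBc h)⟩
      obtain ⟨y, hy, hyA⟩ := hmeet (M ∩ N) (Filter.inter_mem hM hN)
      exact ⟨y, hy.1, hANB ⟨hyA, hy.2⟩⟩
    · rintro B' ⟨hB', hΓB'⟩
      obtain ⟨y, hyN, hyB⟩ := mem_closure_iff_nhds.1 (frontier_subset_closure (hΓB' hp)) N hN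
      have h1 := hANB ⟨gsc_comp_subset hB' hyB, hyN⟩
      rw [gsc_comp_eq hB' hyB, ← connectedComponentIn_eq h1]
  · intro B hB
    have hBo := gsc_comp_open hAo hB
    have hsub := gsc_comp_frontier hAo hB
    have hBA := gsc_comp_subset hB
    obtain ⟨-, hfr, hcomp, ⟨ρ, hρ, hsep⟩, hZ⟩ := id hA
    refine ⟨hBo, ?_, ?_, ⟨ρ, hρ, ?_⟩, fun x hx => hZ x (hsub hx)⟩
    · apply Set.Subset.antisymm
      · rw [← frontier_compl B]
        exact frontier_interior_subset
      · intro p hp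
        have hpA := hsub hp
        rw [← hfr] at hpA
        rw [isOpen_interior.frontier_eq]
        refine ⟨closure_mono (interior_mono (Set.compl_subset_compl.2 hBA))
          (frontier_subset_closure hpA), fun h => ?_⟩
        rw [interior_compl] at h
        exact h (frontier_subset_closure hp)
    · exact fun Γ hΓ => hcomp Γ (gsc_comp_of_frontier hA hB hΓ)
    · exact fun Γ hΓ Γ' hΓ' => hsep Γ (gsc_comp_of_frontier hA hB hΓ) Γ'
        (gsc_comp_of_frontier hA hB hΓ')

end
end

section
/- Let A ⊆ ℝ² be a connected good set and let 𝒜 = int(A^c). Then there exists a bijection Φ from the set of connected components of 𝒜 onto the set of connected components of ∂A such that ∂C = Φ(C) for every connected component C of 𝒜. In particular, every connected component of 𝒜 has connected boundary equal to the range of a simple path or of a simple loop, i.e., is a simple set. -/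
noncomputable section

theorem cc_exists_log {X : Type} [TopologicalSpace X] [SimplyConnectedSpace X]
    [LocallyPathConnectedSpace X] (f : X → ℂ) (hf : Continuous f) (h0 : ∀ x, f x ≠ 0) :
    ∃ L : X → ℂ, Continuous L ∧ ∀ x, Complex.exp (L x) = f x := by
  obtain ⟨x0⟩ : Nonempty X := inferInstance
  obtain ⟨F, ⟨-, hF⟩, -⟩ := Complex.isCoveringMap_exp.existsUnique_continuousMap_lifts
    (⟨fun x => ⟨f x, h0 x⟩, by fun_prop⟩ : C(X, {z : ℂ // z ≠ 0})) x0 (Complex.log (f x0))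
    (by ext; simp [Complex.exp_log (h0 x0)])
  refine ⟨F, F.continuous, fun x => ?_⟩
  have := congrFun hF x
  simpa using congrArg Subtype.val this

theorem cc_exp_const {X : Type} [TopologicalSpace X] {s : Set X} (hs : IsPreconnected s)
    {f g : X → ℂ} (hf : ContinuousOn f s) (hg : ContinuousOn g s)
    (h : ∀ x ∈ s, Complex.exp (f x) = Complex.exp (g x)) :
    ∃ k : ℤ, ∀ x ∈ s, f x = g x + k * (2 * Real.pi * Complex.I) := by
  rcases s.eq_empty_or_nonempty with rfl | ⟨x0, hx0⟩
  · exact ⟨0, by simp⟩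
  have h1 : ∀ x, ∃ n : ℤ, x ∈ s → f x = g x + n * (2 * Real.pi * Complex.I) := by
    intro x
    by_cases hx : x ∈ s
    · obtain ⟨n, hn⟩ := Complex.exp_eq_exp_iff_exists_int.1 (h x hx)
      exact ⟨n, fun _ => hn⟩
    · exact ⟨0, fun h => absurd h hx⟩
  choose n hn using h1
  have hc : ContinuousOn n s := by
    rw [Int.isClosedEmbedding_coe_real.isInducing.continuousOn_iff]
    have : ContinuousOn (fun x => ((f x - g x) / (2 * Real.pi * Complex.I)).re) s :=
      Complex.continuous_re.comp_continuousOn ((hf.sub hg).div_const _)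
    refine this.congr fun x hx => ?_
    have hne : (2 * Real.pi * Complex.I : ℂ) ≠ 0 := Complex.two_pi_I_ne_zero
    have e : (f x - g x) / (2 * Real.pi * Complex.I) = ((n x : ℝ) : ℂ) := by
      rw [div_eq_iff hne, hn x hx]; push_cast; ring
    change ((n x : ℤ) : ℝ) = ((f x - g x) / (2 * Real.pi * Complex.I)).re
    rw [e, Complex.ofReal_re]
  exact ⟨n x0, fun x hx => by rw [← hs.constant hc hx hx0]; exact hn x hx⟩

theorem cc_unicoherent {X : Type} [TopologicalSpace X] [SimplyConnectedSpace X] [NormalSpace X]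
    [LocallyPathConnectedSpace X] {P Q : Set X} (hPc : IsClosed P) (hQc : IsClosed Q)
    (hP : IsPreconnected P) (hQ : IsPreconnected Q) (hPQ : P ∪ Q = Set.univ) :
    IsPreconnected (P ∩ Q) := by
  classical
  rw [isPreconnected_closed_iff]
  intro t t' ht ht' hsub ⟨x1, hx1, hx1t⟩ ⟨x2, hx2, hx2t⟩
  by_contra hne
  have hdisj : Disjoint (P ∩ Q ∩ t) (P ∩ Q ∩ t') := by
    rw [Set.disjoint_left]
    intro x hx hx'
    exact hne ⟨x, hx.1, hx.2, hx'.2⟩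
  obtain ⟨f, hf0, hf1, -⟩ := exists_continuous_zero_one_of_isClosed
    ((hPc.inter hQc).inter ht) ((hPc.inter hQc).inter ht') hdisj
  let u : X → ℂ := fun x => (f x : ℂ) * (Real.pi * Complex.I)
  have hu : Continuous u := by fun_prop
  let φ : X → ℂ := fun x => if x ∈ P then Complex.exp (u x) else Complex.exp (- u x)
  have hφP : ∀ x ∈ P, φ x = Complex.exp (u x) := fun x hx => if_pos hx
  have hφQ : ∀ x ∈ Q, φ x = Complex.exp (- u x) := by
    intro x hx
    by_cases hxP : x ∈ P
    · rw [hφP x hxP]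
      rcases hsub ⟨hxP, hx⟩ with h | h
      · have : f x = 0 := hf0 ⟨⟨hxP, hx⟩, h⟩
        simp [u, this]
      · have : f x = 1 := hf1 ⟨⟨hxP, hx⟩, h⟩
        simp [u, this, Complex.exp_neg, Complex.exp_pi_mul_I]
    · exact if_neg hxP
  have hφ : Continuous φ := by
    rw [← continuousOn_univ, ← hPQ]
    refine ContinuousOn.union_of_isClosed ?_ ?_ hPc hQc
    · exact (Continuous.continuousOn (by fun_prop)).congr hφP
    · exact (Continuous.continuousOn (by fun_prop)).congr hφQ
  obtain ⟨L, hL, hLe⟩ := cc_exists_log φ hφ (by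
    intro x; simp only [φ]; split_ifs <;> exact Complex.exp_ne_zero _)
  obtain ⟨k, hk⟩ := cc_exp_const hP hL.continuousOn hu.continuousOn
    (fun x hx => (hLe x).trans (hφP x hx))
  obtain ⟨l, hl⟩ := cc_exp_const hQ hL.continuousOn (g := fun x => - u x) hu.neg.continuousOn
    (fun x hx => (hLe x).trans (hφQ x hx))
  have hpi : (Real.pi * Complex.I : ℂ) ≠ 0 := by simp [Real.pi_ne_zero]
  have e1 : f x1 = 0 := hf0 ⟨hx1, hx1t⟩
  have e2 : f x2 = 1 := hf1 ⟨hx2, hx2t⟩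
  have a1 := (hk x1 hx1.1).symm.trans (hl x1 hx1.2)
  have a2 := (hk x2 hx2.1).symm.trans (hl x2 hx2.2)
  simp only [u, e1, e2] at a1 a2
  have b1 : (k : ℂ) * (2 * (Real.pi * Complex.I)) = l * (2 * (Real.pi * Complex.I)) := by
    push_cast at a1
    linear_combination a1
  have b2 : (1 + 2 * (k : ℂ)) * ((Real.pi * Complex.I)) = (-1 + 2 * l) * ((Real.pi * Complex.I)) := by
    push_cast at a2
    linear_combination a2
  have c2 := mul_right_cancel₀ hpi b2
  have c1 : (k : ℂ) = l := mul_right_cancel₀ (mul_ne_zero two_ne_zero hpi) b1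
  rw [c1] at c2
  have : (1 : ℂ) = -1 := by linear_combination c2
  norm_num at this

theorem cc_key (U : Set ℂ) (hU : IsOpen U) (hb : Bornology.IsBounded U) {p q : ℂ} (hp : p ∈ U)
    (hq : q ∉ closure U) (K : Set ℂ) (hK : IsClosed K) (hUK : frontier U ⊆ K) (m n : ℤ)
    (h : ℂ → ℂ) (hh : ContinuousOn h K)
    (he : ∀ x ∈ K, Complex.exp (h x) = (x - p) ^ m * (x - q) ^ n) : m = 0 := by
  classical
  obtain ⟨H, hH⟩ := ContinuousMap.exists_restrict_eq hK (⟨K.domRestrict h, hh.domRestrict⟩ : C(K, ℂ))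
  have hH' : ∀ x ∈ K, H x = h x := fun x hx => congrArg (fun F : C(K, ℂ) => F ⟨x, hx⟩) hH
  let G : ℂ → ℂ := fun x => if x ∈ closure U then (x - q) ^ n else Complex.exp (H x) / (x - p) ^ m
  have hpc : p ∉ closure {x | ¬ x ∈ closure U} := by
    intro hc
    obtain ⟨y, hy, hy'⟩ := mem_closure_iff.1 hc U hU hp
    exact hy' (subset_closure hy)
  have hG : Continuous G := by
    refine continuous_if ?_ ?_ ?_
    · intro a ha
      have ha : a ∈ frontier (closure U) := ha
      have haU : a ∈ frontier U := frontier_closure_subset ha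
      have hap : a ≠ p := by
        rintro rfl
        exact (hU.frontier_eq ▸ haU).2 hp
      have : (a - p) ^ m ≠ 0 := zpow_ne_zero _ (sub_ne_zero.2 hap)
      rw [hH' a (hUK haU), he a (hUK haU)]
      field_simp
    · intro x hx
      have hx : x ∈ closure U := by simpa using hx
      have : x - q ≠ 0 := sub_ne_zero.2 (by rintro rfl; exact hq hx)
      exact (((continuous_id.sub continuous_const).continuousAt.zpow₀ n
        (Or.inl this))).continuousWithinAt
    · intro x hx
      have : x - p ≠ 0 := sub_ne_zero.2 (by rintro rfl; exact hpc hx)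
      refine ContinuousAt.continuousWithinAt (ContinuousAt.div (by fun_prop)
        ((continuous_id.sub continuous_const).continuousAt.zpow₀ m (Or.inl this))
        (zpow_ne_zero _ this))
  have hG0 : ∀ x, G x ≠ 0 := by
    intro x
    simp only [G]
    split_ifs with hx
    · exact zpow_ne_zero _ (sub_ne_zero.2 (by rintro rfl; exact hq hx))
    · refine div_ne_zero (Complex.exp_ne_zero _) (zpow_ne_zero _ (sub_ne_zero.2 ?_))
      rintro rfl
      exact hx (subset_closure hp)
  obtain ⟨L, hL, hLe⟩ := cc_exists_log G hG hG0
  obtain ⟨R, hR⟩ := (Metric.isBounded_iff_subset_closedBall p).1 hb.closure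
  let ρ : ℝ := |R| + 1
  have hρ : 0 < ρ := by positivity
  let c : ℝ → ℂ := fun θ => p + ρ * Complex.exp (θ * Complex.I)
  have hc : Continuous c := by fun_prop
  have hcU : ∀ θ, c θ ∉ closure U := by
    intro θ hθ
    have := hR hθ
    rw [Metric.mem_closedBall, dist_eq_norm] at this
    have e : ‖c θ - p‖ = ρ := by
      simp [c, Complex.norm_exp_ofReal_mul_I, abs_of_pos hρ]
    rw [e] at this
    have := le_abs_self R
    simp only [ρ] at *
    linarith
  have hexp : ∀ θ ∈ (Set.univ : Set ℝ), Complex.exp (H (c θ) - L (c θ)) =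
      Complex.exp (m * (Real.log ρ + θ * Complex.I)) := by
    intro θ _
    have hG' : G (c θ) = Complex.exp (H (c θ)) / (c θ - p) ^ m := if_neg (hcU θ)
    have e1 : c θ - p = Complex.exp (Real.log ρ + θ * Complex.I) := by
      rw [Complex.exp_add, ← Complex.ofReal_exp, Real.exp_log hρ]; simp [c]
    rw [Complex.exp_sub, hLe, hG', Complex.exp_int_mul, ← e1]
    have : (c θ - p) ≠ 0 := by rw [e1]; exact Complex.exp_ne_zero _
    have := zpow_ne_zero m this
    have := Complex.exp_ne_zero (H (c θ))
    field_simp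
  obtain ⟨k, hk⟩ := cc_exp_const isPreconnected_univ
    (f := fun θ : ℝ => H (c θ) - L (c θ)) (g := fun θ : ℝ => m * (Real.log ρ + θ * Complex.I))
    (by fun_prop) (by fun_prop) hexp
  have k0 := hk 0 trivial
  have k1 := hk (2 * Real.pi) trivial
  have ec : c (2 * Real.pi) = c 0 := by simp [c, Complex.exp_two_pi_mul_I]
  simp only [ec] at k1
  rw [k0] at k1
  have : (m : ℂ) * (2 * Real.pi * Complex.I) = 0 := by
    push_cast at k1
    linear_combination -k1
  rcases mul_eq_zero.1 this with h | h
  · exact_mod_cast h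
  · exact absurd h Complex.two_pi_I_ne_zero

theorem cc_descend {σ L : ℝ → ℂ} {S : Set ℝ} (hS : IsCompact S) (hσ : ContinuousOn σ S)
    (hL : ContinuousOn L S) (hfib : ∀ s ∈ S, ∀ t ∈ S, σ s = σ t → L s = L t) :
    ∃ h : ℂ → ℂ, ContinuousOn h (σ '' S) ∧ ∀ s ∈ S, h (σ s) = L s := by
  classical
  let h : ℂ → ℂ := fun y => if hy : ∃ s ∈ S, σ s = y then L hy.choose else 0
  have hh : ∀ s ∈ S, h (σ s) = L s := by
    intro s hs
    have hy : ∃ s' ∈ S, σ s' = σ s := ⟨s, hs, rfl⟩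
    simp only [h, dif_pos hy]
    exact hfib _ hy.choose_spec.1 _ hs hy.choose_spec.2
  refine ⟨h, ?_, hh⟩
  rw [continuousOn_iff_isClosed]
  intro t ht
  have hc : IsCompact (S ∩ L ⁻¹' t) :=
    hS.of_isClosed_subset (hL.preimage_isClosed_of_isClosed hS.isClosed ht) Set.inter_subset_left
  refine ⟨σ '' (S ∩ L ⁻¹' t), (hc.image_of_continuousOn
    (hσ.mono Set.inter_subset_left)).isClosed, ?_⟩
  ext y
  constructor
  · rintro ⟨hy, s, hs, rfl⟩
    refine ⟨⟨s, ⟨hs, ?_⟩, rfl⟩, s, hs, rfl⟩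
    have hy : h (σ s) ∈ t := hy
    rwa [hh s hs] at hy
  · rintro ⟨⟨s, ⟨hs, hst⟩, rfl⟩, h2⟩
    refine ⟨?_, h2⟩
    change h (σ s) ∈ t
    rwa [hh s hs]

structure CCurve (σ : ℝ → ℂ) (a b : ℝ) : Prop where
  lt : a < b
  cont : ContinuousOn σ (Set.Icc a b)
  closed : σ a = σ b
  inj : Set.InjOn σ (Set.Ico a b)

theorem CCurve.fib {σ : ℝ → ℂ} {a b : ℝ} (h : CCurve σ a b) {s t : ℝ} (hs : s ∈ Set.Icc a b)
    (ht : t ∈ Set.Icc a b) (hst : σ s = σ t) : s = t ∨ (s = a ∧ t = b) ∨ (s = b ∧ t = a) := by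
  have ha : a ∈ Set.Ico a b := ⟨le_rfl, h.lt⟩
  rcases eq_or_lt_of_le hs.2 with rfl | hs'
  · rcases eq_or_lt_of_le ht.2 with rfl | ht'
    · exact Or.inl rfl
    · right; right
      exact ⟨rfl, (h.inj ha ⟨ht.1, ht'⟩ (h.closed.trans hst)).symm⟩
  · rcases eq_or_lt_of_le ht.2 with rfl | ht'
    · right; left
      exact ⟨(h.inj ha ⟨hs.1, hs'⟩ (h.closed.trans hst.symm)).symm, rfl⟩
    · left
      exact h.inj ⟨hs.1, hs'⟩ ⟨ht.1, ht'⟩ hst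

theorem CCurve.lift {σ : ℝ → ℂ} {a b : ℝ} (h : CCurve σ a b) {p : ℂ}
    (hp : p ∉ σ '' Set.Icc a b) : ∃ L : ℝ → ℂ, Continuous L ∧
      (∀ s ∈ Set.Icc a b, Complex.exp (L s) = σ s - p) ∧
      ∃ k : ℤ, L b = L a + k * (2 * Real.pi * Complex.I) := by
  have hc : Continuous (fun s : ℝ => σ (Set.projIcc a b h.lt.le s) - p) :=
    (h.cont.comp_continuous (continuous_subtype_val.comp continuous_projIcc)
      (fun s => (Set.projIcc a b h.lt.le s).2)).sub continuous_const
  obtain ⟨L, hL, hLe⟩ := cc_exists_log _ hc (by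
    intro s hs
    exact hp ⟨_, (Set.projIcc a b h.lt.le s).2, sub_eq_zero.1 hs⟩)
  have hLe' : ∀ s ∈ Set.Icc a b, Complex.exp (L s) = σ s - p := by
    intro s hs
    rw [hLe, Set.projIcc_of_mem h.lt.le hs]
  refine ⟨L, hL, hLe', Complex.exp_eq_exp_iff_exists_int.1 ?_⟩
  rw [hLe' a ⟨le_rfl, h.lt.le⟩, hLe' b ⟨h.lt.le, le_rfl⟩, h.closed]

theorem cc_add_point {K : Set ℂ} (hK : IsClosed K) {h ψ : ℂ → ℂ} (hh : ContinuousOn h K)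
    (he : ∀ x ∈ K, Complex.exp (h x) = ψ x) (z : ℂ) (hz : ψ z ≠ 0) :
    ∃ h' : ℂ → ℂ, ContinuousOn h' (K ∪ {z}) ∧ ∀ x ∈ K ∪ {z}, Complex.exp (h' x) = ψ x := by
  classical
  by_cases hzK : z ∈ K
  · have : K ∪ {z} = K := by simpa using hzK
    rw [this]
    exact ⟨h, hh, he⟩
  · have hne : ∀ x ∈ K, x ≠ z := by rintro x hx rfl; exact hzK hx
    refine ⟨fun x => if x = z then Complex.log (ψ z) else h x, ?_, ?_⟩
    · refine ContinuousOn.union_of_isClosed ?_ (continuousOn_singleton _ _) hK isClosed_singleton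
      exact hh.congr fun x hx => if_neg (hne x hx)
    · rintro x (hx | rfl)
      · simp only [if_neg (hne x hx)]; exact he x hx
      · simp only [if_true]; exact Complex.exp_log hz

theorem cc_sepA {σ : ℝ → ℂ} {a b : ℝ} (hσ : CCurve σ a b) {U : Set ℂ} (hU : IsOpen U)
    (hb : Bornology.IsBounded U) {p z : ℂ} (hp : p ∈ U) (hpσ : p ∉ σ '' Set.Icc a b) (hpz : p ≠ z)
    (hfr : frontier U ⊆ σ '' Set.Icc a b ∪ {z}) {t0 : ℝ} (ht0m : t0 ∈ Set.Icc a b)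
    (ht0 : σ t0 ∉ frontier U) : False := by
  classical
  obtain ⟨L, hL, hLe, k, hk⟩ := hσ.lift hpσ
  let S : Set ℝ := Set.Icc a b ∩ σ ⁻¹' frontier U
  have hS : IsCompact S := isCompact_Icc.of_isClosed_subset
    (hσ.cont.preimage_isClosed_of_isClosed isClosed_Icc isClosed_frontier) Set.inter_subset_left
  have hσS : ContinuousOn σ S := hσ.cont.mono Set.inter_subset_left
  let c : ℂ := k * (2 * Real.pi * Complex.I)
  have hec : Complex.exp c = 1 := Complex.exp_eq_one_iff.2 ⟨k, rfl⟩
  let L' : ℝ → ℂ := fun s => L s - (if t0 < s then c else 0)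
  have hne : ∀ s ∈ S, s ≠ t0 := by
    rintro s hs rfl
    exact ht0 hs.2
  have hL' : ContinuousOn L' S := by
    intro s hs
    refine ContinuousAt.continuousWithinAt (hL.continuousAt.sub ?_)
    rcases lt_or_gt_of_ne (hne s hs) with h | h
    · refine (continuousAt_const (y := (0 : ℂ))).congr ?_
      filter_upwards [Iio_mem_nhds h] with x hx
      exact (if_neg (not_lt.2 (le_of_lt hx))).symm
    · refine (continuousAt_const (y := c)).congr ?_
      filter_upwards [Ioi_mem_nhds h] with x hx
      exact (if_pos hx).symm
  have hab : a ∈ S → b ∈ S → L' b = L' a := by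
    intro ha hb'
    have ht1 : ¬ t0 < a := not_lt.2 ht0m.1
    have hb2 : t0 < b := lt_of_le_of_ne ht0m.2 (Ne.symm (hne b hb'))
    simp only [L', if_neg ht1, if_pos hb2, hk, c]
    ring
  obtain ⟨h, hh, hhs⟩ := cc_descend hS hσS hL' (by
    intro s hs t ht hst
    rcases hσ.fib hs.1 ht.1 hst with rfl | ⟨rfl, rfl⟩ | ⟨rfl, rfl⟩
    · rfl
    · exact (hab hs ht).symm
    · exact hab ht hs)
  have hK : IsCompact (σ '' S) := hS.image_of_continuousOn hσS
  obtain ⟨q, hq⟩ : ∃ q, q ∉ closure U := by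
    by_contra hcon
    push Not at hcon
    have : closure U = Set.univ := Set.eq_univ_of_forall hcon
    exact NormedSpace.unbounded_univ ℝ ℂ (this ▸ hb.closure)
  obtain ⟨h', hh', he'⟩ := cc_add_point hK.isClosed (ψ := fun x => (x - p) ^ (1 : ℤ) * (x - q) ^ (0 : ℤ))
    hh (by
      rintro _ ⟨s, hs, rfl⟩
      rw [hhs s hs]
      simp only [L', Complex.exp_sub, hLe s hs.1, zpow_one, zpow_zero, mul_one]
      split_ifs <;> simp [hec]) z (by simpa [sub_eq_zero] using hpz.symm)
  have := cc_key U hU hb hp hq (σ '' S ∪ {z}) (hK.isClosed.union isClosed_singleton) (by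
    intro x hx
    rcases hfr hx with ⟨s, hs, rfl⟩ | h
    · exact Or.inl ⟨s, ⟨hs, hx⟩, rfl⟩
    · exact Or.inr h) 1 0 h' hh' he'
  exact one_ne_zero this

theorem cc_sepB {σ : ℝ → ℂ} {a b : ℝ} (hσ : CCurve σ a b) {U V : Set ℂ} (hU : IsOpen U)
    (hV : IsOpen V) (hbU : Bornology.IsBounded U) (hbV : Bornology.IsBounded V)
    (hUV : Disjoint U V) {p q z : ℂ} (hp : p ∈ U) (hq : q ∈ V)
    (hpσ : p ∉ σ '' Set.Icc a b) (hqσ : q ∉ σ '' Set.Icc a b) (hpz : p ≠ z) (hqz : q ≠ z)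
    (hfU : frontier U ⊆ σ '' Set.Icc a b ∪ {z}) (hfV : frontier V ⊆ σ '' Set.Icc a b ∪ {z}) :
    False := by
  obtain ⟨L1, hL1, hLe1, k1, hk1⟩ := hσ.lift hpσ
  obtain ⟨L2, hL2, hLe2, k2, hk2⟩ := hσ.lift hqσ
  obtain ⟨m, n, hmn, hmk⟩ : ∃ m n : ℤ, ¬ (m = 0 ∧ n = 0) ∧ m * k1 + n * k2 = 0 := by
    by_cases h : k1 = 0 ∧ k2 = 0
    · exact ⟨1, 0, by simp, by simp [h.1]⟩
    · exact ⟨k2, -k1, fun h' => h ⟨by simpa using h'.2, h'.1⟩, by ring⟩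
  let L : ℝ → ℂ := fun s => m * L1 s + n * L2 s
  have hL : Continuous L := by fun_prop
  have hLab : L b = L a := by
    have : (m : ℂ) * k1 + n * k2 = 0 := by exact_mod_cast hmk
    simp only [L, hk1, hk2]
    linear_combination (2 * Real.pi * Complex.I) * this
  obtain ⟨h, hh, hhs⟩ := cc_descend isCompact_Icc hσ.cont hL.continuousOn (by
    intro s hs t ht hst
    rcases hσ.fib hs ht hst with rfl | ⟨rfl, rfl⟩ | ⟨rfl, rfl⟩
    · rfl
    · exact hLab.symm
    · exact hLab)
  have hK : IsCompact (σ '' Set.Icc a b) := isCompact_Icc.image_of_continuousOn hσ.cont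
  obtain ⟨h', hh', he'⟩ := cc_add_point hK.isClosed (ψ := fun x => (x - p) ^ m * (x - q) ^ n)
    hh (by
      rintro _ ⟨s, hs, rfl⟩
      rw [hhs s hs]
      simp only [L, Complex.exp_add, Complex.exp_int_mul, hLe1 s hs, hLe2 s hs]) z
    (mul_ne_zero (zpow_ne_zero _ (sub_ne_zero.2 hpz.symm)) (zpow_ne_zero _ (sub_ne_zero.2 hqz.symm)))
  have hKc := hK.isClosed.union (isClosed_singleton (x := z))
  refine hmn ⟨?_, ?_⟩
  · exact cc_key U hU hbU hp (fun hc => Set.disjoint_left.1 (hUV.closure_left hV) hc hq) _ hKc hfU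
      m n h' hh' he'
  · exact cc_key V hV hbV hq (fun hc => Set.disjoint_left.1 (hUV.symm.closure_left hU) hc hp) _ hKc
      hfV n m h' hh' (fun x hx => by rw [he' x hx, mul_comm])

/-- inversion about o, from the plane to ℂ -/
def ccJ (o x : R2) : ℂ := (Complex.equivRealProdCLM.symm x - Complex.equivRealProdCLM.symm o)⁻¹

/-- the inverse of the inversion -/
def ccI (o : R2) (y : ℂ) : R2 := Complex.equivRealProdCLM (y⁻¹ + Complex.equivRealProdCLM.symm o)

theorem ccJ_inj (o : R2) : Function.Injective (ccJ o) := by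
  intro x y h
  have := inv_injective h
  exact Complex.equivRealProdCLM.symm.injective (sub_left_injective this)

theorem ccJ_ne {o x : R2} (h : x ≠ o) : ccJ o x ≠ 0 := by
  refine inv_ne_zero (sub_ne_zero.2 fun h' => h (Complex.equivRealProdCLM.symm.injective h'))

theorem ccI_J (o x : R2) : ccI o (ccJ o x) = x := by
  simp [ccI, ccJ]

theorem ccJ_I (o : R2) (y : ℂ) : ccJ o (ccI o y) = y := by
  unfold ccI ccJ
  rw [ContinuousLinearEquiv.symm_apply_apply, add_sub_cancel_right, inv_inv]

theorem ccJ_cont {o x : R2} (h : x ≠ o) : ContinuousAt (ccJ o) x := by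
  refine ContinuousAt.inv₀ (by fun_prop) (sub_ne_zero.2 fun h' =>
    h (Complex.equivRealProdCLM.symm.injective h'))

theorem ccI_cont {o : R2} {y : ℂ} (h : y ≠ 0) : ContinuousAt (ccI o) y := by
  unfold ccI
  have : ContinuousAt (fun y : ℂ => y⁻¹) y := continuousAt_inv₀ h
  fun_prop

theorem ccJ_tendsto (o : R2) : Filter.Tendsto (ccJ o) (Filter.cocompact R2) (nhds 0) := by
  have h1 := (Complex.equivRealProdCLM.symm.toHomeomorph.trans
    (Homeomorph.subRight (Complex.equivRealProdCLM.symm o))).isClosedEmbedding.tendsto_cocompact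
  have h2 : Filter.Tendsto (fun y : ℂ => y⁻¹) (Filter.cocompact ℂ) (nhds 0) := by
    rw [← Metric.cobounded_eq_cocompact]
    exact Filter.tendsto_inv₀_cobounded
  exact h2.comp h1

theorem ccJ_open {o : R2} {C : Set R2} (hC : IsOpen C) (ho : o ∉ C) : IsOpen (ccJ o '' C) := by
  rw [isOpen_iff_mem_nhds]
  rintro _ ⟨x, hx, rfl⟩
  have hne : ccJ o x ≠ 0 := ccJ_ne (by rintro rfl; exact ho hx)
  have h1 := (ccI_cont (o := o) hne).preimage_mem_nhds (t := C)
    (by rw [ccI_J]; exact hC.mem_nhds hx)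
  filter_upwards [h1] with y hy
  exact ⟨_, hy, ccJ_I o y⟩

theorem ccJ_frontier {o : R2} {C : Set R2} (hC : IsOpen C) (ho : o ∉ C) :
    frontier (ccJ o '' C) ⊆ ccJ o '' frontier C ∪ {0} := by
  intro y hy
  by_cases h0 : y = 0
  · exact Or.inr h0
  left
  rw [(ccJ_open hC ho).frontier_eq] at hy
  refine ⟨ccI o y, ?_, ccJ_I o y⟩
  rw [hC.frontier_eq]
  refine ⟨?_, fun h => hy.2 ⟨_, h, ccJ_I o y⟩⟩
  have := mem_closure_image (ccI_cont (o := o) h0) hy.1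
  rw [Set.image_image] at this
  simpa [ccI_J] using this

theorem ccJ_bdd {o : R2} {C : Set R2} (ho : o ∉ closure C) :
    Bornology.IsBounded (ccJ o '' C) := by
  -- `ccJ o` is bounded off a neighbourhood of `o`
  have h1 : (closure C)ᶜ ∈ nhds o := isClosed_closure.isOpen_compl.mem_nhds ho
  have h2 : Filter.Tendsto (fun y : ℂ => Complex.equivRealProdCLM (y +
      Complex.equivRealProdCLM.symm o)) (nhds 0) (nhds o) := by
    have : Continuous (fun y : ℂ => Complex.equivRealProdCLM (y +
      Complex.equivRealProdCLM.symm o)) := by fun_prop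
    simpa using this.tendsto 0
  obtain ⟨ε, hε, hb⟩ := Metric.mem_nhds_iff.1 (h2 h1)
  rw [isBounded_iff_forall_norm_le]
  refine ⟨ε⁻¹, ?_⟩
  rintro _ ⟨x, hx, rfl⟩
  rw [ccJ, norm_inv]
  refine inv_anti₀ hε ?_
  by_contra hlt
  push Not at hlt
  have := hb (mem_ball_zero_iff.2 hlt)
  simp at this
  exact this (subset_closure hx)

theorem cc_curve {γ : ℝ → R2} (hγ : IsSimplePath γ ∨ IsSimpleLoop γ) {o : R2}
    (ho : o ∉ Set.range γ) : ∃ (σ : ℝ → ℂ) (a b : ℝ), CCurve σ a b ∧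
      ccJ o '' Set.range γ ⊆ σ '' Set.Icc a b ∧
      σ '' Set.Icc a b ⊆ ccJ o '' Set.range γ ∪ {0} := by
  classical
  have hne : ∀ t, γ t ≠ o := fun t h => ho ⟨t, h⟩
  rcases hγ with hγ | hγ
  · have hJγ : Continuous (fun t => ccJ o (γ t)) := continuous_iff_continuousAt.2 fun t =>
      ContinuousAt.comp (g := ccJ o) (ccJ_cont (hne t)) hγ.continuous.continuousAt
    have hγc : Filter.Tendsto γ (Filter.cocompact ℝ) (Filter.cocompact R2) := by
      intro s hs
      obtain ⟨K, hK, hKs⟩ := Filter.mem_cocompact.1 hs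
      refine Filter.mem_of_superset (hγ.proper K hK).compl_mem_cocompact fun t ht => hKs ht
    have hlim : Filter.Tendsto (fun t => ccJ o (γ t)) (Filter.cocompact ℝ) (nhds 0) :=
      (ccJ_tendsto o).comp hγc
    let I := Set.Ioo (-(Real.pi / 2)) (Real.pi / 2)
    let σ : ℝ → ℂ := fun θ => if θ ∈ I then ccJ o (γ (Real.tan θ)) else 0
    have hσI : ∀ θ ∈ I, σ θ = ccJ o (γ (Real.tan θ)) := fun θ h => if_pos h
    have hσa : σ (-(Real.pi / 2)) = 0 := if_neg (fun h => lt_irrefl _ h.1)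
    have hσb : σ (Real.pi / 2) = 0 := if_neg (fun h => lt_irrefl _ h.2)
    have hlt : -(Real.pi / 2) < Real.pi / 2 := by linarith [Real.pi_pos]
    refine ⟨σ, -(Real.pi / 2), Real.pi / 2, ⟨hlt, ?_, by rw [hσa, hσb], ?_⟩, ?_, ?_⟩
    · intro θ hθ
      rcases eq_or_lt_of_le hθ.1 with rfl | h1
      · refine ContinuousWithinAt.mono (t := Set.Ici _) ?_ Set.Icc_subset_Ici_self
        rw [← continuousWithinAt_Ioi_iff_Ici, ContinuousWithinAt, hσa]
        refine ((hlim.mono_left atBot_le_cocompact).comp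
          Real.tendsto_tan_neg_pi_div_two).congr' ?_
        filter_upwards [Ioo_mem_nhdsGT hlt] with x hx
        exact (hσI x hx).symm
      rcases eq_or_lt_of_le hθ.2 with rfl | h2
      · refine ContinuousWithinAt.mono (t := Set.Iic _) ?_ Set.Icc_subset_Iic_self
        rw [← continuousWithinAt_Iio_iff_Iic, ContinuousWithinAt, hσb]
        refine ((hlim.mono_left atTop_le_cocompact).comp
          Real.tendsto_tan_pi_div_two).congr' ?_
        filter_upwards [Ioo_mem_nhdsLT hlt] with x hx
        exact (hσI x hx).symm
      · refine ContinuousAt.continuousWithinAt ?_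
        have hcos : Real.cos θ ≠ 0 := (Real.cos_pos_of_mem_Ioo ⟨h1, h2⟩).ne'
        have : ContinuousAt (fun x => ccJ o (γ (Real.tan x))) θ :=
          ContinuousAt.comp (g := fun t => ccJ o (γ t)) hJγ.continuousAt
            (Real.continuousAt_tan.2 hcos)
        refine this.congr ?_
        filter_upwards [Ioo_mem_nhds h1 h2] with x hx
        exact (hσI x hx).symm
    · intro x hx y hy hxy
      by_cases hxI : x ∈ I <;> by_cases hyI : y ∈ I
      · rw [hσI x hxI, hσI y hyI] at hxy
        exact Real.injOn_tan hxI hyI (hγ.injective (ccJ_inj o hxy))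
      · rw [hσI x hxI, show σ y = 0 from if_neg hyI] at hxy
        exact absurd hxy (ccJ_ne (hne _))
      · rw [hσI y hyI, show σ x = 0 from if_neg hxI] at hxy
        exact absurd hxy.symm (ccJ_ne (hne _))
      · have e1 : x = -(Real.pi / 2) := by
          by_contra h
          exact hxI ⟨lt_of_le_of_ne hx.1 (Ne.symm h), hx.2⟩
        have e2 : y = -(Real.pi / 2) := by
          by_contra h
          exact hyI ⟨lt_of_le_of_ne hy.1 (Ne.symm h), hy.2⟩
        rw [e1, e2]
    · rintro _ ⟨_, ⟨t, rfl⟩, rfl⟩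
      refine ⟨Real.arctan t, Set.Ioo_subset_Icc_self (Real.arctan_mem_Ioo t), ?_⟩
      rw [hσI _ (Real.arctan_mem_Ioo t), Real.tan_arctan]
    · rintro _ ⟨θ, hθ, rfl⟩
      by_cases h : θ ∈ I
      · left; rw [hσI θ h]; exact ⟨_, ⟨_, rfl⟩, rfl⟩
      · right; exact if_neg h
  · have hJγ : Continuous (fun t => ccJ o (γ t)) := continuous_iff_continuousAt.2 fun t =>
      ContinuousAt.comp (g := ccJ o) (ccJ_cont (hne t)) hγ.continuous.continuousAt
    obtain ⟨T, hT, hper, hinj⟩ := hγ.periodic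
    refine ⟨fun t => ccJ o (γ t), 0, T, ⟨hT, hJγ.continuousOn, ?_, ?_⟩, ?_, ?_⟩
    · rw [← hper 0, zero_add]
    · intro x hx y hy hxy
      exact hinj hx hy (ccJ_inj o hxy)
    · rintro _ ⟨_, ⟨t, rfl⟩, rfl⟩
      have : γ t ∈ γ '' Set.Icc 0 (0 + T) := by
        rw [hper.image_Icc hT]; exact ⟨t, rfl⟩
      obtain ⟨s, hs, hst⟩ := this
      rw [zero_add] at hs
      exact ⟨s, hs, by simp only [hst]⟩
    · rintro _ ⟨t, -, rfl⟩
      exact Or.inl ⟨_, ⟨t, rfl⟩, rfl⟩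

theorem cc_full {γ : ℝ → R2} (hγ : IsSimplePath γ ∨ IsSimpleLoop γ) {o : R2}
    (ho : o ∉ Set.range γ) {C : Set R2} (hC : IsOpen C) (hne : C.Nonempty) (hoC : o ∉ closure C)
    (hfr : frontier C ⊆ Set.range γ) (hd : Disjoint C (Set.range γ)) :
    frontier C = Set.range γ := by
  refine hfr.antisymm fun y hy => ?_
  by_contra hyC
  obtain ⟨σ, a, b, hσ, h1, h2⟩ := cc_curve hγ ho
  obtain ⟨p, hp⟩ := hne
  have hoC' : o ∉ C := fun h => hoC (subset_closure h)
  have hp0 : ccJ o p ≠ 0 := ccJ_ne (by rintro rfl; exact hoC' hp)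
  have hy0 : ccJ o y ≠ 0 := ccJ_ne (by rintro rfl; exact ho hy)
  obtain ⟨t0, ht0, hty⟩ := h1 ⟨y, hy, rfl⟩
  refine cc_sepA hσ (ccJ_open hC hoC') (ccJ_bdd hoC) (p := ccJ o p) (z := 0) ⟨p, hp, rfl⟩ ?_ hp0
    ((ccJ_frontier hC hoC').trans (Set.union_subset_union_left _ ((Set.image_mono hfr).trans h1)))
    ht0 ?_
  · intro h
    rcases h2 h with ⟨x, hx, hxp⟩ | h
    · exact Set.disjoint_left.1 hd hp (ccJ_inj o hxp ▸ hx)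
    · exact hp0 h
  · intro h
    rw [hty] at h
    rcases ccJ_frontier hC hoC' h with ⟨x, hx, hxp⟩ | h
    · exact hyC (ccJ_inj o hxp ▸ hx)
    · exact hy0 h

theorem cc_two {γ : ℝ → R2} (hγ : IsSimplePath γ ∨ IsSimpleLoop γ) {o : R2}
    (ho : o ∉ Set.range γ) {C D : Set R2} (hC : IsOpen C) (hneC : C.Nonempty) (hoC : o ∉ closure C)
    (hfrC : frontier C ⊆ Set.range γ) (hdC : Disjoint C (Set.range γ))
    (hD : IsOpen D) (hneD : D.Nonempty) (hoD : o ∉ closure D)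
    (hfrD : frontier D ⊆ Set.range γ) (hdD : Disjoint D (Set.range γ)) (hCD : Disjoint C D) :
    False := by
  obtain ⟨σ, a, b, hσ, h1, h2⟩ := cc_curve hγ ho
  obtain ⟨p, hp⟩ := hneC
  obtain ⟨q, hq⟩ := hneD
  have hoC' : o ∉ C := fun h => hoC (subset_closure h)
  have hoD' : o ∉ D := fun h => hoD (subset_closure h)
  have hp0 : ccJ o p ≠ 0 := ccJ_ne (by rintro rfl; exact hoC' hp)
  have hq0 : ccJ o q ≠ 0 := ccJ_ne (by rintro rfl; exact hoD' hq)
  refine cc_sepB hσ (ccJ_open hC hoC') (ccJ_open hD hoD') (ccJ_bdd hoC) (ccJ_bdd hoD)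
    ((Set.disjoint_image_iff (ccJ_inj o)).2 hCD) (p := ccJ o p) (q := ccJ o q) (z := 0)
    ⟨p, hp, rfl⟩ ⟨q, hq, rfl⟩ ?_ ?_ hp0 hq0
    ((ccJ_frontier hC hoC').trans (Set.union_subset_union_left _ ((Set.image_mono hfrC).trans h1)))
    ((ccJ_frontier hD hoD').trans (Set.union_subset_union_left _ ((Set.image_mono hfrD).trans h1)))
  · intro h
    rcases h2 h with ⟨x, hx, hxp⟩ | h
    · exact Set.disjoint_left.1 hdC hp (ccJ_inj o hxp ▸ hx)
    · exact hp0 h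
  · intro h
    rcases h2 h with ⟨x, hx, hxp⟩ | h
    · exact Set.disjoint_left.1 hdD hq (ccJ_inj o hxp ▸ hx)
    · exact hq0 h

theorem cc_inter_frontier {s t : Set R2} (ht : IsPreconnected t) (h1 : (t ∩ s).Nonempty)
    (h2 : (t ∩ sᶜ).Nonempty) : (t ∩ frontier s).Nonempty := by
  by_contra hcon
  have hno : ∀ x ∈ t, x ∉ frontier s := fun x hx h => hcon ⟨x, hx, h⟩
  obtain ⟨x, hx, hxs⟩ := h1
  obtain ⟨y, hy, hys⟩ := h2
  have hin : ∀ z ∈ t, z ∈ closure s → z ∈ interior s := fun z hz hc => by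
    by_contra h
    exact hno z hz ⟨hc, h⟩
  obtain ⟨z, hz, hz1, hz2⟩ := ht (interior s) (closure s)ᶜ isOpen_interior
    isClosed_closure.isOpen_compl (fun z hz => by
      by_cases h : z ∈ closure s
      · exact Or.inl (hin z hz h)
      · exact Or.inr h)
    ⟨x, hx, hin x hx (subset_closure hxs)⟩
    ⟨y, hy, fun h => hys (interior_subset (hin y hy h))⟩
  exact hz2 (subset_closure (interior_subset hz1))

theorem cc_comp_eq {B C D : Set R2} (hC : C ∈ components B) (hD : D ∈ components B) {z : R2}
    (hzC : z ∈ C) (hzD : z ∈ D) : C = D := by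
  obtain ⟨x, hx, rfl⟩ := hC
  obtain ⟨y, hy, rfl⟩ := hD
  rw [connectedComponentIn_eq hzC, connectedComponentIn_eq hzD]

theorem cc_comp_frontier {B C : Set R2} (hB : IsOpen B) (hC : C ∈ components B) :
    frontier C ⊆ frontier B := by
  intro y hy
  have hCo : IsOpen C := by obtain ⟨x, hx, rfl⟩ := hC; exact hB.connectedComponentIn
  have hCB : C ⊆ B := by obtain ⟨x, hx, rfl⟩ := hC; exact connectedComponentIn_subset _ _
  rw [hCo.frontier_eq] at hy
  rw [hB.frontier_eq]
  refine ⟨closure_mono hCB hy.1, fun hyB => hy.2 ?_⟩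
  have hyD : y ∈ connectedComponentIn B y := mem_connectedComponentIn hyB
  obtain ⟨z, hz, hz'⟩ := mem_closure_iff.1 hy.1 _ (hB.connectedComponentIn) hyD
  rw [cc_comp_eq hC ⟨y, hyB, rfl⟩ hz' hz]
  exact hyD

/-- Lemma 7.7: for a connected good set A, the connected components
of int(A^c) are in bijection with the connected components of ∂A via C ↦ ∂C; in
particular they are simple sets. -/
theorem complement_components_are_simple
    (A : Set R2) (hA : IsGoodSet A) (hconn : IsConnected A) :
    ∃ Φ : Set R2 → Set R2,
      Set.BijOn Φ (components (interior Aᶜ)) (components (frontier A)) ∧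
      (∀ C ∈ components (interior Aᶜ), frontier C = Φ C) ∧
      (∀ C ∈ components (interior Aᶜ), IsSimpleSet C) := by
  obtain ⟨hAo, hfr, hcurve, ⟨ρ, hρ, hsep⟩, -⟩ := hA
  obtain ⟨o, ho⟩ := hconn.nonempty
  have hBo : IsOpen (interior Aᶜ) := isOpen_interior
  have hBA : Disjoint A (interior Aᶜ) :=
    Set.disjoint_left.2 fun x hx hx' => interior_subset hx' hx
  have hFA : Disjoint A (frontier A) := by
    rw [hAo.frontier_eq]; exact Set.disjoint_sdiff_right
  have hFB : Disjoint (interior Aᶜ) (frontier A) := by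
    rw [← hfr, hBo.frontier_eq]; exact Set.disjoint_sdiff_right
  have hsub : ∀ C ∈ components (interior Aᶜ), C ⊆ interior Aᶜ := by
    rintro _ ⟨x, hx, rfl⟩; exact connectedComponentIn_subset _ _
  have hopen : ∀ C ∈ components (interior Aᶜ), IsOpen C := by
    rintro _ ⟨x, hx, rfl⟩; exact hBo.connectedComponentIn
  have hcon : ∀ C ∈ components (interior Aᶜ), IsConnected C := by
    rintro _ ⟨x, hx, rfl⟩; exact isConnected_connectedComponentIn_iff.2 hx
  have hCF : ∀ C ∈ components (interior Aᶜ), frontier C ⊆ frontier A := fun C hC =>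
    (cc_comp_frontier hBo hC).trans hfr.subset
  have hoC : ∀ C ∈ components (interior Aᶜ), o ∉ closure C := fun C hC h =>
    Set.disjoint_left.1 ((hBA.mono_right (hsub C hC)).closure_right hAo) ho h
  have hfne : ∀ C ∈ components (interior Aᶜ), (frontier C).Nonempty := by
    intro C hC
    obtain ⟨x, hx⟩ := (hcon C hC).nonempty
    have h := cc_inter_frontier (s := C) (t := Set.univ) isPreconnected_univ
      ⟨x, trivial, hx⟩ ⟨o, trivial, fun h => hoC C hC (subset_closure h)⟩
    exact h.mono Set.inter_subset_right
  -- complements of components are connected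
  have hcompl : ∀ C ∈ components (interior Aᶜ), IsPreconnected Cᶜ := by
    intro C hC
    have hclA : closure A ⊆ Cᶜ := fun y hy hyC => Set.disjoint_left.1
      ((hBA.mono_right (hsub C hC)).closure_left (hopen C hC)) hy hyC
    refine isPreconnected_of_forall o fun y hy => ?_
    by_cases hyA : y ∈ closure A
    · exact ⟨closure A, hclA, subset_closure ho, hyA, hconn.isPreconnected.closure⟩
    · have hyB : y ∈ interior Aᶜ := by rw [interior_compl]; exact hyA
      have hD : connectedComponentIn (interior Aᶜ) y ∈ components (interior Aᶜ) := ⟨y, hyB, rfl⟩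
      have hyD : y ∈ connectedComponentIn (interior Aᶜ) y := mem_connectedComponentIn hyB
      generalize connectedComponentIn (interior Aᶜ) y = D at hD hyD
      have hCD : Disjoint D C := Set.disjoint_left.2 fun z hz hz' =>
        hy (cc_comp_eq hD hC hz hz' ▸ hyD)
      obtain ⟨w, hw⟩ := hfne D hD
      refine ⟨closure A ∪ closure D, Set.union_subset hclA fun z hz hz' =>
        Set.disjoint_left.1 (hCD.closure_left (hopen C hC)) hz hz',
        Or.inl (subset_closure ho), Or.inr (subset_closure hyD), ?_⟩
      exact IsPreconnected.union w (frontier_subset_closure (hCF D hD hw))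
        (frontier_subset_closure hw) hconn.isPreconnected.closure
        (hcon D hD).isPreconnected.closure
  have hfcon : ∀ C ∈ components (interior Aᶜ), IsPreconnected (frontier C) := by
    intro C hC
    have := cc_unicoherent isClosed_closure (hopen C hC).isClosed_compl
      (hcon C hC).isPreconnected.closure (hcompl C hC) (by
        ext x
        by_cases h : x ∈ C
        · simp [subset_closure h]
        · simp [h])
    rwa [(hopen C hC).frontier_eq, Set.sdiff_eq]
  have hdis : ∀ C ∈ components (interior Aᶜ), ∀ Γ ∈ components (frontier A), Disjoint C Γ := by
    rintro C hC _ ⟨y, hy, rfl⟩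
    exact (hFB.mono_left (hsub C hC)).mono_right (connectedComponentIn_subset _ _)
  have hoΓ : ∀ Γ ∈ components (frontier A), o ∉ Γ := by
    rintro _ ⟨y, hy, rfl⟩ h
    exact Set.disjoint_left.1 hFA ho (connectedComponentIn_subset _ _ h)
  have hmem : ∀ C ∈ components (interior Aᶜ), frontier C ∈ components (frontier A) := by
    intro C hC
    obtain ⟨y, hy⟩ := hfne C hC
    have hΓ : connectedComponentIn (frontier A) y ∈ components (frontier A) :=
      ⟨y, hCF C hC hy, rfl⟩
    have hsubΓ := (hfcon C hC).subset_connectedComponentIn hy (hCF C hC)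
    generalize connectedComponentIn (frontier A) y = Γ at hΓ hsubΓ
    have hd := hdis C hC Γ hΓ
    have hoG := hoΓ Γ hΓ
    obtain ⟨γ, hγ, e⟩ := hcurve Γ hΓ
    have : frontier C = Γ := by
      rw [e] at hd hsubΓ hoG ⊢
      exact cc_full hγ hoG (hopen C hC) (hcon C hC).nonempty (hoC C hC) hsubΓ hd
    rw [this]; exact hΓ
  refine ⟨frontier, ⟨hmem, ?_, ?_⟩, fun _ _ => rfl, fun C hC =>
    ⟨hopen C hC, hcon C hC, hcurve _ (hmem C hC)⟩⟩
  · intro C hC D hD hCD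
    by_contra hne
    have hdisj : Disjoint C D := Set.disjoint_left.2 fun z hz hz' => hne (cc_comp_eq hC hD hz hz')
    obtain ⟨γ, hγ, e⟩ := hcurve _ (hmem C hC)
    have hoG := hoΓ _ (hmem C hC)
    have hd1 := hdis C hC _ (hmem C hC)
    have hd2 := hdis D hD _ (hmem C hC)
    rw [e] at hoG hd1 hd2
    exact cc_two hγ hoG (hopen C hC) (hcon C hC).nonempty (hoC C hC) e.subset hd1
      (hopen D hD) (hcon D hD).nonempty (hoC D hD) (hCD.symm.trans e).subset hd2 hdisj
  · intro Γ hΓ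
    have hΓ' : ∃ x ∈ frontier A, Γ = connectedComponentIn (frontier A) x := hΓ
    obtain ⟨x, hx, hxΓ⟩ := hΓ'
    have hxm : x ∈ Γ := hxΓ ▸ mem_connectedComponentIn hx
    have hxB : x ∈ closure (interior Aᶜ) := frontier_subset_closure (hfr ▸ hx)
    obtain ⟨b, hb, hbx⟩ := Metric.mem_closure_iff.1 hxB (ρ / 2) (by positivity)
    have hC : connectedComponentIn (interior Aᶜ) b ∈ components (interior Aᶜ) := ⟨b, hb, rfl⟩
    have hbC : b ∈ connectedComponentIn (interior Aᶜ) b := mem_connectedComponentIn hb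
    generalize connectedComponentIn (interior Aᶜ) b = C at hC hbC
    refine ⟨C, hC, ?_⟩
    have hxC : x ∉ C := fun h => Set.disjoint_left.1 hFB (hsub C hC h) hx
    obtain ⟨y, hyb, hy⟩ := cc_inter_frontier (convex_ball x (ρ / 2)).isPreconnected (s := C)
      ⟨b, by rw [Metric.mem_ball, dist_comm]; exact hbx, hbC⟩
      ⟨x, Metric.mem_ball_self (by positivity), hxC⟩
    by_contra hne
    have h1 := hsep _ (hmem C hC) Γ hΓ hne y hy x hxm
    rw [Metric.mem_ball, dist_eq_norm, Prod.norm_def, max_lt_iff] at hyb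
    obtain ⟨h2, h3⟩ := hyb
    rw [Real.norm_eq_abs] at h2 h3
    have h4 : eudist y x < ρ := by
      rw [eudist, eunorm, Real.sqrt_lt' hρ]
      have := sq_lt_sq' (neg_lt_of_abs_lt h2) (lt_of_abs_lt h2)
      have := sq_lt_sq' (neg_lt_of_abs_lt h3) (lt_of_abs_lt h3)
      nlinarith [sq_pos_of_pos hρ]
    linarith

end
end
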